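/- For every α > 0 there exist η > 0 and n₀ ∈ ℕ such that for all n ≥ n₀ the following holds: if φ is an edge-colouring of the complete graph K_n that is (1+η)n/2-bounded and locally ηn-bounded, then K_n contains at least (1−α)n/2 pairwise edge-disjoint cycles, each of which is rainbow with respect to φ and has length at least (1−α)n. -/

import Mathlib

namespace Paper

variable {V : Type*} {W : Type*} {C : Type*}

/-- The set of edges of `G` receiving colour `c` under `φ`. -/
def colourCls (G : SimpleGraph V) (φ : Sym2 V → C) (c : C) : Set (Sym2 V) :=
  {e | e ∈ G.edgeSet ∧ φ e = c}

/-- `φ` is a (globally) `g`-bounded edge-colouring of `G`: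
every colour is used on at most `g` edges. -/
def GBounded (G : SimpleGraph V) (φ : Sym2 V → C) (g : ℝ) : Prop :=
  ∀ c : C, ((colourCls G φ c).ncard : ℝ) ≤ g

/-- `φ` is a locally `l`-bounded edge-colouring of `G`:
every vertex is incident to at most `l` edges of each colour. -/
def LBounded (G : SimpleGraph V) (φ : Sym2 V → C) (l : ℝ) : Prop :=
  ∀ (v : V) (c : C), (({u | G.Adj v u ∧ φ s(v, u) = c}).ncard : ℝ) ≤ l

/-- A set of edges is rainbow if the colouring is injective on it. -/
def Rainbow (φ : Sym2 V → C) (E : Set (Sym2 V)) : Prop :=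
  Set.InjOn φ E

/-- The set of common neighbours `w` of `u` and `v` with `φ(uw) = φ(vw)`. -/
def monoSet (G : SimpleGraph V) (φ : Sym2 V → C) (u v : V) : Set V :=
  {w | G.Adj u w ∧ G.Adj v w ∧ φ s(u, w) = φ s(v, w)}

/-- The monochromatic codegree `c^φ_G(u,v)`. -/
noncomputable def monoCodeg (G : SimpleGraph V) (φ : Sym2 V → C) (u v : V) : ℕ :=
  (monoSet G φ u v).ncard

/-- Degree of `u` into the set `S`. -/
noncomputable def degIn (G : SimpleGraph V) (u : V) (S : Set V) : ℕ :=
  (G.neighborSet u ∩ S).ncard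

/-- Codegree of `u,v` into the set `S`. -/
noncomputable def codegIn (G : SimpleGraph V) (u v : V) (S : Set V) : ℕ :=
  (G.neighborSet u ∩ G.neighborSet v ∩ S).ncard

/-- `G` restricted to `S` is `(ε,d)`-quasirandom: all degrees (within `S`)
are `(d ± ε)|S|` and all but at most `ε|S|²` unordered pairs of distinct
vertices of `S` have codegree (within `S`) equal to `(d² ± ε)|S|`. -/
def QuasirandomOn (G : SimpleGraph V) (S : Set V) (ε d : ℝ) : Prop :=
  (∀ v ∈ S, |(degIn G v S : ℝ) - d * S.ncard| ≤ ε * S.ncard) ∧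
  ((({p : Sym2 V | ∃ u v, p = s(u, v) ∧ u ≠ v ∧ u ∈ S ∧ v ∈ S ∧
        ¬ (|(codegIn G u v S : ℝ) - d ^ 2 * S.ncard| ≤ ε * S.ncard)}).ncard : ℝ)
      ≤ ε * (S.ncard : ℝ) ^ 2)

/-- `G` is `(ε,d)`-quasirandom. -/
def Quasirandom (G : SimpleGraph V) (ε d : ℝ) : Prop :=
  QuasirandomOn G Set.univ ε d

/-- Edges of `G` with one endpoint in `X` and the other in `Y`. -/
def edgesBetween (G : SimpleGraph V) (X Y : Set V) : Set (Sym2 V) :=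
  {e | e ∈ G.edgeSet ∧ ∃ u v, e = s(u, v) ∧ u ∈ X ∧ v ∈ Y}

/-- The pair `(A,B)` is `(ε,d)`-regular in `G`. -/
def RegularPair (G : SimpleGraph V) (A B : Set V) (ε d : ℝ) : Prop :=
  ∀ X ⊆ A, ∀ Y ⊆ B, ε * A.ncard ≤ (X.ncard : ℝ) → ε * B.ncard ≤ (Y.ncard : ℝ) →
    |((edgesBetween G X Y).ncard : ℝ) / ((X.ncard : ℝ) * (Y.ncard : ℝ)) - d| ≤ ε

/-- The pair `(A,B)` is `(ε,d)`-superregular in `G`. -/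
def SuperregularPair (G : SimpleGraph V) (A B : Set V) (ε d : ℝ) : Prop :=
  RegularPair G A B ε d ∧
  (∀ u ∈ A, |(degIn G u B : ℝ) - d * B.ncard| ≤ ε * B.ncard) ∧
  (∀ v ∈ B, |(degIn G v A : ℝ) - d * A.ncard| ≤ ε * A.ncard)

/-- `H` is a copy of `F`: a subgraph of `G` isomorphic to `F`. -/
def IsCopy (F : SimpleGraph W) {G : SimpleGraph V} (H : G.Subgraph) : Prop :=
  Nonempty (F ≃g H.coe)

/-- `L` is the union of the family `𝒞` of pairwise vertex-disjoint copies of `F`. -/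
def IsFactorFrom (F : SimpleGraph W) {G : SimpleGraph V} (L : G.Subgraph)
    (𝒞 : Set G.Subgraph) : Prop :=
  (∀ H ∈ 𝒞, IsCopy F H) ∧
  𝒞.Pairwise (fun H₁ H₂ => Disjoint H₁.verts H₂.verts) ∧
  L = sSup 𝒞

/-- `L` consists of vertex-disjoint copies of `F`. -/
def IsFFactorSub (F : SimpleGraph W) {G : SimpleGraph V} (L : G.Subgraph) : Prop :=
  ∃ 𝒞 : Set G.Subgraph, IsFactorFrom F L 𝒞

/-- An `ε`-decomposition: pairwise edge-disjoint subgraphs of `G` which together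
contain all but at most an `ε`-proportion of the edges of `G`. -/
def ApxDecomp (G : SimpleGraph V) (ε : ℝ) {t : ℕ} (L : Fin t → G.Subgraph) : Prop :=
  (Pairwise fun i j => Disjoint (L i).edgeSet (L j).edgeSet) ∧
  ((G.edgeSet \ ⋃ i, (L i).edgeSet).ncard : ℝ) ≤ ε * (G.edgeSet.ncard : ℝ)

/-- `a(F) ≤ a`, where `a(F) = max {Δ(F), a'(F), a''(F)}`. -/
def AParamLe (F : SimpleGraph W) (a : ℕ) : Prop :=
  (∀ v, (F.neighborSet v).ncard ≤ a) ∧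
  (∀ u v, F.Adj u v →
    (F.neighborSet u).ncard + (F.neighborSet v).ncard - 2 ≤ a) ∧
  (∀ u v w, F.Adj u v → F.Adj v w → u ≠ w →
    (F.neighborSet u).ncard + (F.neighborSet v).ncard + (F.neighborSet w).ncard - 4 ≤ a)

end Paper

open Paper

section

open Finset
set_option linter.unusedSectionVars false

/-- Expectation of `F S` for a random subset `S` of `Ω` containing each element independently
with probability `p`. -/
noncomputable def bernoulliMean {ι : Type*} (Ω : Finset ι) (p : ℝ) (F : Finset ι → ℝ) : ℝ :=
  ∑ S ∈ Ω.powerset, p ^ #S * (1 - p) ^ (#Ω - #S) * F S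

section bernoulli
variable {ι : Type*} {Ω : Finset ι} {p : ℝ}

lemma bernoulliMean_add (F G : Finset ι → ℝ) :
    bernoulliMean Ω p (fun S => F S + G S) = bernoulliMean Ω p F + bernoulliMean Ω p G := by
  simp only [bernoulliMean, mul_add, Finset.sum_add_distrib]

lemma bernoulliMean_mul (c : ℝ) (F : Finset ι → ℝ) :
    bernoulliMean Ω p (fun S => c * F S) = c * bernoulliMean Ω p F := by
  simp only [bernoulliMean, Finset.mul_sum]
  exact Finset.sum_congr rfl fun S _ => by ring

lemma bernoulliMean_sum {κ : Type*} (s : Finset κ) (F : κ → Finset ι → ℝ) :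
    bernoulliMean Ω p (fun S => ∑ i ∈ s, F i S) = ∑ i ∈ s, bernoulliMean Ω p (F i) := by
  simp only [bernoulliMean, Finset.mul_sum]
  exact Finset.sum_comm

lemma bernoulliMean_disjoint [DecidableEq ι] {A : Finset ι} (hA : A ⊆ Ω) :
    bernoulliMean Ω p (fun S => if Disjoint S A then 1 else 0) = (1 - p) ^ #A := by
  unfold bernoulliMean
  simp only [mul_ite, mul_one, mul_zero]
  rw [← Finset.sum_filter]
  have hset : Ω.powerset.filter (fun S => Disjoint S A) = (Ω \ A).powerset := by
    ext S
    simp only [Finset.mem_filter, Finset.mem_powerset, Finset.subset_sdiff]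
  rw [hset]
  have hcard : #Ω = #(Ω \ A) + #A := by
    rw [Finset.card_sdiff_of_subset hA]
    have := Finset.card_le_card hA
    omega
  have : ∀ S ∈ (Ω \ A).powerset, p ^ #S * (1 - p) ^ (#Ω - #S)
      = (1 - p) ^ #A * (p ^ #S * (1 - p) ^ (#(Ω \ A) - #S)) := by
    intro S hS
    have hle := Finset.card_le_card (Finset.mem_powerset.1 hS)
    have : #Ω - #S = #A + (#(Ω \ A) - #S) := by omega
    rw [this, pow_add]; ring
  rw [Finset.sum_congr rfl this, ← Finset.mul_sum, Finset.sum_pow_mul_eq_add_pow]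
  simp

lemma bernoulliMean_const (c : ℝ) : bernoulliMean Ω p (fun _ => c) = c := by
  classical
  have := bernoulliMean_disjoint (Ω := Ω) (p := p) (A := ∅) (by simp)
  simp only [Finset.disjoint_empty_right, if_true, Finset.card_empty, pow_zero] at this
  have h2 := bernoulliMean_mul (Ω := Ω) (p := p) c (fun _ => 1)
  simp only [mul_one] at h2
  rw [h2, this, mul_one]

lemma bernoulliMean_mem_disjoint [DecidableEq ι] {A : Finset ι} (hA : A ⊆ Ω) {x : ι}
    (hx : x ∈ A) :
    bernoulliMean Ω p (fun S => if x ∈ S ∧ Disjoint S (A.erase x) then 1 else 0)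
      = p * (1 - p) ^ (#A - 1) := by
  have h : (fun S : Finset ι => (if Disjoint S (A.erase x) then (1 : ℝ) else 0)) =
      fun S => (if x ∈ S ∧ Disjoint S (A.erase x) then 1 else 0)
        + (if Disjoint S A then 1 else 0) := by
    funext S
    have hd : Disjoint S A ↔ x ∉ S ∧ Disjoint S (A.erase x) := by
      conv_lhs => rw [← Finset.insert_erase hx]
      rw [Finset.disjoint_insert_right]
    by_cases h1 : x ∈ S <;> by_cases h2 : Disjoint S (A.erase x) <;> simp [hd, h1, h2]
  have h1 := bernoulliMean_disjoint (Ω := Ω) (p := p) ((Finset.erase_subset x A).trans hA)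
  rw [h, bernoulliMean_add, bernoulliMean_disjoint hA, Finset.card_erase_of_mem hx] at h1
  have h2 : #A = (#A - 1) + 1 := by have := Finset.card_pos.2 ⟨x, hx⟩; omega
  have h3 : (1 - p) ^ #A = (1 - p) ^ (#A - 1) * (1 - p) := by
    conv_lhs => rw [h2, pow_succ]
  rw [h3] at h1
  linarith

lemma exists_bernoulliMean_le (hp0 : 0 < p) (hp1 : p < 1) (F : Finset ι → ℝ) :
    ∃ S ⊆ Ω, bernoulliMean Ω p F ≤ F S := by
  by_contra! hcon
  have h1 : bernoulliMean Ω p F < bernoulliMean Ω p (fun _ => bernoulliMean Ω p F) := by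
    conv_lhs => unfold bernoulliMean
    conv_rhs => unfold bernoulliMean
    refine Finset.sum_lt_sum_of_nonempty ⟨∅, by simp⟩ fun S hS => ?_
    have := hcon S (Finset.mem_powerset.1 hS)
    have h1 : 0 < 1 - p := by linarith
    have h2 : 0 < p ^ #S * (1 - p) ^ (#Ω - #S) := by positivity
    exact mul_lt_mul_of_pos_left this h2
  rw [bernoulliMean_const] at h1
  exact lt_irrefl _ h1

end bernoulli

section nibble
variable {A V : Type} [DecidableEq A] [DecidableEq V]

/-- The members of the family `H` whose vertex set contains `v`. -/
def membersAt (H : Finset A) (vt : A → Finset V) (v : V) : Finset A := {e ∈ H | v ∈ vt e}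

/-- The members of `H` at `w`, padded by dummy elements up to `D` elements. -/
def paddedStar (H : Finset A) (vt : A → Finset V) (D : ℕ) (w : V) : Finset (A ⊕ V × ℕ) :=
  (membersAt H vt w).disjSum ({w} ×ˢ range (D - #(membersAt H vt w)))

/-- The padded members of `H` that meet `W`. -/
def blockers (H : Finset A) (vt : A → Finset V) (D : ℕ) (W : Finset V) : Finset (A ⊕ V × ℕ) :=
  W.biUnion (paddedStar H vt D)

/-- Indicator that no member of `S` meets `W`. -/
def survives (H : Finset A) (vt : A → Finset V) (D : ℕ) (W : Finset V)
    (S : Finset (A ⊕ V × ℕ)) : ℝ :=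
  if Disjoint S (blockers H vt D W) then 1 else 0

variable {H : Finset A} {vt : A → Finset V} {D κ s : ℕ}

lemma card_paddedStar {w : V} (h : #(membersAt H vt w) ≤ D) : #(paddedStar H vt D w) = D := by
  simp [paddedStar, Finset.card_disjSum]; omega

lemma card_paddedStar_inter {u w : V} (huw : u ≠ w)
    (hκ : #{e ∈ H | u ∈ vt e ∧ w ∈ vt e} ≤ κ) :
    #(paddedStar H vt D u ∩ paddedStar H vt D w) ≤ κ := by
  refine le_trans ?_ hκ
  rw [← Finset.card_map (s := {e ∈ H | u ∈ vt e ∧ w ∈ vt e})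
    (Function.Embedding.inl (β := V × ℕ))]
  refine Finset.card_le_card fun x hx => ?_
  rcases x with e | ⟨v, j⟩
  · simp only [paddedStar, membersAt, Finset.mem_inter, Finset.inl_mem_disjSum,
      Finset.mem_filter] at hx
    simp only [Finset.mem_map, Finset.mem_filter, Function.Embedding.inl_apply, Sum.inl.injEq,
      exists_eq_right]
    tauto
  · simp only [paddedStar, Finset.mem_inter, Finset.inr_mem_disjSum, Finset.mem_product,
      Finset.mem_singleton] at hx
    exact absurd (hx.1.1.symm.trans hx.2.1) huw

lemma card_blockers_le (hD : ∀ v, #(membersAt H vt v) ≤ D) (W : Finset V) :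
    #(blockers H vt D W) ≤ #W * D := by
  refine Finset.card_biUnion_le.trans ?_
  rw [Finset.sum_congr rfl fun w _ => card_paddedStar (hD w)]
  simp

lemma le_card_blockers (hD : ∀ v, #(membersAt H vt v) ≤ D)
    (hκ : ∀ u v, u ≠ v → #{e ∈ H | u ∈ vt e ∧ v ∈ vt e} ≤ κ) (W : Finset V) :
    #W * D ≤ #(blockers H vt D W) + #W ^ 2 * κ := by
  induction W using Finset.induction_on with
  | empty => simp
  | insert w W hw ih =>
    have h1 : blockers H vt D (insert w W) = paddedStar H vt D w ∪ blockers H vt D W := by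
      simp [blockers, Finset.biUnion_insert]
    have h2 := Finset.card_union_add_card_inter (paddedStar H vt D w) (blockers H vt D W)
    have h3 : #(paddedStar H vt D w ∩ blockers H vt D W) ≤ #W * κ := by
      rw [blockers, Finset.inter_biUnion]
      refine Finset.card_biUnion_le_card_mul _ _ _ fun u hu => ?_
      have : w ≠ u := fun h => hw (h ▸ hu)
      exact card_paddedStar_inter this (hκ _ _ this)
    rw [card_paddedStar (hD w)] at h2
    rw [h1, Finset.card_insert_of_notMem hw]
    nlinarith

lemma survives_mul (W W' : Finset V) (S : Finset (A ⊕ V × ℕ)) :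
    survives H vt D W S * survives H vt D W' S = survives H vt D (W ∪ W') S := by
  have : blockers H vt D (W ∪ W') = blockers H vt D W ∪ blockers H vt D W' := by
    simp [blockers, Finset.union_biUnion]
  simp only [survives, this, Finset.disjoint_union_right]
  by_cases h1 : Disjoint S (blockers H vt D W) <;>
    by_cases h2 : Disjoint S (blockers H vt D W') <;> simp [h1, h2]

lemma survives_nonneg (W : Finset V) (S : Finset (A ⊕ V × ℕ)) : 0 ≤ survives H vt D W S := by
  unfold survives; split_ifs <;> norm_num

lemma blockers_mono {W W' : Finset V} (h : W ⊆ W') :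
    blockers H vt D W ⊆ blockers H vt D W' :=
  Finset.biUnion_subset_biUnion_of_subset_left _ h

variable {Ω : Finset (A ⊕ V × ℕ)} {θ p q δ : ℝ}

lemma mean_survives {W : Finset V} (hΩ : blockers H vt D W ⊆ Ω) :
    bernoulliMean Ω p (survives H vt D W) = (1 - p) ^ #(blockers H vt D W) :=
  bernoulliMean_disjoint hΩ

lemma le_mean_survives (hp0 : 0 ≤ p) (hp1 : p ≤ 1) (hq : q = (1 - p) ^ D)
    (hD : ∀ v, #(membersAt H vt v) ≤ D) {W : Finset V}
    (hΩ : blockers H vt D W ⊆ Ω) :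
    q ^ #W ≤ bernoulliMean Ω p (survives H vt D W) := by
  rw [mean_survives hΩ, hq, ← pow_mul]
  exact pow_le_pow_of_le_one (by linarith) (by linarith)
    ((card_blockers_le hD W).trans_eq (mul_comm _ _))

lemma mean_survives_le (hp0 : 0 ≤ p) (hp1 : p ≤ 1) (hq : q = (1 - p) ^ D)
    (hD : ∀ v, #(membersAt H vt v) ≤ D)
    (hκ : ∀ u v, u ≠ v → #{e ∈ H | u ∈ vt e ∧ v ∈ vt e} ≤ κ) {W : Finset V}
    (hΩ : blockers H vt D W ⊆ Ω) :
    bernoulliMean Ω p (survives H vt D W) ≤ q ^ #W + #W ^ 2 * κ * p := by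
  rw [mean_survives hΩ]
  set B := #(blockers H vt D W)
  have h0 : (0 : ℝ) ≤ 1 - p := by linarith
  have h1 : (1 - p) ^ (B + #W ^ 2 * κ) ≤ q ^ #W := by
    rw [hq, ← pow_mul, mul_comm D]
    exact pow_le_pow_of_le_one h0 (by linarith) (le_card_blockers hD hκ W)
  have h2 : 1 + (#W ^ 2 * κ : ℕ) * (-p) ≤ (1 + -p) ^ (#W ^ 2 * κ) :=
    one_add_mul_le_pow (by linarith) _
  rw [pow_add] at h1
  have h3 : (1 - p) ^ B ≤ 1 := pow_le_one₀ h0 (by linarith)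
  have h4 : 0 ≤ (1 - p) ^ B := by positivity
  push_cast at h2
  rw [← sub_eq_add_neg] at h2
  have h5 : (0 : ℝ) ≤ #W ^ 2 * κ * p := by positivity
  nlinarith [mul_le_mul_of_nonneg_left h2 h4]

/-- The number of members at `v` that survive. -/
def survivingDeg (H : Finset A) (vt : A → Finset V) (D : ℕ) (v : V)
    (S : Finset (A ⊕ V × ℕ)) : ℝ :=
  ∑ e ∈ membersAt H vt v, survives H vt D (vt e) S

lemma card_pairs_meeting_twice (hunif : ∀ e ∈ H, #(vt e) = s + 1)
    (hκ : ∀ u v, u ≠ v → #{e ∈ H | u ∈ vt e ∧ v ∈ vt e} ≤ κ) {v : V} {e : A}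
    (he : e ∈ membersAt H vt v) :
    #{f ∈ membersAt H vt v | ¬ #(vt e ∪ vt f) = 2 * s + 1} ≤ s * κ := by
  simp only [membersAt, Finset.mem_filter] at he
  have h1 : {f ∈ membersAt H vt v | ¬ #(vt e ∪ vt f) = 2 * s + 1} ⊆
      ((vt e).erase v).biUnion fun w => {f ∈ H | v ∈ vt f ∧ w ∈ vt f} := by
    intro f hf
    simp only [membersAt, Finset.mem_filter] at hf
    simp only [Finset.mem_biUnion, Finset.mem_filter, Finset.mem_erase]
    by_contra! hcon
    have hi : vt e ∩ vt f = {v} := by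
      ext w
      simp only [Finset.mem_inter, Finset.mem_singleton]
      constructor
      · rintro ⟨h1, h2⟩
        by_contra hne
        exact hcon w ⟨hne, h1⟩ hf.1.1 hf.1.2 h2
      · rintro rfl; exact ⟨he.2, hf.1.2⟩
    have := Finset.card_union_add_card_inter (vt e) (vt f)
    rw [hi, hunif e he.1, hunif f hf.1.1, Finset.card_singleton] at this
    exact hf.2 (by omega)
  refine (Finset.card_le_card h1).trans ?_
  have h2 : #((vt e).erase v) = s := by
    rw [Finset.card_erase_of_mem he.2, hunif e he.1]; rfl
  rw [← h2]
  refine Finset.card_biUnion_le_card_mul _ _ _ fun w hw => hκ _ _ ?_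
  exact (Finset.ne_of_mem_erase hw).symm

lemma variance_survivingDeg_le (hp0 : 0 ≤ p) (hp1 : p ≤ 1) (hq : q = (1 - p) ^ D)
    (hunif : ∀ e ∈ H, #(vt e) = s + 1)
    (hD : ∀ v, #(membersAt H vt v) ≤ D)
    (hκ : ∀ u v, u ≠ v → #{e ∈ H | u ∈ vt e ∧ v ∈ vt e} ≤ κ) (hpD : p * D ≤ 1)
    (hκD : (κ : ℝ) ≤ δ * D) (v : V)
    (hΩ : ∀ e ∈ membersAt H vt v, ∀ f ∈ membersAt H vt v, blockers H vt D (vt e ∪ vt f) ⊆ Ω)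
    (hΩ' : blockers H vt D {v} ⊆ Ω) :
    bernoulliMean Ω p (fun S => survives H vt D {v} S *
        (survivingDeg H vt D v S - #(membersAt H vt v) * q ^ s) ^ 2)
      ≤ ((2 * s + 1) ^ 2 + s) * δ * D ^ 2 := by
  set d : ℝ := ((#(membersAt H vt v) : ℕ) : ℝ) with hd
  set m : ℝ := d * q ^ s with hm
  have hq0 : 0 ≤ q := by rw [hq]; exact pow_nonneg (by linarith) _
  have hd0 : 0 ≤ d := by positivity
  have hdD : d ≤ D := by rw [hd]; exact_mod_cast hD v
  have hm0 : 0 ≤ m := by positivity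
  have hvt : ∀ e ∈ membersAt H vt v, {v} ∪ vt e = vt e := by
    intro e he
    simp only [membersAt, Finset.mem_filter] at he
    exact Finset.union_eq_right.2 (by simpa using he.2)
  have hΩe : ∀ e ∈ membersAt H vt v, blockers H vt D (vt e) ⊆ Ω := by
    intro e he; simpa using hΩ e he e he
  have hexp : ∀ S, survives H vt D {v} S * (survivingDeg H vt D v S - m) ^ 2 =
      (∑ e ∈ membersAt H vt v, ∑ f ∈ membersAt H vt v, survives H vt D (vt e ∪ vt f) S) +
      ((-2 * m) * (∑ e ∈ membersAt H vt v, survives H vt D (vt e) S) +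
        m ^ 2 * survives H vt D {v} S) := by
    intro S
    have h1 : survives H vt D {v} S * survivingDeg H vt D v S = survivingDeg H vt D v S := by
      unfold survivingDeg
      rw [Finset.mul_sum]
      exact Finset.sum_congr rfl fun e he => by rw [survives_mul, hvt e he]
    have h2 : survivingDeg H vt D v S * survivingDeg H vt D v S =
        ∑ e ∈ membersAt H vt v, ∑ f ∈ membersAt H vt v, survives H vt D (vt e ∪ vt f) S := by
      unfold survivingDeg
      rw [Finset.sum_mul_sum]
      simp only [survives_mul]
    rw [← h2]
    change _ = _ + (-2 * m * survivingDeg H vt D v S + _)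
    calc _ = (survives H vt D {v} S * survivingDeg H vt D v S) * survivingDeg H vt D v S
          - 2 * m * (survives H vt D {v} S * survivingDeg H vt D v S)
          + m ^ 2 * survives H vt D {v} S := by ring
      _ = _ := by rw [h1]; ring
  have hrw : (fun S => survives H vt D {v} S * (survivingDeg H vt D v S - m) ^ 2) = _ :=
    funext hexp
  rw [hrw, bernoulliMean_add, bernoulliMean_add, bernoulliMean_mul, bernoulliMean_mul,
    bernoulliMean_sum, bernoulliMean_sum]
  have hA : ∀ e ∈ membersAt H vt v, bernoulliMean Ω p
      (fun S => ∑ f ∈ membersAt H vt v, survives H vt D (vt e ∪ vt f) S) ≤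
      d * (q ^ (2 * s + 1) + (2 * s + 1) ^ 2 * δ) + s * κ := by
    intro e he
    rw [bernoulliMean_sum]
    have hb : ∀ f ∈ membersAt H vt v, bernoulliMean Ω p (survives H vt D (vt e ∪ vt f)) ≤
        (q ^ (2 * s + 1) + (2 * s + 1) ^ 2 * δ) +
          (if ¬ #(vt e ∪ vt f) = 2 * s + 1 then 1 else 0) := by
      intro f hf
      have hδ : (κ : ℝ) * p ≤ δ := by
        have hp2 : (κ : ℝ) * p ≤ δ * (p * D) := by
          calc (κ : ℝ) * p ≤ δ * D * p := by gcongr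
            _ = _ := by ring
        by_cases hδ0 : 0 ≤ δ
        · nlinarith
        · have : δ * (D:ℝ) ≤ 0 := by
            have : (0 : ℝ) ≤ D := by positivity
            nlinarith
          have hk : (κ : ℝ) = 0 := le_antisymm (hκD.trans this) (by positivity)
          have hD0 : (D : ℝ) = 0 := by
            rw [hk] at hκD
            have : (0 : ℝ) ≤ D := by positivity
            nlinarith
          have : D = 0 := by exact_mod_cast hD0
          have h3 := hD v
          rw [this] at h3
          have : #(membersAt H vt v) = 0 := by omega
          rw [Finset.card_eq_zero] at this
          rw [this] at he; simp at he
      have hδ0 : 0 ≤ δ := le_trans (by positivity) hδ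
      by_cases hc : #(vt e ∪ vt f) = 2 * s + 1
      · have := mean_survives_le hp0 hp1 hq hD hκ (hΩ e he f hf)
        rw [hc] at this
        rw [if_neg (by simpa using hc), add_zero]
        refine this.trans ?_
        push_cast
        rw [mul_assoc]
        gcongr
      · rw [if_pos hc]
        have : bernoulliMean Ω p (survives H vt D (vt e ∪ vt f)) ≤ 1 := by
          rw [mean_survives (hΩ e he f hf)]
          exact pow_le_one₀ (by linarith) (by linarith)
        have h2 : 0 ≤ q ^ (2 * s + 1) + (2 * s + 1) ^ 2 * δ := by positivity
        linarith
    refine (Finset.sum_le_sum hb).trans ?_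
    rw [Finset.sum_add_distrib, Finset.sum_const, nsmul_eq_mul, ← Finset.sum_filter,
      Finset.sum_const, nsmul_eq_mul, mul_one]
    gcongr
    exact_mod_cast card_pairs_meeting_twice hunif hκ he
  have hA' := Finset.sum_le_sum hA
  rw [Finset.sum_const, nsmul_eq_mul] at hA'
  have hB : d * q ^ (s + 1) ≤
      ∑ e ∈ membersAt H vt v, bernoulliMean Ω p (fun S => survives H vt D (vt e) S) := by
    rw [hd, ← nsmul_eq_mul, ← Finset.sum_const]
    refine Finset.sum_le_sum fun e he => ?_
    have := le_mean_survives hp0 hp1 hq hD (hΩe e he)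
    rwa [hunif e (Finset.mem_of_mem_filter e he)] at this
  have hC : bernoulliMean Ω p (fun S => survives H vt D {v} S) = q := by
    have := mean_survives (p := p) hΩ'
    rw [this, hq]
    simp [blockers, card_paddedStar (hD v)]
  rw [hC]
  have hB' := mul_le_mul_of_nonneg_left hB hm0
  have hfin : d * (d * ((2 * s + 1) ^ 2 * δ) + s * κ) ≤ ((2 * s + 1) ^ 2 + s) * δ * D ^ 2 := by
    rcases hd0.eq_or_lt with h0 | h0
    · rw [← h0]
      by_cases hδ0 : 0 ≤ δ
      · simp only [zero_mul]; positivity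
      · have : (0 : ℝ) ≤ D := by positivity
        have h2 : (0 : ℝ) ≤ δ * D := le_trans (by positivity) hκD
        have : ((2 * (s:ℝ) + 1) ^ 2 + s) * δ * D ^ 2 =
          ((2 * (s:ℝ) + 1) ^ 2 + s) * ((δ * D) * D) := by ring
        rw [this]; simp only [zero_mul]; positivity
    · have hDpos : (0 : ℝ) < D := lt_of_lt_of_le h0 hdD
      have hδ0 : 0 ≤ δ := by
        by_contra hneg
        have : (0:ℝ) ≤ κ := by positivity
        nlinarith
      calc d * (d * ((2 * s + 1) ^ 2 * δ) + s * κ)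
          ≤ D * (D * ((2 * s + 1) ^ 2 * δ) + s * (δ * D)) := by gcongr
        _ = _ := by ring
  have hpow : d * (d * q ^ (2 * s + 1)) + (-2 * m) * (d * q ^ (s + 1)) + m ^ 2 * q = 0 := by
    rw [hm]; ring
  nlinarith

end nibble

section matching
variable {A V : Type} [DecidableEq A] [DecidableEq V]
variable {H : Finset A} {vt : A → Finset V} {D κ s : ℕ}

lemma sum_card_membersAt {r : ℕ} (hunif : ∀ e ∈ H, #(vt e) = r) :
    ∑ v ∈ H.biUnion vt, #(membersAt H vt v) = r * #H := by
  have h := Finset.sum_card_bipartiteAbove_eq_sum_card_bipartiteBelow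
    (s := H.biUnion vt) (t := H) (fun v e => v ∈ vt e)
  have h1 : ∀ v, #(membersAt H vt v) = #(Finset.bipartiteAbove (fun v e => v ∈ vt e) H v) :=
    fun v => rfl
  simp only [h1, h]
  have h2 : ∀ e ∈ H, #(Finset.bipartiteBelow (fun v e => v ∈ vt e) (H.biUnion vt) e) = r := by
    intro e he
    rw [← hunif e he]
    congr 1
    ext v
    simp only [Finset.bipartiteBelow, Finset.mem_filter, Finset.mem_biUnion]
    exact ⟨fun h => h.2, fun h => ⟨⟨e, he, h⟩, h⟩⟩
  rw [Finset.sum_congr rfl h2]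
  simp [mul_comm]

lemma inl_mem_blockers {e : A} (he : e ∈ H) {w : V} {W : Finset V} (h1 : w ∈ vt e) (h2 : w ∈ W) :
    (Sum.inl e : A ⊕ V × ℕ) ∈ blockers H vt D W := by
  simp only [blockers, Finset.mem_biUnion, paddedStar, Finset.inl_mem_disjSum, membersAt,
    Finset.mem_filter]
  exact ⟨w, h2, he, h1⟩

lemma nibble_round {θ ξ δ p q c : ℝ} (hθ0 : 0 < θ) (hθ1 : θ ≤ 1 / 2) (hξ : 0 < ξ) (hc : 0 ≤ c)
    (hDpos : 0 < D) (hp : p = θ / D) (hq : q = (1 - p) ^ D)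
    (hunif : ∀ e ∈ H, #(vt e) = s + 1)
    (hD : ∀ v, #(membersAt H vt v) ≤ D)
    (hκ : ∀ u v, u ≠ v → #{e ∈ H | u ∈ vt e ∧ v ∈ vt e} ≤ κ)
    (hκD : (κ : ℝ) ≤ δ * D) :
    ∃ M ⊆ H, ∃ H' ⊆ H, (∀ e ∈ M, ∀ f ∈ M, e ≠ f → Disjoint (vt e) (vt f)) ∧
      (∀ e ∈ M, ∀ f ∈ H', Disjoint (vt e) (vt f)) ∧
      (∀ v, #(membersAt H' vt v) ≤ ⌊(1 + ξ) * D * q ^ s⌋₊) ∧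
      #H * (θ / D * q ^ (s + 1)) +
        c * (#H * (q ^ (s + 1) - (s + 1) * ((2 * s + 1) ^ 2 + s) * δ / (ξ * q ^ s) ^ 2))
        ≤ #M + c * #H' := by
  classical
  have hDr : (0 : ℝ) < D := by exact_mod_cast hDpos
  have hp0 : 0 < p := by rw [hp]; positivity
  have hD1 : (1 : ℝ) ≤ D := by exact_mod_cast hDpos
  have hp1 : p < 1 := by
    rw [hp, div_lt_one hDr]; linarith
  have hpD : p * D ≤ 1 := by
    rw [hp]; field_simp; linarith
  have hq0 : 0 < q := by rw [hq]; exact pow_pos (by linarith) _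
  set U := H.biUnion vt with hU
  set Ω := blockers H vt D U with hΩdef
  have hsub : ∀ e ∈ H, vt e ⊆ U := fun e he => Finset.subset_biUnion_of_mem vt he
  have hΩ : ∀ {W}, W ⊆ U → blockers H vt D W ⊆ Ω := fun h => blockers_mono h
  let Mf : Finset (A ⊕ V × ℕ) → Finset A := fun S =>
    {e ∈ H | Sum.inl e ∈ S ∧ Disjoint S ((blockers H vt D (vt e)).erase (Sum.inl e))}
  let Sv : Finset (A ⊕ V × ℕ) → Finset A := fun S =>
    {e ∈ H | Disjoint S (blockers H vt D (vt e))}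
  let Hf : Finset (A ⊕ V × ℕ) → Finset A := fun S =>
    {e ∈ Sv S | ∀ v ∈ vt e, survivingDeg H vt D v S ≤ (1 + ξ) * D * q ^ s}
  let loss : V → Finset (A ⊕ V × ℕ) → ℝ := fun v S =>
    (#(membersAt H vt v) / (ξ * D * q ^ s) ^ 2) * (survives H vt D {v} S *
        (survivingDeg H vt D v S - #(membersAt H vt v) * q ^ s) ^ 2)
  let F : Finset (A ⊕ V × ℕ) → ℝ := fun S =>
    (∑ e ∈ H, if Sum.inl e ∈ S ∧ Disjoint S ((blockers H vt D (vt e)).erase (Sum.inl e))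
      then (1 : ℝ) else 0) +
    c * ((∑ e ∈ H, survives H vt D (vt e) S) + (-1) * ∑ v ∈ U, loss v S)
  have hmean : #H * (θ / D * q ^ (s + 1)) +
        c * (#H * (q ^ (s + 1) - (s + 1) * ((2 * s + 1) ^ 2 + s) * δ / (ξ * q ^ s) ^ 2))
        ≤ bernoulliMean Ω p F := by
    simp only [F]
    rw [bernoulliMean_add, bernoulliMean_mul, bernoulliMean_add, bernoulliMean_mul,
      bernoulliMean_sum, bernoulliMean_sum, bernoulliMean_sum]
    have h1 : #H * (θ / D * q ^ (s + 1)) ≤ ∑ e ∈ H, bernoulliMean Ω p (fun S =>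
        if Sum.inl e ∈ S ∧ Disjoint S ((blockers H vt D (vt e)).erase (Sum.inl e))
        then (1 : ℝ) else 0) := by
      rw [← nsmul_eq_mul, ← Finset.sum_const]
      refine Finset.sum_le_sum fun e he => ?_
      obtain ⟨w, hw⟩ : (vt e).Nonempty := by
        rw [← Finset.card_pos, hunif e he]; omega
      rw [bernoulliMean_mem_disjoint (hΩ (hsub e he)) (inl_mem_blockers he hw hw), ← hp]
      have h3 := card_blockers_le hD (vt e)
      rw [hunif e he] at h3
      have : q ^ (s + 1) ≤ (1 - p) ^ (#(blockers H vt D (vt e)) - 1) := by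
        rw [hq, ← pow_mul]
        refine pow_le_pow_of_le_one (by linarith) (by linarith) ?_
        rw [mul_comm]; omega
      gcongr
    have h2 : #H * q ^ (s + 1) ≤
        ∑ e ∈ H, bernoulliMean Ω p (fun S => survives H vt D (vt e) S) := by
      rw [← nsmul_eq_mul, ← Finset.sum_const]
      refine Finset.sum_le_sum fun e he => ?_
      have := le_mean_survives hp0.le hp1.le hq hD (hΩ (hsub e he))
      rwa [hunif e he] at this
    have h3 : ∑ v ∈ U, bernoulliMean Ω p (loss v) ≤
        #H * ((s + 1) * ((2 * s + 1) ^ 2 + s) * δ / (ξ * q ^ s) ^ 2) := by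
      have h4 : ∀ v ∈ U, bernoulliMean Ω p (loss v) ≤
          #(membersAt H vt v) * ((((2 * s + 1) ^ 2 + s) * δ) / (ξ * q ^ s) ^ 2) := by
        intro v hv
        simp only [loss]
        rw [bernoulliMean_mul]
        have := variance_survivingDeg_le (Ω := Ω) hp0.le hp1.le hq hunif hD hκ hpD hκD v
          (fun e he f hf => hΩ (Finset.union_subset (hsub e (Finset.mem_of_mem_filter e he))
            (hsub f (Finset.mem_of_mem_filter f hf))))
          (hΩ (by simpa using hv))
        refine (mul_le_mul_of_nonneg_left this (by positivity)).trans (le_of_eq ?_)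
        field_simp
      refine (Finset.sum_le_sum h4).trans (le_of_eq ?_)
      rw [← Finset.sum_mul, ← Nat.cast_sum, sum_card_membersAt hunif]
      push_cast; ring
    have h5 : #H * (q ^ (s + 1) - (s + 1) * ((2 * s + 1) ^ 2 + s) * δ / (ξ * q ^ s) ^ 2) ≤
      (∑ e ∈ H, bernoulliMean Ω p (fun S => survives H vt D (vt e) S)) +
        (-1) * ∑ v ∈ U, bernoulliMean Ω p (loss v) := by linarith
    exact add_le_add h1 (mul_le_mul_of_nonneg_left h5 hc)
  obtain ⟨S, hS, hFS⟩ := exists_bernoulliMean_le (Ω := Ω) hp0 hp1 F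
  refine ⟨Mf S, Finset.filter_subset _ _, Hf S,
    (Finset.filter_subset _ _).trans (Finset.filter_subset _ _), ?_, ?_, ?_, ?_⟩
  · intro e he f hf hef
    simp only [Mf, Finset.mem_filter] at he hf
    rw [Finset.disjoint_left]
    intro w hwe hwf
    refine Finset.disjoint_left.1 he.2.2 hf.2.1 (Finset.mem_erase.2 ⟨?_, ?_⟩)
    · simpa using fun h => hef h.symm
    · exact inl_mem_blockers hf.1 hwf hwe
  · intro e he f hf
    simp only [Mf, Hf, Sv, Finset.mem_filter] at he hf
    rw [Finset.disjoint_left]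
    intro w hwe hwf
    exact Finset.disjoint_left.1 hf.1.2 he.2.1 (inl_mem_blockers he.1 hwe hwf)
  · intro v
    rcases (membersAt (Hf S) vt v).eq_empty_or_nonempty with h | ⟨e, he⟩
    · rw [h]; simp
    · have he' := he
      simp only [membersAt, Hf, Finset.mem_filter] at he
      refine Nat.le_floor (le_trans ?_ (he.1.2 v he.2))
      simp only [survivingDeg, survives]
      rw [← Finset.sum_filter, Finset.sum_const, nsmul_eq_mul, mul_one]
      norm_cast
      refine Finset.card_le_card fun f hf => ?_
      simp only [membersAt, Hf, Sv, Finset.mem_filter] at hf ⊢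
      exact ⟨⟨hf.1.1.1, hf.2⟩, hf.1.1.2⟩
  · refine hmean.trans (hFS.trans ?_)
    simp only [F]
    refine add_le_add (le_of_eq ?_) (mul_le_mul_of_nonneg_left ?_ hc)
    · rw [← Finset.sum_filter, Finset.sum_const, nsmul_eq_mul, mul_one]
    · have h1 : ∑ e ∈ H, survives H vt D (vt e) S = #(Sv S) := by
        simp only [survives, Sv]
        rw [← Finset.sum_filter, Finset.sum_const, nsmul_eq_mul, mul_one]
      rw [h1]
      have h2 : (Sv S) ⊆ Hf S ∪ {v ∈ U | (1 + ξ) * D * q ^ s < survivingDeg H vt D v S}.biUnion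
          (membersAt H vt) := by
        intro e he
        by_cases hg : ∀ v ∈ vt e, survivingDeg H vt D v S ≤ (1 + ξ) * D * q ^ s
        · exact Finset.mem_union_left _ (Finset.mem_filter.2 ⟨he, hg⟩)
        · push Not at hg
          obtain ⟨v, hv, hlt⟩ := hg
          have heH : e ∈ H := Finset.mem_of_mem_filter e he
          refine Finset.mem_union_right _ (Finset.mem_biUnion.2 ⟨v, ?_, ?_⟩)
          · exact Finset.mem_filter.2 ⟨hsub e heH hv, hlt⟩
          · exact Finset.mem_filter.2 ⟨heH, hv⟩
      have h3 : (#(Sv S) : ℝ) ≤ #(Hf S) +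
          ∑ v ∈ U with (1 + ξ) * D * q ^ s < survivingDeg H vt D v S, (#(membersAt H vt v) : ℝ) := by
        have := (Finset.card_le_card h2).trans ((Finset.card_union_le _ _).trans
          (Nat.add_le_add_left Finset.card_biUnion_le _))
        exact_mod_cast this
      have hloss0 : ∀ v, 0 ≤ loss v S := fun v => by
        have := survives_nonneg (H := H) (vt := vt) (D := D) {v} S
        simp only [loss]; positivity
      have h4 : ∑ v ∈ U with (1 + ξ) * D * q ^ s < survivingDeg H vt D v S,
          (#(membersAt H vt v) : ℝ) ≤ ∑ v ∈ U, loss v S := by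
        rw [Finset.sum_filter]
        refine Finset.sum_le_sum fun v hv => ?_
        split_ifs with hlt
        · have hpos : 0 < survivingDeg H vt D v S := lt_of_le_of_lt (by positivity) hlt
          have hsurv : survives H vt D {v} S = 1 := by
            unfold survivingDeg at hpos
            obtain ⟨e, he, hne⟩ := Finset.exists_ne_zero_of_sum_ne_zero hpos.ne'
            simp only [membersAt, Finset.mem_filter] at he
            unfold survives at hne ⊢
            have hd : Disjoint S (blockers H vt D (vt e)) := by
              by_contra hcon; rw [if_neg hcon] at hne; exact hne rfl
            rw [if_pos (hd.mono_right (blockers_mono (by simpa using he.2)))]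
          simp only [loss, hsurv, one_mul]
          have hdD : (#(membersAt H vt v) : ℝ) ≤ D := by exact_mod_cast hD v
          have hx : ξ * D * q ^ s ≤ survivingDeg H vt D v S - #(membersAt H vt v) * q ^ s := by
            have : (#(membersAt H vt v) : ℝ) * q ^ s ≤ D * q ^ s := by gcongr
            nlinarith
          have hx0 : 0 < ξ * D * q ^ s := by positivity
          have hsq : (ξ * D * q ^ s) ^ 2 ≤
            (survivingDeg H vt D v S - #(membersAt H vt v) * q ^ s) ^ 2 := by gcongr
          rw [div_mul_eq_mul_div, le_div_iff₀ (by positivity)]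
          gcongr
        · exact hloss0 v
      linarith

end matching

/-- Every `r`-uniform family of maximum degree `D` and sufficiently small codegrees contains a
matching of size at least `a * #H / D`. -/
def HasLargeMatchings (r : ℕ) (a : ℝ) : Prop :=
  ∃ δ : ℝ, 0 < δ ∧ ∀ (A V : Type) [DecidableEq A] [DecidableEq V] (H : Finset A)
    (vt : A → Finset V) (D κ : ℕ), (∀ e ∈ H, #(vt e) = r) → (∀ v, #(membersAt H vt v) ≤ D) →
    (∀ u v, u ≠ v → #{e ∈ H | u ∈ vt e ∧ v ∈ vt e} ≤ κ) → 1 ≤ κ → (κ : ℝ) ≤ δ * D →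
    ∃ M ⊆ H, (∀ e ∈ M, ∀ f ∈ M, e ≠ f → Disjoint (vt e) (vt f)) ∧ a * #H ≤ #M * D

lemma HasLargeMatchings.mono {r : ℕ} {a b : ℝ} (h : HasLargeMatchings r b) (hab : a ≤ b) :
    HasLargeMatchings r a := by
  obtain ⟨δ, hδ, h⟩ := h
  refine ⟨δ, hδ, fun A V _ _ H vt D κ h1 h2 h3 h4 h5 => ?_⟩
  obtain ⟨M, hM, h6, h7⟩ := h A V H vt D κ h1 h2 h3 h4 h5
  refine ⟨M, hM, h6, le_trans ?_ h7⟩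
  gcongr

lemma HasLargeMatchings.zero (r : ℕ) : HasLargeMatchings r 0 :=
  ⟨1, one_pos, fun A V _ _ H vt D κ _ _ _ _ _ => ⟨∅, by simp, by simp, by simp⟩⟩

lemma nibble_gain_identity {x θ D q a ξ e : ℝ} {s : ℕ} (hD : D ≠ 0) (hq : q ≠ 0)
    (hξ : 1 + ξ ≠ 0) :
    x * (θ * q ^ (s + 1) + a * ((q - e) / (1 + ξ))) =
      (x * (θ / D * q ^ (s + 1)) +
        a / ((1 + ξ) * D * q ^ s) * (x * (q ^ (s + 1) - e * q ^ s))) * D := by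
  have hqs : q ^ s ≠ 0 := pow_ne_zero _ hq
  rw [pow_succ]
  field_simp

set_option maxHeartbeats 1000000 in
lemma HasLargeMatchings.extend {s : ℕ} {a θ : ℝ} (ha0 : 0 ≤ a) (hθ0 : 0 < θ)
    (hθ1 : θ ≤ 1 / 2) (h : HasLargeMatchings (s + 1) a) :
    HasLargeMatchings (s + 1) (θ * (1 - θ) ^ (s + 1) + a * (1 - θ - θ ^ 2)) := by
  obtain ⟨δ', hδ', h⟩ := h
  set ξ := θ ^ 2 / 2 with hξ
  have hξ0 : 0 < ξ := by positivity
  set C : ℝ := (s + 1) * ((2 * s + 1) ^ 2 + s) * 4 ^ s * 2 ^ s / ξ ^ 2 with hC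
  have hC0 : 0 < C := by positivity
  refine ⟨min (min (δ' / 2 ^ s) (ξ / 2 ^ s)) (θ ^ 2 / (2 * C)), by positivity, ?_⟩
  set δ := min (min (δ' / 2 ^ s) (ξ / 2 ^ s)) (θ ^ 2 / (2 * C)) with hδ
  have hδ1 : δ * 2 ^ s ≤ δ' := by
    rw [← le_div_iff₀ (by positivity)]; exact (min_le_left _ _).trans (min_le_left _ _)
  have hδ2 : δ * 2 ^ s ≤ ξ := by
    rw [← le_div_iff₀ (by positivity)]; exact (min_le_left _ _).trans (min_le_right _ _)
  have hδ3 : C * δ ≤ θ ^ 2 / 2 := by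
    have : δ ≤ θ ^ 2 / (2 * C) := min_le_right _ _
    rw [le_div_iff₀ (by positivity)] at this
    linarith
  have hδ0 : 0 < δ := by positivity
  intro A V _ _ H vt D κ hunif hD hκ hκ1 hκD
  have hκ1' : (1 : ℝ) ≤ κ := by exact_mod_cast hκ1
  have hδD : 1 ≤ δ * D := hκ1'.trans hκD
  have hDr : (0 : ℝ) < D := by
    by_contra hcon
    have : (D : ℝ) ≤ 0 := not_lt.1 hcon
    nlinarith
  have hDpos : 0 < D := by exact_mod_cast hDr
  obtain ⟨p, hp⟩ : ∃ p, p = θ / D := ⟨_, rfl⟩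
  obtain ⟨q, hq⟩ : ∃ q, q = (1 - p) ^ D := ⟨_, rfl⟩
  have hD1 : (1 : ℝ) ≤ D := by exact_mod_cast hDpos
  have hp0 : 0 < p := by rw [hp]; positivity
  have hp1 : p ≤ 1 / 2 := by
    rw [hp, div_le_iff₀ hDr]; nlinarith
  have hq1 : q ≤ 1 := by rw [hq]; exact pow_le_one₀ (by linarith) (by linarith)
  have hqθ : 1 - θ ≤ q := by
    have := one_add_mul_le_pow (a := -p) (by linarith) D
    rw [hq, sub_eq_add_neg 1 p]
    refine le_trans (le_of_eq ?_) this
    rw [hp]; field_simp; ring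
  have hqhalf : 1 / 2 ≤ q := by linarith
  have hq0 : 0 < q := by linarith
  have hqs : (1 / 2 : ℝ) ^ s ≤ q ^ s := by gcongr
  have hqs0 : 0 < q ^ s := by positivity
  have hqs2 : 1 ≤ q ^ s * 2 ^ s := by
    rw [← mul_pow]; exact one_le_pow₀ (by linarith)
  set c := a / ((1 + ξ) * D * q ^ s) with hcdef
  have hc0 : 0 ≤ c := by positivity
  obtain ⟨M, hM, H', hH', hM1, hM2, hdeg, hmain⟩ :=
    nibble_round hθ0 hθ1 hξ0 hc0 hDpos hp hq hunif hD hκ hκD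
  set D' := ⌊(1 + ξ) * D * q ^ s⌋₊ with hD'
  have hD'le : (D' : ℝ) ≤ (1 + ξ) * D * q ^ s := Nat.floor_le (by positivity)
  have hD'ge : (κ : ℝ) ≤ δ' * D' := by
    have h1 : (1 + ξ) * D * q ^ s < D' + 1 := Nat.lt_floor_add_one _
    have h2 : 1 ≤ ξ * D * q ^ s := by
      have : 1 ≤ (ξ * D) * (1 / 2 ^ s) := by
        rw [mul_one_div, le_div_iff₀ (by positivity)]
        nlinarith [show (0:ℝ) < 2 ^ s by positivity]
      refine this.trans ?_
      have : (1 : ℝ) / 2 ^ s ≤ q ^ s := by rw [← one_div_pow]; exact hqs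
      gcongr
    have h3 : D * q ^ s ≤ D' := by nlinarith
    have h4 : (D : ℝ) ≤ D' * 2 ^ s := by
      calc (D : ℝ) ≤ D * (q ^ s * 2 ^ s) := le_mul_of_one_le_right hDr.le hqs2
        _ = D * q ^ s * 2 ^ s := by ring
        _ ≤ _ := by gcongr
    calc (κ : ℝ) ≤ δ * D := hκD
      _ ≤ δ * (D' * 2 ^ s) := by gcongr
      _ = (δ * 2 ^ s) * D' := by ring
      _ ≤ _ := by gcongr
  have hunif' : ∀ e ∈ H', #(vt e) = s + 1 := fun e he => hunif e (hH' he)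
  obtain ⟨M', hM', hdis, hsize⟩ := h A V H' vt D' κ hunif' hdeg
    (fun u v huv => (Finset.card_le_card (Finset.filter_subset_filter _ hH')).trans (hκ u v huv))
    hκ1 hD'ge
  have hMM' : Disjoint M M' := by
    rw [Finset.disjoint_left]
    intro e he he'
    have := hM2 e he e (hM' he')
    rw [disjoint_self] at this
    have h2 := hunif e (hM he)
    rw [this] at h2; simp at h2
  refine ⟨M ∪ M', Finset.union_subset hM (hM'.trans hH'), ?_, ?_⟩
  · intro e he f hf hef
    rcases Finset.mem_union.1 he with he | he <;> rcases Finset.mem_union.1 hf with hf | hf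
    · exact hM1 e he f hf hef
    · exact hM2 e he f (hM' hf)
    · exact (hM2 f hf e (hM' he)).symm
    · exact hdis e he f hf hef
  · rw [Finset.card_union_of_disjoint hMM']
    have h1 : c * #H' ≤ #M' := by
      rw [hcdef, div_mul_eq_mul_div, div_le_iff₀ (by positivity)]
      exact hsize.trans (by gcongr)
    push_cast
    have h2 := hmain.trans (add_le_add_right h1 (#M : ℝ))
    have hE : (s + 1) * ((2 * s + 1) ^ 2 + s) * δ / (ξ * q ^ s) ^ 2 ≤ (θ ^ 2 / 2) * q ^ s := by
      have h4 : (4 : ℝ) ^ s = 2 ^ s * 2 ^ s := by rw [← mul_pow]; norm_num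
      have h3 : (s + 1) * ((2 * s + 1) ^ 2 + s) * δ / (ξ * q ^ s) ^ 2 =
        C * δ / ((q ^ s * 2 ^ s) ^ 3) * q ^ s := by
        rw [hC, h4]; field_simp
      rw [h3]
      refine mul_le_mul_of_nonneg_right ?_ hqs0.le
      refine le_trans (div_le_self (by positivity) ?_) hδ3
      exact one_le_pow₀ hqs2
    have h3 : #H * (θ / D * q ^ (s + 1)) + c * (#H * (q ^ (s + 1) - (θ ^ 2 / 2) * q ^ s)) ≤
        #M + #M' := by
      refine le_trans ?_ h2
      gcongr
    have h4 : #H * (θ * q ^ (s + 1) + a * ((q - θ ^ 2 / 2) / (1 + ξ))) ≤ (#M + #M') * D := by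
      refine le_trans (le_of_eq ?_) (mul_le_mul_of_nonneg_right h3 hDr.le)
      rw [hcdef]
      exact nibble_gain_identity hDr.ne' hq0.ne' (by linarith)
    rw [mul_comm]
    refine le_trans (mul_le_mul_of_nonneg_left (add_le_add ?_ ?_) (Nat.cast_nonneg _)) h4
    · have : 0 ≤ 1 - θ := by linarith
      exact mul_le_mul_of_nonneg_left (pow_le_pow_left₀ this hqθ _) hθ0.le
    · refine mul_le_mul_of_nonneg_left ?_ ha0
      rw [le_div_iff₀ (by linarith), hξ]
      nlinarith [sq_nonneg θ, pow_pos hθ0 3, pow_pos hθ0 4]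

theorem hasLargeMatchings (s : ℕ) {a : ℝ} (ha : a < 1) : HasLargeMatchings (s + 1) a := by
  have hlim : Filter.Tendsto (fun θ : ℝ => (1 - θ) ^ (s + 1) / (1 + θ)) (nhds 0) (nhds 1) := by
    have : ContinuousAt (fun θ : ℝ => (1 - θ) ^ (s + 1) / (1 + θ)) 0 := by
      refine ContinuousAt.div (by fun_prop) (by fun_prop) (by norm_num)
    simpa using this.tendsto
  have hev := (hlim.eventually (lt_mem_nhds ha)).filter_mono (nhdsWithin_le_nhds (s := Set.Ioi 0))
  have hev2 : ∀ᶠ θ : ℝ in nhdsWithin 0 (Set.Ioi 0), θ ≤ 1 / 2 :=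
    (Filter.Eventually.filter_mono nhdsWithin_le_nhds (ge_mem_nhds (by norm_num)))
  obtain ⟨θ, ⟨h1, hθ1⟩, hθ0⟩ := ((hev.and hev2).and self_mem_nhdsWithin).exists
  have hθ0 : 0 < θ := hθ0
  set L := (1 - θ) ^ (s + 1) / (1 + θ) with hL
  set ρ := 1 - θ - θ ^ 2 with hρ
  have hρ0 : 0 < ρ := by nlinarith
  have hρ1 : ρ < 1 := by nlinarith
  have hL0 : 0 < L := by
    have : 0 < 1 - θ := by linarith
    positivity
  have hL1 : L ≤ 1 := by
    rw [hL, div_le_one (by linarith)]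
    have : (1 - θ) ^ (s + 1) ≤ 1 := pow_le_one₀ (by linarith) (by linarith)
    linarith
  have key : ∀ t : ℕ, HasLargeMatchings (s + 1) (L * (1 - ρ ^ t)) := by
    intro t
    induction t with
    | zero => simpa using HasLargeMatchings.zero (s + 1)
    | succ t ih =>
      have hρt : ρ ^ t ≤ 1 := pow_le_one₀ hρ0.le hρ1.le
      have hρt0 : 0 < ρ ^ t := by positivity
      refine (ih.extend (θ := θ) ?_ hθ0 hθ1).mono (le_of_eq ?_)
      · exact mul_nonneg hL0.le (by linarith)
      · have : θ * (1 - θ) ^ (s + 1) = L * (1 - ρ) := by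
          rw [hL, hρ]; field_simp; ring
        rw [this, ← hρ]; ring
  have hlim2 : Filter.Tendsto (fun t : ℕ => L * (1 - ρ ^ t)) Filter.atTop (nhds (L * (1 - 0))) :=
    ((tendsto_pow_atTop_nhds_zero_of_lt_one hρ0.le hρ1).const_sub 1).const_mul L
  obtain ⟨t, ht⟩ := (hlim2.eventually (lt_mem_nhds (by simpa using h1))).exists
  exact (key t).mono ht.le

lemma sum_mul_eq_zero_of_update {κ β : Type*} [Fintype κ] [DecidableEq κ] [Fintype β] [Nonempty β]
    (c : κ) (g : β → ℝ) (hg : ∑ x, g x = 0) (h : (κ → β) → ℝ)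
    (hh : ∀ X y, h (Function.update X c y) = h X) : ∑ X : κ → β, g (X c) * h X = 0 := by
  let e : (κ → β) × β → (κ → β) × β := fun z => (Function.update z.1 c z.2, z.1 c)
  have he : Function.Involutive e := by
    rintro ⟨X, y⟩
    simp [e]
  have h1 : ∑ z : (κ → β) × β, g z.2 * h z.1 = ∑ z : (κ → β) × β, g (z.1 c) * h z.1 := by
    refine Fintype.sum_equiv he.toPerm _ _ fun z => ?_
    simp [e, hh]
  rw [Fintype.sum_prod_type, Fintype.sum_prod_type] at h1
  simp only [← Finset.sum_mul, hg, zero_mul, Finset.sum_const_zero, Finset.sum_const,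
    nsmul_eq_mul, mul_assoc] at h1
  rw [← Finset.mul_sum] at h1
  have h2 : ((#(Finset.univ : Finset β) : ℕ) : ℝ) ≠ 0 := by
    simp
  exact (mul_eq_zero.1 h1.symm).resolve_left h2

section reservoir
variable {V : Type*} [Fintype V] [DecidableEq V]

/-- The deviation from `d` of the indicator that `ab` has its colour in `P`. -/
noncomputable def deviation {κ : Type*} (φ : Sym2 V → κ) (P : Set κ) (d : ℝ) (a b : V) : ℝ :=
  open Classical in if a = b then 0 else (if φ s(a, b) ∈ P then 1 else 0) - d

lemma deviation_sum_pow_four_le (f : V → V → ℝ) (A B : Finset V) :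
    (∑ a ∈ A, ∑ b ∈ B, f a b) ^ 4 ≤ (Fintype.card V : ℝ) ^ 4 *
      ∑ z : (V × V) × (V × V), f z.1.1 z.1.2 * f z.1.1 z.2.2 * f z.2.1 z.1.2 * f z.2.1 z.2.2 := by
  set n : ℝ := ((Fintype.card V : ℕ) : ℝ) with hn
  have hn0 : 0 ≤ n := by positivity
  have hcard : ∀ A : Finset V, (#A : ℝ) ≤ n := fun A => by
    rw [hn]; exact_mod_cast Finset.card_le_univ A
  set R := ∑ b, (∑ a ∈ A, f a b) ^ 2 with hR
  have hR0 : 0 ≤ R := Finset.sum_nonneg fun _ _ => sq_nonneg _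
  have h1 : (∑ a ∈ A, ∑ b ∈ B, f a b) ^ 2 ≤ n * R := by
    rw [Finset.sum_comm]
    refine (sq_sum_le_card_mul_sum_sq).trans ?_
    have h2 : ∑ b ∈ B, (∑ a ∈ A, f a b) ^ 2 ≤ R :=
      Finset.sum_le_univ_sum_of_nonneg fun _ => sq_nonneg _
    have h3 : 0 ≤ ∑ b ∈ B, (∑ a ∈ A, f a b) ^ 2 := Finset.sum_nonneg fun _ _ => sq_nonneg _
    exact mul_le_mul (hcard B) h2 h3 hn0
  have h2 : R = ∑ z ∈ A ×ˢ A, ∑ b, f z.1 b * f z.2 b := by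
    rw [hR, Finset.sum_comm]
    refine Finset.sum_congr rfl fun b _ => ?_
    rw [sq, Finset.sum_mul_sum, Finset.sum_product]
  have h3 : R ^ 2 ≤ n ^ 2 * ∑ z : V × V, (∑ b, f z.1 b * f z.2 b) ^ 2 := by
    rw [h2]
    refine (sq_sum_le_card_mul_sum_sq).trans ?_
    have h4 : ∑ z ∈ A ×ˢ A, (∑ b, f z.1 b * f z.2 b) ^ 2 ≤
        ∑ z : V × V, (∑ b, f z.1 b * f z.2 b) ^ 2 :=
      Finset.sum_le_univ_sum_of_nonneg fun _ => sq_nonneg _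
    have h5 : 0 ≤ ∑ z ∈ A ×ˢ A, (∑ b, f z.1 b * f z.2 b) ^ 2 :=
      Finset.sum_nonneg fun _ _ => sq_nonneg _
    have h6 : ((#(A ×ˢ A) : ℕ) : ℝ) ≤ n ^ 2 := by
      rw [Finset.card_product, sq]; push_cast
      exact mul_le_mul (hcard A) (hcard A) (by positivity) hn0
    exact mul_le_mul h6 h4 h5 (by positivity)
  have h4 : ∑ z : V × V, (∑ b, f z.1 b * f z.2 b) ^ 2 = ∑ z : (V × V) × (V × V),
      f z.1.1 z.1.2 * f z.1.1 z.2.2 * f z.2.1 z.1.2 * f z.2.1 z.2.2 := by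
    simp only [Fintype.sum_prod_type, sq, Finset.sum_mul_sum]
    refine Finset.sum_congr rfl fun a _ => ?_
    rw [Finset.sum_comm]
    refine Finset.sum_congr rfl fun b _ => Finset.sum_congr rfl fun a' _ =>
      Finset.sum_congr rfl fun b' _ => ?_
    ring
  rw [← h4]
  calc (∑ a ∈ A, ∑ b ∈ B, f a b) ^ 4 = ((∑ a ∈ A, ∑ b ∈ B, f a b) ^ 2) ^ 2 := by ring
    _ ≤ (n * R) ^ 2 := by gcongr
    _ = n ^ 2 * R ^ 2 := by ring
    _ ≤ n ^ 2 * (n ^ 2 * ∑ z : V × V, (∑ b, f z.1 b * f z.2 b) ^ 2) := by gcongr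
    _ = _ := by ring

/-- The quadruples `((a, b), (c, d))` for which the colour of `ab` reappears on `ad`, `cb` or
`cd`. -/
def RepeatedColour {κ : Type*} (φ : Sym2 V → κ) (z : (V × V) × (V × V)) : Prop :=
  (z.1.1 ≠ z.2.2 ∧ φ s(z.1.1, z.2.2) = φ s(z.1.1, z.1.2)) ∨
  (z.2.1 ≠ z.1.2 ∧ φ s(z.2.1, z.1.2) = φ s(z.1.1, z.1.2)) ∨
  (z.2.1 ≠ z.2.2 ∧ φ s(z.2.1, z.2.2) = φ s(z.1.1, z.1.2))

open Classical in
lemma card_repeatedColour_le {κ : Type*} (φ : Sym2 V → κ) (L g : ℕ)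
    (hL : ∀ v c, #{u | v ≠ u ∧ φ s(v, u) = c} ≤ L)
    (hg : ∀ c, #{z : V × V | z.1 ≠ z.2 ∧ φ s(z.1, z.2) = c} ≤ g) :
    #{z : (V × V) × (V × V) | RepeatedColour φ z} ≤
      Fintype.card V ^ 2 * (2 * (Fintype.card V * L) + g) := by
  have h : ∀ x ∈ (univ : Finset (V × V)),
      #{z ∈ (univ.filter (RepeatedColour φ)) | z.1 = x} ≤
      2 * (Fintype.card V * L) + g := by
    rintro ⟨a, b⟩ -
    have hsub : {z ∈ (univ.filter (RepeatedColour φ)) | z.1 = (a, b)} ⊆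
        {((a, b) : V × V)} ×ˢ (((univ : Finset V) ×ˢ ({u | a ≠ u ∧ φ s(a, u) = φ s(a, b)} : Finset V)) ∪
          ((({u | b ≠ u ∧ φ s(b, u) = φ s(a, b)} : Finset V) ×ˢ (univ : Finset V)) ∪
          ({z : V × V | z.1 ≠ z.2 ∧ φ s(z.1, z.2) = φ s(a, b)} : Finset _))) := by
      rintro ⟨⟨a1, b1⟩, ⟨a', b'⟩⟩ hz
      simp only [RepeatedColour, Finset.mem_filter, Finset.mem_univ, true_and, Prod.mk.injEq] at hz
      obtain ⟨hz, rfl, rfl⟩ := hz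
      simp only [Finset.mem_product, Finset.mem_singleton, Finset.mem_union, Finset.mem_filter,
        Finset.mem_univ, true_and, and_true]
      rcases hz with h | h | h
      · exact Or.inl h
      · exact Or.inr (Or.inl ⟨h.1.symm, by rw [Sym2.eq_swap]; exact h.2⟩)
      · exact Or.inr (Or.inr h)
    refine (Finset.card_le_card hsub).trans ?_
    rw [Finset.card_product, Finset.card_singleton, one_mul]
    refine (Finset.card_union_le _ _).trans ?_
    have h2 := Finset.card_union_le (({u | b ≠ u ∧ φ s(b, u) = φ s(a, b)} : Finset V) ×ˢ (univ : Finset V))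
      ({z : V × V | z.1 ≠ z.2 ∧ φ s(z.1, z.2) = φ s(a, b)} : Finset _)
    rw [Finset.card_product] at h2 ⊢
    rw [Finset.card_univ] at h2 ⊢
    have h3 := Nat.mul_le_mul_left (Fintype.card V) (hL a (φ s(a, b)))
    have h4 := Nat.mul_le_mul_right (Fintype.card V) (hL b (φ s(a, b)))
    have h5 := hg (φ s(a, b))
    rw [mul_comm L] at h4
    omega
  have := Finset.card_eq_sum_card_fiberwise (f := Prod.fst) (t := (univ : Finset (V × V)))
    (s := (univ.filter (RepeatedColour φ))) (fun _ _ => by simp)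
  rw [this]
  refine (Finset.sum_le_card_nsmul _ _ _ h).trans ?_
  simp [sq]

open Classical in
lemma exists_reservoir {κ : Type*} [Fintype κ] (φ : Sym2 V → κ) (L g q : ℕ)
    (hq : 0 < q)
    (hL : ∀ v c, #{u | v ≠ u ∧ φ s(v, u) = c} ≤ L)
    (hg : ∀ c, #{z : V × V | z.1 ≠ z.2 ∧ φ s(z.1, z.2) = c} ≤ g) :
    ∃ P : Set κ, ∀ A B : Finset V, (∑ a ∈ A, ∑ b ∈ B, deviation φ P (1 / q) a b) ^ 4 ≤
      (Fintype.card V : ℝ) ^ 6 * (2 * (Fintype.card V * L) + g) := by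
  classical
  have : NeZero q := ⟨hq.ne'⟩
  have hqr : (0 : ℝ) < q := by exact_mod_cast hq
  have hq1 : (1 : ℝ) / q ≤ 1 := by
    rw [div_le_one hqr]; exact_mod_cast hq
  let Q : (κ → Fin q) → Set κ := fun X => {c | X c = 0}
  let f : (κ → Fin q) → V → V → ℝ := fun X => deviation φ (Q X) (1 / q)
  let T : (κ → Fin q) → (V × V) × (V × V) → ℝ := fun X z =>
    f X z.1.1 z.1.2 * f X z.1.1 z.2.2 * f X z.2.1 z.1.2 * f X z.2.1 z.2.2
  have hf1 : ∀ X a b, |f X a b| ≤ 1 := by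
    intro X a b
    have : (0 : ℝ) ≤ 1 / q := by positivity
    simp only [f, deviation]
    split_ifs <;> rw [abs_le] <;> constructor <;> linarith
  have hT1 : ∀ X z, T X z ≤ 1 := by
    intro X z
    refine (le_abs_self _).trans ?_
    simp only [T, abs_mul]
    have h := hf1 X
    calc _ ≤ (1 : ℝ) * 1 * 1 * 1 := by gcongr <;> apply h
      _ = 1 := by norm_num
  have hupd : ∀ X c y a b, (a ≠ b → φ s(a, b) ≠ c) → f (Function.update X c y) a b = f X a b := by
    intro X c y a b h
    simp only [f, deviation, Q, Set.mem_ofPred_eq]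
    by_cases hab : a = b
    · simp [hab]
    · simp [hab, Function.update_of_ne (h hab)]
  have hsum : ∀ z, ∑ X, T X z ≤ ∑ X : κ → Fin q, if RepeatedColour φ z then (1 : ℝ) else 0 := by
    intro z
    split_ifs with hz
    · exact Finset.sum_le_sum fun X _ => hT1 X z
    · rw [Finset.sum_const_zero]
      by_cases hab : z.1.1 = z.1.2
      · refine (Finset.sum_eq_zero fun X _ => ?_).le
        simp [T, f, deviation, hab]
      · refine le_of_eq ?_
        have := sum_mul_eq_zero_of_update (κ := κ) (β := Fin q) (φ s(z.1.1, z.1.2))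
          (fun x => (if x = 0 then 1 else 0) - 1 / q)
          (by
            rw [Finset.sum_sub_distrib, Finset.sum_ite_eq' ]
            simp [hqr.ne'])
          (fun X => f X z.1.1 z.2.2 * f X z.2.1 z.1.2 * f X z.2.1 z.2.2)
          (by
            intro X y
            simp only [RepeatedColour, not_or, not_and] at hz
            rw [hupd X _ y _ _ hz.1, hupd X _ y _ _ hz.2.1, hupd X _ y _ _ hz.2.2])
        rw [← this]
        refine Finset.sum_congr rfl fun X _ => ?_
        simp only [T]
        have : f X z.1.1 z.1.2 = (if X (φ s(z.1.1, z.1.2)) = 0 then 1 else 0) - 1 / q := by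
          simp only [f, deviation, Q, if_neg hab, Set.mem_ofPred_eq]
          congr
        rw [this]; ring
  have hex : ∃ X ∈ (univ : Finset (κ → Fin q)), ∑ z, T X z ≤
      (#{z : (V × V) × (V × V) | RepeatedColour φ z} : ℝ) := by
    refine Finset.exists_le_of_sum_le ⟨fun _ => 0, by simp⟩ ?_
    rw [Finset.sum_comm]
    refine (Finset.sum_le_sum fun z _ => hsum z).trans (le_of_eq ?_)
    rw [Finset.sum_comm]
    refine Finset.sum_congr rfl fun X _ => ?_
    simp
  obtain ⟨X, -, hX⟩ := hex
  refine ⟨Q X, fun A B => (deviation_sum_pow_four_le (f X) A B).trans ?_⟩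
  have h1 : (#{z : (V × V) × (V × V) | RepeatedColour φ z} : ℝ) ≤
      (Fintype.card V : ℝ) ^ 2 * (2 * (Fintype.card V * L) + g) := by
    exact_mod_cast card_repeatedColour_le φ L g hL hg
  calc (Fintype.card V : ℝ) ^ 4 * ∑ z, T X z
      ≤ (Fintype.card V : ℝ) ^ 4 * ((Fintype.card V : ℝ) ^ 2 * (2 * (Fintype.card V * L) + g)) := by
        have := hX.trans h1
        gcongr
    _ = _ := by ring

end reservoir

section paths
variable {V : Type*} [Fintype V] [DecidableEq V]

/-- The `j`-th edge of a sequence of vertices. -/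
def edgeAt {k : ℕ} (p : Fin (k + 1) → V) (j : Fin k) : Sym2 V := s(p j.castSucc, p j.succ)

/-- The walks with `k` edges. -/
def walksOf (G : SimpleGraph V) [DecidableRel G.Adj] (k : ℕ) : Finset (Fin (k + 1) → V) :=
  {p | ∀ j : Fin k, G.Adj (p j.castSucc) (p j.succ)}

variable (G : SimpleGraph V) [DecidableRel G.Adj]

lemma tail_mem_walksOf {k : ℕ} {p : Fin (k + 2) → V} (hp : p ∈ walksOf G (k + 1)) :
    Fin.tail p ∈ walksOf G k := by
  simp only [walksOf, Finset.mem_filter, Finset.mem_univ, true_and, Fin.tail] at hp ⊢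
  intro j
  have := hp j.succ
  rwa [← Fin.succ_castSucc] at this

lemma adj_of_mem_walksOf {k : ℕ} {p : Fin (k + 2) → V} (hp : p ∈ walksOf G (k + 1)) :
    G.Adj (p 0) (p 1) := by
  simp only [walksOf, Finset.mem_filter, Finset.mem_univ, true_and] at hp
  exact hp 0

lemma cons_mem_walksOf {k : ℕ} {p : Fin (k + 1) → V} (hp : p ∈ walksOf G k) {v : V}
    (hv : G.Adj v (p 0)) : (Fin.cons v p : Fin (k + 2) → V) ∈ walksOf G (k + 1) := by
  simp only [walksOf, Finset.mem_filter, Finset.mem_univ, true_and] at hp ⊢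
  intro j
  induction j using Fin.cases with
  | zero => simpa using hv
  | succ j => simpa [← Fin.succ_castSucc] using hp j

lemma card_mul_pow_le_card_walksOf (S : Finset V) (δ : ℕ) (hG : ∀ u v, G.Adj u v → u ∈ S)
    (hδ : ∀ v ∈ S, δ ≤ #{u | G.Adj u v}) (k : ℕ) :
    #S * δ ^ k ≤ #{p ∈ walksOf G k | p 0 ∈ S} := by
  induction k with
  | zero =>
    rw [pow_zero, mul_one]
    refine Finset.card_le_card_of_injOn (fun v _ => v) (fun v hv => ?_) ?_
    · simp only [Finset.coe_filter, Set.mem_ofPred_eq, walksOf]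
      exact ⟨by simp, hv⟩
    · intro u _ v _ h
      exact congrFun h 0
  | succ k ih =>
    have h := Finset.card_le_card_of_injOn
      (s := ({p ∈ walksOf G k | p 0 ∈ S}).sigma fun p => ({u | G.Adj u (p 0)} : Finset V))
      (t := {p ∈ walksOf G (k + 1) | p 0 ∈ S})
      (fun z => (Fin.cons z.2 z.1 : Fin (k + 2) → V)) (by
        rintro ⟨p, v⟩ hz
        simp only [Finset.coe_sigma, Set.mem_sigma_iff, Finset.mem_coe, Finset.mem_filter,
          Finset.mem_univ, true_and] at hz ⊢
        exact ⟨cons_mem_walksOf G hz.1.1 hz.2, by simpa using hG _ _ hz.2⟩) (by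
        rintro ⟨p, v⟩ - ⟨p', v'⟩ - h
        obtain ⟨h1, h2⟩ := Fin.cons_injective2 h
        simp only at h1 h2
        subst h1 h2; rfl)
    refine le_trans ?_ h
    rw [Finset.card_sigma, pow_succ, ← mul_assoc]
    refine (Nat.mul_le_mul_right _ ih).trans ?_
    rw [← smul_eq_mul]
    refine Finset.card_nsmul_le_sum _ _ _ fun p hp => ?_
    exact hδ _ (Finset.mem_filter.1 hp).2

lemma card_walksOf_tail_le {Δ : ℕ} (hΔ : ∀ v, #{u | G.Adj u v} ≤ Δ) {k : ℕ}
    (S : Finset (Fin (k + 2) → V)) (T : Finset (Fin (k + 1) → V)) (hS : S ⊆ walksOf G (k + 1))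
    (hT : ∀ p ∈ S, Fin.tail p ∈ T) : #S ≤ Δ * #T := by
  refine Finset.card_le_mul_card_image_of_maps_to (f := Fin.tail) hT Δ fun q _ => ?_
  refine (Finset.card_le_card_of_injOn (fun p => p 0) (t := {u | G.Adj u (q 0)}) ?_ ?_).trans
    (hΔ (q 0))
  · intro p hp
    simp only [Finset.coe_filter, Set.mem_ofPred_eq, Finset.mem_univ, true_and] at hp ⊢
    have := adj_of_mem_walksOf G (hS hp.1)
    rw [← hp.2]
    exact this
  · intro p hp p' hp' h
    simp only [Finset.coe_filter, Set.mem_ofPred_eq] at hp hp' h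
    rw [← Fin.cons_self_tail p, ← Fin.cons_self_tail p', hp.2, hp'.2, h]

lemma card_walksOf_apply_eq_le {Δ : ℕ} (hΔ : ∀ v, #{u | G.Adj u v} ≤ Δ) (k : ℕ)
    (a : Fin (k + 1)) (v : V) : #{p ∈ walksOf G k | p a = v} ≤ Δ ^ k := by
  induction k generalizing v with
  | zero =>
    rw [pow_zero, Finset.card_le_one]
    intro p hp p' hp'
    rw [Finset.mem_filter] at hp hp'
    funext i
    have hi : i = a := by omega
    rw [hi, hp.2, hp'.2]
  | succ k ih =>
    induction a using Fin.cases with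
    | succ a =>
      refine (card_walksOf_tail_le G hΔ _ ({p ∈ walksOf G k | p a = v}) (filter_subset _ _)
        fun p hp => ?_).trans ?_
      · rw [Finset.mem_filter] at hp ⊢
        exact ⟨tail_mem_walksOf G hp.1, hp.2⟩
      · rw [pow_succ']
        exact Nat.mul_le_mul_left _ (ih a v)
    | zero =>
      have h : ∀ u ∈ ({u | G.Adj u v} : Finset V),
          #{p ∈ ({p ∈ walksOf G (k + 1) | p 0 = v} : Finset _) | p 1 = u} ≤ Δ ^ k := by
        intro u _
        refine (Finset.card_le_card_of_injOn Fin.tail (t := {p ∈ walksOf G k | p 0 = u})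
          ?_ ?_).trans (ih 0 u)
        · intro p hp
          simp only [Finset.coe_filter, Finset.mem_filter, Set.mem_ofPred_eq] at hp ⊢
          exact ⟨tail_mem_walksOf G hp.1.1, hp.2⟩
        · intro p hp p' hp' h
          simp only [Finset.coe_filter, Finset.mem_filter, Set.mem_ofPred_eq] at hp hp' h
          rw [← Fin.cons_self_tail p, ← Fin.cons_self_tail p', hp.1.2, hp'.1.2, h]
      have h2 := Finset.card_le_mul_card_image_of_maps_to (f := fun p : Fin (k + 2) → V => p 1)
        (s := {p ∈ walksOf G (k + 1) | p 0 = v}) (t := {u | G.Adj u v}) (fun p hp => by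
          rw [Finset.mem_filter] at hp
          simp only [Finset.mem_filter, Finset.mem_univ, true_and]
          rw [← hp.2]
          exact (adj_of_mem_walksOf G hp.1).symm) _ h
      refine h2.trans ?_
      rw [pow_succ]
      exact Nat.mul_le_mul_left _ (hΔ v)

lemma card_walksOf_apply_eq_apply_eq_le {Δ : ℕ} (hΔ : ∀ v, #{u | G.Adj u v} ≤ Δ) (k : ℕ)
    (j : Fin (k + 1)) (u v : V) :
    #{p ∈ walksOf G (k + 1) | p j.castSucc = u ∧ p j.succ = v} ≤ Δ ^ k := by
  induction k generalizing u v with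
  | zero =>
    rw [pow_zero, Finset.card_le_one]
    intro p hp p' hp'
    rw [Finset.mem_filter] at hp hp'
    have hj : j = 0 := by omega
    rw [hj] at hp hp'
    funext i
    fin_cases i
    · exact hp.2.1.trans hp'.2.1.symm
    · exact hp.2.2.trans hp'.2.2.symm
  | succ k ih =>
    induction j using Fin.cases with
    | zero =>
      refine (Finset.card_le_card_of_injOn Fin.tail (t := {p ∈ walksOf G (k + 1) | p 0 = v})
        ?_ ?_).trans (card_walksOf_apply_eq_le G hΔ _ 0 v)
      · intro p hp
        simp only [Finset.coe_filter, Set.mem_ofPred_eq] at hp ⊢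
        exact ⟨tail_mem_walksOf G hp.1, hp.2.2⟩
      · intro p hp p' hp' h
        rw [Finset.mem_coe, Finset.mem_filter] at hp hp'
        simp only [Fin.castSucc_zero] at hp hp'
        rw [← Fin.cons_self_tail p, ← Fin.cons_self_tail p', hp.2.1, hp'.2.1, h]
    | succ j =>
      refine (card_walksOf_tail_le G hΔ _
        ({p ∈ walksOf G (k + 1) | p j.castSucc = u ∧ p j.succ = v}) (filter_subset _ _)
        fun p hp => ?_).trans ?_
      · rw [Finset.mem_filter] at hp ⊢
        refine ⟨tail_mem_walksOf G hp.1, ?_, hp.2.2⟩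
        rw [Fin.tail, Fin.succ_castSucc]
        exact hp.2.1
      · rw [pow_succ']
        exact Nat.mul_le_mul_left _ (ih j u v)

lemma card_walksOf_edgeAt_eq_le {Δ : ℕ} (hΔ : ∀ v, #{u | G.Adj u v} ≤ Δ) (k : ℕ)
    (j : Fin (k + 1)) (e : Sym2 V) :
    #{p ∈ walksOf G (k + 1) | edgeAt p j = e} ≤ 2 * Δ ^ k := by
  induction e using Sym2.ind with
  | _ u v =>
    have : {p ∈ walksOf G (k + 1) | edgeAt p j = s(u, v)} ⊆
        {p ∈ walksOf G (k + 1) | p j.castSucc = u ∧ p j.succ = v} ∪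
        {p ∈ walksOf G (k + 1) | p j.castSucc = v ∧ p j.succ = u} := by
      intro p hp
      simp only [Finset.mem_filter, Finset.mem_union, edgeAt, Sym2.eq_iff] at hp ⊢
      tauto
    have h1 := card_walksOf_apply_eq_apply_eq_le G hΔ k j u v
    have h2 := card_walksOf_apply_eq_apply_eq_le G hΔ k j v u
    have h3 := (Finset.card_le_card this).trans (Finset.card_union_le _ _)
    omega

lemma card_walksOf_colour_eq_le {κ : Type*} [DecidableEq κ] (φ : Sym2 V → κ) {g : ℕ}
    (hg : ∀ c, #{z : V × V | z.1 ≠ z.2 ∧ φ s(z.1, z.2) = c} ≤ g)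
    {Δ : ℕ} (hΔ : ∀ v, #{u | G.Adj u v} ≤ Δ) (k : ℕ) (j : Fin (k + 1)) (c : κ) :
    #{p ∈ walksOf G (k + 1) | φ (edgeAt p j) = c} ≤ g * Δ ^ k := by
  have h := Finset.card_le_mul_card_image_of_maps_to
    (f := fun p : Fin (k + 2) → V => (p j.castSucc, p j.succ))
    (s := {p ∈ walksOf G (k + 1) | φ (edgeAt p j) = c})
    (t := {z : V × V | z.1 ≠ z.2 ∧ φ s(z.1, z.2) = c}) (fun p hp => by
      simp only [walksOf, Finset.mem_filter, Finset.mem_univ, true_and] at hp ⊢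
      exact ⟨(hp.1 j).ne, hp.2⟩) (Δ ^ k) (by
      rintro ⟨u, v⟩ -
      refine le_trans (Finset.card_le_card fun p hp => ?_)
        (card_walksOf_apply_eq_apply_eq_le G hΔ k j u v)
      simp only [Finset.mem_filter, Prod.mk.injEq] at hp ⊢
      exact ⟨hp.1.1, hp.2⟩)
  refine h.trans ?_
  rw [mul_comm]
  exact Nat.mul_le_mul_right _ (hg c)

end paths

section counting
variable {V ι : Type*} [Fintype V] [DecidableEq V] [Fintype ι] [DecidableEq ι]

lemma card_le_card_mul_pow {X : Type*} [DecidableEq X] (S : Finset (ι → V)) (B : Finset ι)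
    (F : (ι → V) → X) (T : Finset X) (hF : ∀ p ∈ S, F p ∈ T)
    (hinj : ∀ p ∈ S, ∀ q ∈ S, (∀ i ∉ B, p i = q i) → F p = F q → p = q) :
    #S ≤ #T * Fintype.card V ^ (Fintype.card ι - #B) := by
  have h := Finset.card_le_card_of_injOn (s := S) (t := T ×ˢ (univ : Finset ({i // i ∉ B} → V)))
    (fun p => (F p, fun i => p i.1)) (fun p hp => by simpa using hF p hp) (by
      intro p hp q hq h
      simp only [Prod.mk.injEq] at h
      exact hinj p hp q hq (fun i hi => congrFun h.2 ⟨i, hi⟩) h.1)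
  rw [Finset.card_product, Finset.card_univ, Fintype.card_fun] at h
  simpa [Fintype.card_subtype_compl] using h

lemma card_le_pow (S : Finset (ι → V)) (B : Finset ι)
    (hinj : ∀ p ∈ S, ∀ q ∈ S, (∀ i ∉ B, p i = q i) → p = q) :
    #S ≤ Fintype.card V ^ (Fintype.card ι - #B) := by
  simpa using card_le_card_mul_pow S B (fun _ => ()) {()} (by simp)
    (fun p hp q hq h _ => hinj p hp q hq h)

lemma card_le_mul_card_of_update {κ : Type*} [DecidableEq κ] (φ : Sym2 V → κ) {L : ℕ}
    (hL : ∀ v c, #{u | v ≠ u ∧ φ s(v, u) = c} ≤ L) (S S' : Finset (ι → V)) (z : V) {b b' : ι}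
    (hb : b' ≠ b) (f : (ι → V) → κ) (hf : ∀ p x, f (Function.update p b x) = f p)
    (hS : ∀ p ∈ S, p b' ≠ p b ∧ φ s(p b', p b) = f p)
    (hS' : ∀ p ∈ S, Function.update p b z ∈ S') : #S ≤ L * #S' := by
  refine Finset.card_le_mul_card_image_of_maps_to (f := fun p => Function.update p b z) hS' L
    fun q _ => ?_
  refine (Finset.card_le_card_of_injOn (fun p => p b)
    (t := {u | q b' ≠ u ∧ φ s(q b', u) = f q}) ?_ ?_).trans (hL _ _)
  · intro p hp
    simp only [Finset.coe_filter, Set.mem_ofPred_eq, Finset.mem_univ, true_and] at hp ⊢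
    obtain ⟨hp, rfl⟩ := hp
    rw [hf, Function.update_of_ne hb]
    exact hS p hp
  · intro p hp p' hp' h
    simp only [Finset.coe_filter, Set.mem_ofPred_eq] at hp hp' h
    funext i
    by_cases hi : i = b
    · rw [hi, h]
    · have := congrFun (hp.2.trans hp'.2.symm) i
      rwa [Function.update_of_ne hi, Function.update_of_ne hi] at this

end counting

section rainbow
variable {V κ : Type*} [Fintype V] [DecidableEq V] [DecidableEq κ]

/-- The rainbow paths with `k` edges. -/
def rainbowPaths (G : SimpleGraph V) [DecidableRel G.Adj] (φ : Sym2 V → κ) (k : ℕ) :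
    Finset (Fin (k + 1) → V) :=
  {p ∈ walksOf G k | Function.Injective p ∧ Function.Injective fun j => φ (edgeAt p j)}

variable (G : SimpleGraph V) [DecidableRel G.Adj] (φ : Sym2 V → κ)

lemma card_walksOf_le_card_rainbowPaths_add {L : ℕ} (z : V)
    (hL : ∀ v c, #{u | v ≠ u ∧ φ s(v, u) = c} ≤ L) (k : ℕ) :
    #(walksOf G k) ≤ #(rainbowPaths G φ k) +
      ((k + 1) ^ 2 + k ^ 2 * L) * Fintype.card V ^ k := by
  have hsub : walksOf G k ⊆ rainbowPaths G φ k ∪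
      ((univ : Finset (Fin (k + 1) × Fin (k + 1))).filter (fun x => x.1 ≠ x.2)).biUnion
        (fun x => {p : Fin (k + 1) → V | p x.1 = p x.2}) ∪
      ((univ : Finset (Fin k × Fin k)).filter (fun x => x.1 < x.2)).biUnion
        (fun x => {p ∈ walksOf G k | φ (edgeAt p x.2) = φ (edgeAt p x.1)}) := by
    intro p hp
    simp only [Finset.mem_union, Finset.mem_biUnion, Finset.mem_filter, Finset.mem_univ, true_and,
      rainbowPaths, Prod.exists]
    by_contra! h
    refine h.1.1 hp (fun i j hij => by_contra fun hne => h.1.2 i j hne hij) fun i j hij => ?_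
    rcases lt_trichotomy i j with hlt | rfl | hlt
    · exact absurd hij.symm (h.2 i j hlt hp)
    · rfl
    · exact absurd hij (h.2 j i hlt hp)
  refine (Finset.card_le_card hsub).trans ?_
  refine (Finset.card_union_le _ _).trans ?_
  have h1 := Finset.card_union_le (rainbowPaths G φ k)
    (((univ : Finset (Fin (k + 1) × Fin (k + 1))).filter (fun x => x.1 ≠ x.2)).biUnion
        (fun x => {p : Fin (k + 1) → V | p x.1 = p x.2}))
  have h2 : #(((univ : Finset (Fin (k + 1) × Fin (k + 1))).filter (fun x => x.1 ≠ x.2)).biUnion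
        (fun x => {p : Fin (k + 1) → V | p x.1 = p x.2})) ≤
      (k + 1) ^ 2 * Fintype.card V ^ k := by
    refine (Finset.card_biUnion_le_card_mul _ _ (Fintype.card V ^ k) ?_).trans ?_
    · rintro ⟨i, j⟩ hij
      simp only [Finset.mem_filter, Finset.mem_univ, true_and] at hij
      have := card_le_pow (V := V) ({p : Fin (k + 1) → V | p i = p j}) {i} (by
        intro p hp q hq h
        simp only [Finset.mem_filter, Finset.mem_univ, true_and, Finset.mem_singleton] at hp hq h
        funext a
        by_cases ha : a = i
        · rw [ha, hp, hq, h j (Ne.symm hij)]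
        · exact h a ha)
      simpa using this
    · refine Nat.mul_le_mul_right _ ((Finset.card_le_univ _).trans ?_)
      simp [sq]
  have h3 : #(((univ : Finset (Fin k × Fin k)).filter (fun x => x.1 < x.2)).biUnion
        (fun x => {p ∈ walksOf G k | φ (edgeAt p x.2) = φ (edgeAt p x.1)})) ≤
      k ^ 2 * (L * Fintype.card V ^ k) := by
    refine (Finset.card_biUnion_le_card_mul _ _ (L * Fintype.card V ^ k) ?_).trans ?_
    · rintro ⟨i, j⟩ hij
      simp only [Finset.mem_filter, Finset.mem_univ, true_and] at hij
      refine (card_le_mul_card_of_update φ hL _ ({p : Fin (k + 1) → V | p j.succ = z}) z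
        (b := j.succ) (b' := j.castSucc) (Fin.castSucc_lt_succ).ne
        (fun p => φ (edgeAt p i)) ?_ ?_ ?_).trans ?_
      · intro p x
        simp only [edgeAt]
        rw [Function.update_of_ne, Function.update_of_ne]
        · simp only [ne_eq, Fin.ext_iff, Fin.val_succ]
          have := Fin.lt_def.1 hij
          omega
        · simp only [ne_eq, Fin.ext_iff, Fin.val_succ, Fin.val_castSucc]
          have := Fin.lt_def.1 hij
          omega
      · intro p hp
        simp only [walksOf, Finset.mem_filter, Finset.mem_univ, true_and] at hp
        exact ⟨(hp.1 j).ne, hp.2⟩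
      · intro p hp
        simp
      · refine Nat.mul_le_mul_left _ ?_
        have := card_le_pow (V := V) ({p : Fin (k + 1) → V | p j.succ = z}) {j.succ} (by
          intro p hp q hq h
          simp only [Finset.mem_filter, Finset.mem_univ, true_and, Finset.mem_singleton] at hp hq h
          funext a
          by_cases ha : a = j.succ
          · rw [ha, hp, hq]
          · exact h a ha)
        simpa using this
    · refine Nat.mul_le_mul_right _ ((Finset.card_le_univ _).trans ?_)
      simp [sq]
  have h4 : ((k + 1) ^ 2 + k ^ 2 * L) * Fintype.card V ^ k =
    (k + 1) ^ 2 * Fintype.card V ^ k + k ^ 2 * (L * Fintype.card V ^ k) := by ring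
  omega

/-- Two distinct edges of a path: some endpoint of the second lies outside the first. -/
lemma exists_endpoint_not_mem {k : ℕ} {i j : Fin k} (hij : i ≠ j) :
    ∃ b b' : Fin (k + 1), b ≠ b' ∧ b ≠ i.castSucc ∧ b ≠ i.succ ∧
      ((b = j.castSucc ∧ b' = j.succ) ∨ (b = j.succ ∧ b' = j.castSucc)) := by
  rcases lt_or_gt_of_ne hij with h | h
  · refine ⟨j.succ, j.castSucc, ?_, ?_, ?_, Or.inr ⟨rfl, rfl⟩⟩ <;>
      simp only [ne_eq, Fin.ext_iff, Fin.val_succ, Fin.val_castSucc] <;>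
      have := Fin.lt_def.1 h <;> omega
  · refine ⟨j.castSucc, j.succ, ?_, ?_, ?_, Or.inl ⟨rfl, rfl⟩⟩ <;>
      simp only [ne_eq, Fin.ext_iff, Fin.val_succ, Fin.val_castSucc] <;>
      have := Fin.lt_def.1 h <;> omega

lemma edgeAt_eq_of_endpoints {k : ℕ} {j : Fin k} {b b' : Fin (k + 1)}
    (h : (b = j.castSucc ∧ b' = j.succ) ∨ (b = j.succ ∧ b' = j.castSucc)) (p : Fin (k + 1) → V) :
    edgeAt p j = s(p b', p b) := by
  rcases h with ⟨rfl, rfl⟩ | ⟨rfl, rfl⟩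
  · exact Sym2.eq_swap
  · rfl

variable {m : ℕ}

lemma eq_of_edgeAt_eq {k : ℕ} {p q : Fin (k + 1) → V} {j : Fin k}
    (h : edgeAt p j = edgeAt q j) (h0 : p j.castSucc = q j.castSucc) : p j.succ = q j.succ := by
  simp only [edgeAt, Sym2.eq_iff] at h
  rcases h with h | h
  · exact h.2
  · rw [h.2, ← h.1, h0]

lemma card_edgeAt_eq_le (j : Fin (m + 2)) (e : Sym2 V) :
    #{p : Fin (m + 3) → V | edgeAt p j = e} ≤ 2 * Fintype.card V ^ (m + 1) := by
  induction e using Sym2.ind with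
  | _ u v =>
  have h := card_le_card_mul_pow (V := V) ({p : Fin (m + 3) → V | edgeAt p j = s(u, v)})
    {j.castSucc, j.succ} (fun p => p j.castSucc) {u, v} (by
      intro p hp
      simp only [Finset.mem_filter, Finset.mem_univ, true_and, edgeAt, Sym2.eq_iff] at hp
      simp only [Finset.mem_insert, Finset.mem_singleton]
      tauto) (by
      intro p hp q hq h h0
      simp only [Finset.mem_filter, Finset.mem_univ, true_and] at hp hq
      simp only [Finset.mem_insert, Finset.mem_singleton, not_or, and_imp] at h
      funext a
      by_cases h1 : a = j.castSucc
      · rw [h1, h0]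
      by_cases h2 : a = j.succ
      · rw [h2]; exact eq_of_edgeAt_eq (hp.trans hq.symm) h0
      exact h a h1 h2)
  refine h.trans ?_
  have h3 : #({u, v} : Finset V) ≤ 2 := Finset.card_le_two
  rw [Finset.card_pair Fin.castSucc_lt_succ.ne, Fintype.card_fin]
  exact Nat.mul_le_mul_right _ h3

lemma card_edgeAt_eq_edgeAt_eq_le {i j : Fin (m + 2)} (hij : i ≠ j) (e f : Sym2 V) :
    #{p : Fin (m + 3) → V | edgeAt p i = e ∧ edgeAt p j = f} ≤ 4 * Fintype.card V ^ m := by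
  obtain ⟨b, b', hb, hbi, hbi', hj⟩ := exists_endpoint_not_mem hij
  induction e using Sym2.ind with
  | _ u v =>
  induction f using Sym2.ind with
  | _ x y =>
  have h := card_le_card_mul_pow (V := V)
    ({p : Fin (m + 3) → V | edgeAt p i = s(u, v) ∧ edgeAt p j = s(x, y)})
    {b, i.castSucc, i.succ} (fun p => (p i.castSucc, p b)) ({u, v} ×ˢ {x, y}) (by
      intro p hp
      simp only [Finset.mem_filter, Finset.mem_univ, true_and, edgeAt_eq_of_endpoints hj] at hp
      simp only [edgeAt, Sym2.eq_iff] at hp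
      simp only [Finset.mem_product, Finset.mem_insert, Finset.mem_singleton]
      tauto) (by
      intro p hp q hq h h0
      simp only [Finset.mem_filter, Finset.mem_univ, true_and, Prod.mk.injEq] at hp hq h0
      simp only [Finset.mem_insert, Finset.mem_singleton, not_or, and_imp] at h
      funext a
      by_cases h1 : a = i.castSucc
      · rw [h1, h0.1]
      by_cases h2 : a = i.succ
      · rw [h2]; exact eq_of_edgeAt_eq (hp.1.trans hq.1.symm) h0.1
      by_cases h3 : a = b
      · rw [h3, h0.2]
      exact h a h3 h1 h2)
  refine h.trans ?_
  have h3 : #({u, v} : Finset V) ≤ 2 := Finset.card_le_two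
  have h4 : #({x, y} : Finset V) ≤ 2 := Finset.card_le_two
  rw [Finset.card_eq_three.2 ⟨b, i.castSucc, i.succ, hbi, hbi', Fin.castSucc_lt_succ.ne, rfl⟩,
    Fintype.card_fin, Finset.card_product]
  exact Nat.mul_le_mul_right _ (Nat.mul_le_mul h3 h4)

lemma card_apply_eq_apply_eq_le {a b : Fin (m + 3)} (hab : a ≠ b) (u v : V) :
    #{p : Fin (m + 3) → V | p a = u ∧ p b = v} ≤ Fintype.card V ^ (m + 1) := by
  have h := card_le_pow (V := V) ({p : Fin (m + 3) → V | p a = u ∧ p b = v}) {a, b} (by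
    intro p hp q hq h
    simp only [Finset.mem_filter, Finset.mem_univ, true_and] at hp hq
    simp only [Finset.mem_insert, Finset.mem_singleton, not_or, and_imp] at h
    funext i
    by_cases h1 : i = a
    · rw [h1, hp.1, hq.1]
    by_cases h2 : i = b
    · rw [h2, hp.2, hq.2]
    exact h i h1 h2)
  rwa [Finset.card_pair hab, Fintype.card_fin] at h

lemma card_apply_eq_colour_eq_le {L : ℕ}
    (hL : ∀ v c, #{u | v ≠ u ∧ φ s(v, u) = c} ≤ L) (a : Fin (m + 3)) (j : Fin (m + 2))
    (v : V) (c : κ) :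
    #{p : Fin (m + 3) → V | Function.Injective p ∧ p a = v ∧ φ (edgeAt p j) = c} ≤
      L * Fintype.card V ^ (m + 1) := by
  obtain ⟨b, b', hb, hba, hj⟩ : ∃ b b' : Fin (m + 3), b ≠ b' ∧ b ≠ a ∧
      ((b = j.castSucc ∧ b' = j.succ) ∨ (b = j.succ ∧ b' = j.castSucc)) := by
    have h : j.castSucc ≠ j.succ := Fin.castSucc_lt_succ.ne
    by_cases ha : j.castSucc = a
    · exact ⟨j.succ, j.castSucc, h.symm, by rw [← ha]; exact h.symm, Or.inr ⟨rfl, rfl⟩⟩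
    · exact ⟨j.castSucc, j.succ, h, ha, Or.inl ⟨rfl, rfl⟩⟩
  refine (card_le_mul_card_of_update φ hL _ ({p : Fin (m + 3) → V | p a = v ∧ p b = v}) v
    hb.symm (fun _ => c) (fun _ _ => rfl) ?_ ?_).trans
    (Nat.mul_le_mul_left _ (card_apply_eq_apply_eq_le hba.symm v v))
  · intro p hp
    simp only [Finset.mem_filter, Finset.mem_univ, true_and, edgeAt_eq_of_endpoints hj] at hp
    exact ⟨hp.1.ne hb.symm, hp.2.2⟩
  · intro p hp
    simp only [Finset.mem_filter, Finset.mem_univ, true_and] at hp ⊢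
    rw [Function.update_of_ne hba.symm, Function.update_self]
    exact ⟨hp.2.1, rfl⟩

lemma card_colour_eq_colour_eq_le {L g : ℕ} (z : V)
    (hL : ∀ v c, #{u | v ≠ u ∧ φ s(v, u) = c} ≤ L)
    (hg : ∀ c, #{z : V × V | z.1 ≠ z.2 ∧ φ s(z.1, z.2) = c} ≤ g) {i j : Fin (m + 2)}
    (hij : i ≠ j) (c d : κ) :
    #{p : Fin (m + 3) → V | Function.Injective p ∧ φ (edgeAt p i) = c ∧ φ (edgeAt p j) = d} ≤
      L * (g * Fintype.card V ^ m) := by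
  obtain ⟨b, b', hb, hbi, hbi', hj⟩ := exists_endpoint_not_mem hij
  refine (card_le_mul_card_of_update φ hL _ ({p : Fin (m + 3) → V |
      (p i.castSucc ≠ p i.succ ∧ φ s(p i.castSucc, p i.succ) = c) ∧ p b = z}) z
    hb.symm (fun _ => d) (fun _ _ => rfl) ?_ ?_).trans (Nat.mul_le_mul_left _ ?_)
  · intro p hp
    simp only [Finset.mem_filter, Finset.mem_univ, true_and, edgeAt_eq_of_endpoints hj] at hp
    exact ⟨hp.1.ne hb.symm, hp.2.2⟩
  · intro p hp
    simp only [Finset.mem_filter, Finset.mem_univ, true_and] at hp ⊢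
    rw [Function.update_of_ne hbi.symm, Function.update_of_ne hbi'.symm, Function.update_self]
    exact ⟨⟨hp.1.ne Fin.castSucc_lt_succ.ne, hp.2.1⟩, rfl⟩
  · have h := card_le_card_mul_pow (V := V) ({p : Fin (m + 3) → V |
      (p i.castSucc ≠ p i.succ ∧ φ s(p i.castSucc, p i.succ) = c) ∧ p b = z})
      {b, i.castSucc, i.succ} (fun p => (p i.castSucc, p i.succ))
      ({z : V × V | z.1 ≠ z.2 ∧ φ s(z.1, z.2) = c}) (by
        intro p hp
        simp only [Finset.mem_filter, Finset.mem_univ, true_and] at hp ⊢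
        exact hp.1) (by
        intro p hp q hq h h0
        simp only [Finset.mem_filter, Finset.mem_univ, true_and, Prod.mk.injEq] at hp hq h0
        simp only [Finset.mem_insert, Finset.mem_singleton, not_or, and_imp] at h
        funext a
        by_cases h1 : a = i.castSucc
        · rw [h1, h0.1]
        by_cases h2 : a = i.succ
        · rw [h2, h0.2]
        by_cases h3 : a = b
        · rw [h3, hp.2, hq.2]
        exact h a h3 h1 h2)
    refine h.trans ?_
    rw [Finset.card_eq_three.2 ⟨b, i.castSucc, i.succ, hbi, hbi', Fin.castSucc_lt_succ.ne, rfl⟩,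
      Fintype.card_fin]
    exact Nat.mul_le_mul_right _ (hg c)

end rainbow

section pathHypergraph

lemma card_le_of_exists_snd {X ι : Type*} [Fintype ι] [DecidableEq X] {t B : ℕ}
    (F : Finset (Fin t × X)) (P : ι → X → Prop) (h : ∀ j, ∃ S : Finset X, #S ≤ B ∧ ∀ p, P j p → p ∈ S)
    (hF : ∀ x ∈ F, ∃ j, P j x.2) : #F ≤ t * (Fintype.card ι * B) := by
  choose S hS hPS using h
  have hsub : F ⊆ (univ : Finset (Fin t)) ×ˢ (univ : Finset ι).biUnion S := by
    intro x hx
    simp only [Finset.mem_product, Finset.mem_univ, true_and, Finset.mem_biUnion]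
    obtain ⟨j, hj⟩ := hF x hx
    exact ⟨j, hPS j _ hj⟩
  refine (Finset.card_le_card hsub).trans ?_
  rw [Finset.card_product, Finset.card_univ, Fintype.card_fin]
  exact Nat.mul_le_mul_left _ (Finset.card_biUnion_le_card_mul _ _ _ fun j _ => hS j)

lemma card_le_of_fst_eq_exists_snd {X ι : Type*} [Fintype ι] [DecidableEq X] {t B : ℕ} (i : Fin t)
    (F : Finset (Fin t × X)) (P : ι → X → Prop) (h : ∀ j, ∃ S : Finset X, #S ≤ B ∧ ∀ p, P j p → p ∈ S)
    (hF : ∀ x ∈ F, i = x.1 ∧ ∃ j, P j x.2) : #F ≤ Fintype.card ι * B := by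
  choose S hS hPS using h
  have hsub : F ⊆ ({i} : Finset (Fin t)) ×ˢ (univ : Finset ι).biUnion S := by
    intro x hx
    simp only [Finset.mem_product, Finset.mem_univ, true_and, Finset.mem_biUnion,
      Finset.mem_singleton]
    obtain ⟨hi, j, hj⟩ := hF x hx
    exact ⟨hi.symm, j, hPS j _ hj⟩
  refine (Finset.card_le_card hsub).trans ?_
  rw [Finset.card_product, Finset.card_singleton, one_mul]
  exact Finset.card_biUnion_le_card_mul _ _ _ fun j _ => hS j

variable {V κ : Type} [Fintype V] [DecidableEq V] [DecidableEq κ]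

/-- The vertices of the auxiliary hypergraph blocked by placing the path `x.2` in slot `x.1`. -/
def pathBlock (φ : Sym2 V → κ) {t k : ℕ} (x : Fin t × (Fin (k + 1) → V)) :
    Finset (Sym2 V ⊕ Fin t × (V ⊕ κ)) :=
  (univ.image (edgeAt x.2)).disjSum
    ({x.1} ×ˢ (univ.image x.2).disjSum (univ.image fun j => φ (edgeAt x.2 j)))

variable (φ : Sym2 V → κ) {t k : ℕ}

lemma inl_mem_pathBlock (x : Fin t × (Fin (k + 1) → V)) (e : Sym2 V) :
    Sum.inl e ∈ pathBlock φ x ↔ ∃ j, edgeAt x.2 j = e := by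
  simp [pathBlock]

lemma inr_inl_mem_pathBlock (x : Fin t × (Fin (k + 1) → V)) (i : Fin t) (v : V) :
    Sum.inr (i, Sum.inl v) ∈ pathBlock φ x ↔ i = x.1 ∧ ∃ a, x.2 a = v := by
  simp [pathBlock, and_comm, eq_comm]

lemma inr_inr_mem_pathBlock (x : Fin t × (Fin (k + 1) → V)) (i : Fin t) (c : κ) :
    Sum.inr (i, Sum.inr c) ∈ pathBlock φ x ↔ i = x.1 ∧ ∃ j, φ (edgeAt x.2 j) = c := by
  simp [pathBlock, and_comm, eq_comm]

variable (G : SimpleGraph V) [DecidableRel G.Adj]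

lemma card_pathBlock {x : Fin t × (Fin (k + 1) → V)} (hx : x.2 ∈ rainbowPaths G φ k) :
    #(pathBlock φ x) = 3 * k + 1 := by
  simp only [rainbowPaths, Finset.mem_filter] at hx
  have h : Function.Injective (edgeAt x.2) := fun i j hij => hx.2.2 (by simp [hij])
  rw [pathBlock, Finset.card_disjSum, Finset.card_product, Finset.card_disjSum,
    Finset.card_image_of_injective _ h, Finset.card_image_of_injective _ hx.2.1,
    Finset.card_image_of_injective _ hx.2.2]
  simp
  ring

variable {m L g Δ : ℕ}

open Classical in
lemma card_membersAt_pathBlock_le (hg : ∀ c, #{z : V × V | z.1 ≠ z.2 ∧ φ s(z.1, z.2) = c} ≤ g)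
    (hΔ : ∀ v, #{u | G.Adj u v} ≤ Δ) (htg : 2 * t ≤ g) (hΔg : Δ ≤ g)
    (w : Sym2 V ⊕ Fin t × (V ⊕ κ)) :
    #(membersAt ((univ : Finset (Fin t)) ×ˢ rainbowPaths G φ (m + 2)) (pathBlock φ) w) ≤
      (m + 3) * (g * Δ ^ (m + 1)) := by
  have hsub : rainbowPaths G φ (m + 2) ⊆ walksOf G (m + 2) := Finset.filter_subset _ _
  rcases w with e | ⟨i, v | c⟩
  · simp only [membersAt, inl_mem_pathBlock]
    refine (card_le_of_exists_snd _ (fun j p => p ∈ rainbowPaths G φ (m + 2) ∧ edgeAt p j = e)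
      (fun j => ⟨_, card_walksOf_edgeAt_eq_le G hΔ (m + 1) j e, fun p hp =>
        Finset.mem_filter.2 ⟨hsub hp.1, hp.2⟩⟩) fun x hx => ?_).trans ?_
    · rw [Finset.mem_filter, Finset.mem_product] at hx
      obtain ⟨hx, j, hj⟩ := hx
      exact ⟨j, hx.2, hj⟩
    rw [Fintype.card_fin]
    have := Nat.mul_le_mul htg (le_refl ((m + 2) * Δ ^ (m + 1)))
    nlinarith [Nat.zero_le (g * Δ ^ (m + 1))]
  · simp only [membersAt, inr_inl_mem_pathBlock]
    refine (card_le_of_fst_eq_exists_snd i _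
      (fun a p => p ∈ rainbowPaths G φ (m + 2) ∧ p a = v)
      (fun a => ⟨_, card_walksOf_apply_eq_le G hΔ (m + 2) a v, fun p hp =>
        Finset.mem_filter.2 ⟨hsub hp.1, hp.2⟩⟩) fun x hx => ?_).trans ?_
    · rw [Finset.mem_filter, Finset.mem_product] at hx
      obtain ⟨hx, hi, j, hj⟩ := hx
      exact ⟨hi, j, hx.2, hj⟩
    rw [Fintype.card_fin, pow_succ' _ (m + 1)]
    exact Nat.mul_le_mul_left _ (Nat.mul_le_mul_right _ hΔg)
  · simp only [membersAt, inr_inr_mem_pathBlock]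
    refine (card_le_of_fst_eq_exists_snd i _
      (fun j p => p ∈ rainbowPaths G φ (m + 2) ∧ φ (edgeAt p j) = c)
      (fun a => ⟨_, card_walksOf_colour_eq_le G φ hg hΔ (m + 1) a c, fun p hp =>
        Finset.mem_filter.2 ⟨hsub hp.1, hp.2⟩⟩) fun x hx => ?_).trans ?_
    · rw [Finset.mem_filter, Finset.mem_product] at hx
      obtain ⟨hx, hi, j, hj⟩ := hx
      exact ⟨hi, j, hx.2, hj⟩
    rw [Fintype.card_fin]
    exact Nat.mul_le_mul_right _ (by omega)

open Classical in
lemma card_pathBlock_codegree_le (z : V) (hL : ∀ v c, #{u | v ≠ u ∧ φ s(v, u) = c} ≤ L)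
    (hg : ∀ c, #{z : V × V | z.1 ≠ z.2 ∧ φ s(z.1, z.2) = c} ≤ g)
    (htN : t ≤ Fintype.card V) (hgN : g ≤ 2 * Fintype.card V) (hL1 : 1 ≤ L)
    (w w' : Sym2 V ⊕ Fin t × (V ⊕ κ)) (hw : w ≠ w') :
    #{x ∈ (univ : Finset (Fin t)) ×ˢ rainbowPaths G φ (m + 2) |
      w ∈ pathBlock φ x ∧ w' ∈ pathBlock φ x} ≤
      4 * (m + 3) ^ 2 * (L * Fintype.card V ^ (m + 1)) := by
  set R := rainbowPaths G φ (m + 2) with hR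
  set N := Fintype.card V with hN
  have hinj : ∀ p ∈ R, Function.Injective p ∧ Function.Injective fun j => φ (edgeAt p j) :=
    fun p hp => (Finset.mem_filter.1 hp).2
  have hLN : N ^ (m + 1) ≤ L * N ^ (m + 1) := Nat.le_mul_of_pos_left _ hL1
  have key : ∀ a b : ℕ, a ≤ (m + 3) ^ 2 → b ≤ 4 * (L * N ^ (m + 1)) →
      a * b ≤ 4 * (m + 3) ^ 2 * (L * N ^ (m + 1)) := fun a b ha hb =>
    (Nat.mul_le_mul ha hb).trans (le_of_eq (by ring))
  have hm1 : m + 2 ≤ (m + 3) ^ 2 := by nlinarith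
  have edge : ∀ (e : Sym2 V) (w : Sym2 V ⊕ Fin t × (V ⊕ κ)) (i : Fin t),
      (∀ x : Fin t × (Fin (m + 3) → V), w ∈ pathBlock φ x → i = x.1) →
      #{x ∈ (univ : Finset (Fin t)) ×ˢ R | Sum.inl e ∈ pathBlock φ x ∧ w ∈ pathBlock φ x} ≤
        4 * (m + 3) ^ 2 * (L * N ^ (m + 1)) := by
    intro e w i hi
    refine (card_le_of_fst_eq_exists_snd i _ (fun j p => edgeAt p j = e)
      (fun j => ⟨_, card_edgeAt_eq_le j e, fun p hp => by simpa using hp⟩) fun x hx => ?_).trans ?_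
    · simp only [Finset.mem_filter, inl_mem_pathBlock] at hx
      exact ⟨hi x hx.2.2, hx.2.1⟩
    · rw [Fintype.card_fin]
      refine key _ _ hm1 ?_
      rw [← hN]
      omega
  have two : ∀ (i : Fin t) {ι ι' : Type} [Fintype ι] [Fintype ι']
      (P : ι × ι' → (Fin (m + 3) → V) → Prop) (w w' : Sym2 V ⊕ Fin t × (V ⊕ κ)),
      Fintype.card ι ≤ m + 3 → Fintype.card ι' ≤ m + 3 →
      (∀ j, ∃ S : Finset (Fin (m + 3) → V), #S ≤ 4 * (L * N ^ (m + 1)) ∧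
        ∀ p, P j p ∧ Function.Injective p → p ∈ S) →
      (∀ x : Fin t × (Fin (m + 3) → V), w ∈ pathBlock φ x → w' ∈ pathBlock φ x →
        i = x.1 ∧ ∃ j, P j x.2) →
      #{x ∈ (univ : Finset (Fin t)) ×ˢ R | w ∈ pathBlock φ x ∧ w' ∈ pathBlock φ x} ≤
        4 * (m + 3) ^ 2 * (L * N ^ (m + 1)) := by
    intro i ι ι' _ _ P w w' h1 h2 hP h
    refine (card_le_of_fst_eq_exists_snd i _ _ hP fun x hx => ?_).trans ?_
    · simp only [Finset.mem_filter, Finset.mem_product] at hx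
      obtain ⟨h3, j, hj⟩ := h x hx.2.1 hx.2.2
      exact ⟨h3, j, hj, (hinj _ hx.1.2).1⟩
    · rw [Fintype.card_prod]
      exact key _ _ (by rw [sq]; exact Nat.mul_le_mul h1 h2) le_rfl
  have hvc : ∀ (i : Fin t) (v : V) (i' : Fin t) (c : κ),
      #{x ∈ (univ : Finset (Fin t)) ×ˢ R | Sum.inr (i, Sum.inl v) ∈ pathBlock φ x ∧
        Sum.inr (i', Sum.inr c) ∈ pathBlock φ x} ≤ 4 * (m + 3) ^ 2 * (L * N ^ (m + 1)) := by
    intro i v i' c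
    refine two i (ι := Fin (m + 3)) (ι' := Fin (m + 2))
      (fun j p => p j.1 = v ∧ φ (edgeAt p j.2) = c) _ _ (by simp) (by simp) ?_ ?_
    · rintro ⟨a, j⟩
      exact ⟨_, (card_apply_eq_colour_eq_le φ hL a j v c).trans (Nat.le_mul_of_pos_left _ four_pos),
        fun p hp => Finset.mem_filter.2 ⟨Finset.mem_univ _, hp.2, hp.1⟩⟩
    · intro x h1 h2
      rw [inr_inl_mem_pathBlock] at h1
      rw [inr_inr_mem_pathBlock] at h2
      obtain ⟨h1, a, ha⟩ := h1
      obtain ⟨-, j, hj⟩ := h2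
      exact ⟨h1, (a, j), ha, hj⟩
  rcases w with e | ⟨i, v | c⟩ <;> rcases w' with e' | ⟨i', v' | c'⟩
  · refine (card_le_of_exists_snd _
      (fun (j : Fin (m + 2) × Fin (m + 2)) p => edgeAt p j.1 = e ∧ edgeAt p j.2 = e')
      (B := 4 * N ^ m) ?_ fun x hx => ?_).trans ?_
    · rintro ⟨j, j'⟩
      by_cases hjj : j = j'
      · subst hjj
        exact ⟨∅, by simp, fun p h => absurd (by rw [← h.1, ← h.2]) hw⟩
      · exact ⟨_, card_edgeAt_eq_edgeAt_eq_le hjj e e', fun p hp =>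
          Finset.mem_filter.2 ⟨Finset.mem_univ _, hp⟩⟩
    · simp only [Finset.mem_filter, inl_mem_pathBlock] at hx
      obtain ⟨hx, ⟨j, hj⟩, j', hj'⟩ := hx
      exact ⟨(j, j'), hj, hj'⟩
    · rw [Fintype.card_prod, Fintype.card_fin]
      calc t * ((m + 2) * (m + 2) * (4 * N ^ m)) ≤ N * ((m + 3) * (m + 3) * (4 * N ^ m)) := by
            gcongr <;> omega
        _ = 4 * (m + 3) ^ 2 * N ^ (m + 1) := by ring
        _ ≤ _ := Nat.mul_le_mul_left _ hLN
  · exact edge e _ i' fun x hx => ((inr_inl_mem_pathBlock φ x _ _).1 hx).1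
  · exact edge e _ i' fun x hx => ((inr_inr_mem_pathBlock φ x _ _).1 hx).1
  · simp only [and_comm (a := Sum.inr (i, Sum.inl v) ∈ _)]
    exact edge e' _ i fun x hx => ((inr_inl_mem_pathBlock φ x _ _).1 hx).1
  · refine two i (ι := Fin (m + 3)) (ι' := Fin (m + 3))
      (fun j p => i = i' ∧ p j.1 = v ∧ p j.2 = v') _ _ (by simp) (by simp) ?_ ?_
    · rintro ⟨a, b⟩
      by_cases hab : a = b
      · subst hab
        exact ⟨∅, by simp, fun p h => absurd (by rw [h.1.1, ← h.1.2.1, ← h.1.2.2]) hw⟩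
      · exact ⟨_, (card_apply_eq_apply_eq_le hab v v').trans
          (hLN.trans (Nat.le_mul_of_pos_left _ four_pos)),
          fun p hp => Finset.mem_filter.2 ⟨Finset.mem_univ _, hp.1.2⟩⟩
    · intro x h1 h2
      rw [inr_inl_mem_pathBlock] at h1 h2
      obtain ⟨h1, a, ha⟩ := h1
      obtain ⟨h2, b, hb⟩ := h2
      exact ⟨h1, (a, b), h1.trans h2.symm, ha, hb⟩
  · exact hvc i v i' c'
  · simp only [and_comm (a := Sum.inr (i, Sum.inr c) ∈ _)]
    exact edge e' _ i fun x hx => ((inr_inr_mem_pathBlock φ x _ _).1 hx).1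
  · simp only [and_comm (a := Sum.inr (i, Sum.inr c) ∈ _)]
    exact hvc i' v' i c
  · refine two i (ι := Fin (m + 2)) (ι' := Fin (m + 2))
      (fun j p => i = i' ∧ φ (edgeAt p j.1) = c ∧ φ (edgeAt p j.2) = c') _ _
      (by simp) (by simp) ?_ ?_
    · rintro ⟨a, b⟩
      by_cases hab : a = b
      · subst hab
        exact ⟨∅, by simp, fun p h => absurd (by rw [h.1.1, ← h.1.2.1, ← h.1.2.2]) hw⟩
      · refine ⟨_, (card_colour_eq_colour_eq_le φ z hL hg hab c c').trans ?_,
          fun p hp => Finset.mem_filter.2 ⟨Finset.mem_univ _, hp.2, hp.1.2⟩⟩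
        · calc L * (g * N ^ m) ≤ L * (2 * N * N ^ m) := by gcongr
            _ = 2 * (L * N ^ (m + 1)) := by ring
            _ ≤ _ := by omega
    · intro x h1 h2
      rw [inr_inr_mem_pathBlock] at h1 h2
      obtain ⟨h1, a, ha⟩ := h1
      obtain ⟨h2, b, hb⟩ := h2
      exact ⟨h1, (a, b), h1.trans h2.symm, ha, hb⟩

end pathHypergraph

lemma exists_disjoint_rainbowPaths (m : ℕ) {a : ℝ} (ha : a < 1) : ∃ δ : ℝ, 0 < δ ∧
    ∀ (V κ : Type) [Fintype V] [DecidableEq V] [DecidableEq κ] (φ : Sym2 V → κ)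
      (G : SimpleGraph V) [DecidableRel G.Adj] (L g Δ t : ℕ), Nonempty V →
      (∀ v c, #{u | v ≠ u ∧ φ s(v, u) = c} ≤ L) →
      (∀ c, #{z : V × V | z.1 ≠ z.2 ∧ φ s(z.1, z.2) = c} ≤ g) →
      (∀ v, #{u | G.Adj u v} ≤ Δ) → 2 * t ≤ g → Δ ≤ g → t ≤ Fintype.card V →
      g ≤ 2 * Fintype.card V → 1 ≤ L →
      ((4 * (m + 3) ^ 2 * (L * Fintype.card V ^ (m + 1)) : ℕ) : ℝ) ≤
        δ * ((m + 3) * (g * Δ ^ (m + 1)) : ℕ) →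
      ∃ M : Finset (Fin t × (Fin (m + 3) → V)), (∀ x ∈ M, x.2 ∈ rainbowPaths G φ (m + 2)) ∧
        (∀ x ∈ M, ∀ y ∈ M, x ≠ y → (∀ i j, edgeAt x.2 i ≠ edgeAt y.2 j) ∧
          (x.1 = y.1 → (∀ i j, x.2 i ≠ y.2 j) ∧
            ∀ i j, φ (edgeAt x.2 i) ≠ φ (edgeAt y.2 j))) ∧
        a * (t * #(rainbowPaths G φ (m + 2))) ≤ #M * ((m + 3) * (g * Δ ^ (m + 1)) : ℕ) := by
  obtain ⟨δ, hδ, h⟩ := hasLargeMatchings (3 * (m + 2)) ha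
  refine ⟨δ, hδ, fun V κ _ _ _ φ G _ L g Δ t hV hL hg hΔ htg hΔg htN hgN hL1 hD => ?_⟩
  obtain ⟨z⟩ := hV
  obtain ⟨M, hM, hdisj, hcard⟩ := h (Fin t × (Fin (m + 3) → V)) (Sym2 V ⊕ Fin t × (V ⊕ κ))
    (univ ×ˢ rainbowPaths G φ (m + 2)) (pathBlock φ) _ _
    (fun x hx => card_pathBlock φ G (Finset.mem_product.1 hx).2)
    (fun w => by
      convert card_membersAt_pathBlock_le φ G hg hΔ htg hΔg w)
    (fun w w' hw => by
      convert card_pathBlock_codegree_le φ G z hL hg htN hgN hL1 w w' hw)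
    (by
      have : 0 < Fintype.card V := Fintype.card_pos_iff.2 ⟨z⟩
      exact Nat.succ_le_of_lt (by positivity)) hD
  refine ⟨M, fun x hx => (Finset.mem_product.1 (hM hx)).2, fun x hx y hy hxy => ?_, ?_⟩
  · have hd := Finset.disjoint_left.1 (hdisj x hx y hy hxy)
    refine ⟨fun i j hij => ?_, fun h1 => ⟨fun i j hij => ?_, fun i j hij => ?_⟩⟩
    · exact hd ((inl_mem_pathBlock φ x _).2 ⟨i, rfl⟩) ((inl_mem_pathBlock φ y _).2 ⟨j, hij.symm⟩)
    · exact hd ((inr_inl_mem_pathBlock φ x x.1 _).2 ⟨rfl, i, rfl⟩)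
        ((inr_inl_mem_pathBlock φ y x.1 _).2 ⟨h1, j, hij.symm⟩)
    · exact hd ((inr_inr_mem_pathBlock φ x x.1 _).2 ⟨rfl, i, rfl⟩)
        ((inr_inr_mem_pathBlock φ y x.1 _).2 ⟨h1, j, hij.symm⟩)
  · rw [Finset.card_product, Finset.card_univ, Fintype.card_fin] at hcard
    exact_mod_cast hcard

section search
variable {J : Type*} [DecidableEq J]

/-- A state of the depth-first search along the relation `R`: explored elements `T`, current
stack `S` (top first), unexplored elements `W` and used colours `K`. -/
structure SearchState (Q : Finset J) (R : J → J → ℕ → Prop) (T W : Finset J) (S : List (J × ℕ))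
    (K : Finset ℕ) : Prop where
  nodup : (S.map Prod.fst).Nodup
  cover : ∀ x, x ∈ Q ↔ x ∈ T ∨ x ∈ W ∨ x ∈ S.map Prod.fst
  disjoint_T_W : Disjoint T W
  disjoint_T : ∀ x ∈ S.map Prod.fst, x ∉ T
  disjoint_W : ∀ x ∈ S.map Prod.fst, x ∉ W
  no_link : ∀ a ∈ T, ∀ b ∈ W, ∀ c ∉ K, ¬ R a b c
  chain : S.IsChain fun x y => R y.1 x.1 x.2
  nodup_colours : (S.map Prod.snd).Nodup
  colours_mem : ∀ c ∈ S.map Prod.snd, c ∈ K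
  card_colours : #K ≤ #T + S.length

lemma SearchState.card_eq {Q : Finset J} {R : J → J → ℕ → Prop} {T W : Finset J}
    {S : List (J × ℕ)} {K : Finset ℕ} (h : SearchState Q R T W S K) :
    #Q = #T + #W + S.length := by
  have h1 : Q = (T ∪ W) ∪ (S.map Prod.fst).toFinset := by
    ext x
    simp only [h.cover, Finset.mem_union, List.mem_toFinset, or_assoc]
  have h2 : Disjoint (T ∪ W) (S.map Prod.fst).toFinset := by
    rw [Finset.disjoint_right]
    intro x hx
    rw [List.mem_toFinset] at hx
    simp [h.disjoint_T x hx, h.disjoint_W x hx]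
  rw [h1, Finset.card_union_of_disjoint h2, Finset.card_union_of_disjoint h.disjoint_T_W,
    List.toFinset_card_of_nodup h.nodup, List.length_map]

lemma exists_searchState (Q : Finset J) (R : J → J → ℕ → Prop) (N : ℕ) (hN : N ≤ #Q) :
    ∃ T W S K, SearchState Q R T W S K ∧ #T + #Q = #W + N := by
  classical
  induction N with
  | zero =>
    refine ⟨∅, Q, [], ∅, ⟨?_, ?_, ?_, ?_, ?_, ?_, ?_, ?_, ?_, ?_⟩, ?_⟩ <;> simp
  | succ N ih =>
    obtain ⟨T, W, S, K, h, hcard⟩ := ih (by omega)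
    have hsize := h.card_eq
    rcases S with _ | ⟨x, S⟩
    · obtain ⟨b, hb⟩ : W.Nonempty := by
        rw [← Finset.card_pos]
        simp only [List.length_nil] at hsize
        omega
      obtain ⟨c, hc⟩ := Infinite.exists_notMem_finset K
      refine ⟨T, W.erase b, [(b, c)], insert c K, ⟨?_, ?_, ?_, ?_, ?_, ?_, ?_, ?_, ?_, ?_⟩, ?_⟩
      · simp
      · intro x
        rw [h.cover]
        by_cases hx : x = b
        · subst hx; simp [hb]
        · simp [hx]
      · exact h.disjoint_T_W.mono_right (Finset.erase_subset _ _)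
      · simpa using fun hT => Finset.disjoint_left.1 h.disjoint_T_W hT hb
      · simp
      · intro a ha b' hb' c' hc'
        exact h.no_link a ha b' (Finset.mem_of_mem_erase hb') c'
          fun hK => hc' (Finset.mem_insert_of_mem hK)
      · simp
      · simp
      · simp
      · have := h.card_colours
        rw [Finset.card_insert_of_notMem hc]
        simpa using this
      · have := Finset.card_erase_add_one hb
        omega
    · by_cases hlink : ∃ b ∈ W, ∃ c ∉ K, R x.1 b c
      · obtain ⟨b, hb, c, hc, hR⟩ := hlink
        refine ⟨T, W.erase b, (b, c) :: x :: S, insert c K,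
          ⟨?_, ?_, ?_, ?_, ?_, ?_, ?_, ?_, ?_, ?_⟩, ?_⟩
        · rw [List.map_cons, List.nodup_cons]
          exact ⟨fun hbS => h.disjoint_W b hbS hb, h.nodup⟩
        · intro y
          rw [h.cover]
          by_cases hy : y = b
          · subst hy; simp [hb]
          · simp [hy]
        · exact h.disjoint_T_W.mono_right (Finset.erase_subset _ _)
        · intro y hy
          rw [List.map_cons, List.mem_cons] at hy
          rcases hy with rfl | hy
          · exact fun hT => Finset.disjoint_left.1 h.disjoint_T_W hT hb
          · exact h.disjoint_T y hy
        · intro y hy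
          rw [List.map_cons, List.mem_cons] at hy
          rcases hy with rfl | hy
          · simp
          · exact fun hW => h.disjoint_W y hy (Finset.mem_of_mem_erase hW)
        · intro a ha b' hb' c' hc'
          exact h.no_link a ha b' (Finset.mem_of_mem_erase hb') c'
            fun hK => hc' (Finset.mem_insert_of_mem hK)
        · exact List.isChain_cons_cons.2 ⟨hR, h.chain⟩
        · rw [List.map_cons, List.nodup_cons]
          exact ⟨fun hcS => hc (h.colours_mem c hcS), h.nodup_colours⟩
        · intro d hd
          rw [List.map_cons, List.mem_cons] at hd
          rcases hd with rfl | hd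
          · exact Finset.mem_insert_self _ _
          · exact Finset.mem_insert_of_mem (h.colours_mem d hd)
        · have := h.card_colours
          rw [Finset.card_insert_of_notMem hc]
          simp only [List.length_cons] at this ⊢
          omega
        · have := Finset.card_erase_add_one hb
          omega
      · have hxT : x.1 ∉ T := h.disjoint_T _ (by simp)
        have hnd := h.nodup
        rw [List.map_cons, List.nodup_cons] at hnd
        have hnd' := h.nodup_colours
        rw [List.map_cons, List.nodup_cons] at hnd'
        refine ⟨insert x.1 T, W, S, K, ⟨hnd.2, ?_, ?_, ?_, ?_, ?_, ?_, hnd'.2, ?_, ?_⟩, ?_⟩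
        · intro y
          rw [h.cover]
          simp only [List.map_cons, List.mem_cons, Finset.mem_insert]
          tauto
        · rw [Finset.disjoint_insert_left]
          exact ⟨h.disjoint_W _ (by simp), h.disjoint_T_W⟩
        · intro y hy
          rw [Finset.mem_insert, not_or]
          refine ⟨?_, h.disjoint_T y (by rw [List.map_cons]; exact List.mem_cons_of_mem _ hy)⟩
          rintro rfl
          exact hnd.1 hy
        · exact fun y hy => h.disjoint_W y (by rw [List.map_cons]; exact List.mem_cons_of_mem _ hy)
        · intro a ha b hb c hc hR
          rw [Finset.mem_insert] at ha
          rcases ha with rfl | ha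
          · exact hlink ⟨b, hb, c, hc, hR⟩
          · exact h.no_link a ha b hb c hc hR
        · exact (List.isChain_cons.1 h.chain).2
        · exact fun c hc => h.colours_mem c (by rw [List.map_cons]; exact List.mem_cons_of_mem _ hc)
        · have := h.card_colours
          rw [Finset.card_insert_of_notMem hxT]
          simp only [List.length_cons] at this
          omega
        · rw [Finset.card_insert_of_notMem hxT]
          omega

/-- A long cyclic sequence of elements of `Q` in which every element is entered along a link of its
own colour. -/
lemma exists_linked_cycle (Q : Finset J) (R : J → J → ℕ → Prop) (w : ℕ) (hw : 4 * w < #Q)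
    (hR : ∀ A ⊆ Q, ∀ B ⊆ Q, Disjoint A B → w ≤ #A → w ≤ #B → ∀ K : Finset ℕ, #K ≤ #Q →
      ∃ a ∈ A, ∃ b ∈ B, ∃ c ∉ K, R a b c) :
    ∃ l : List (J × ℕ), (l.map Prod.fst).Nodup ∧ (∀ x ∈ l, x.1 ∈ Q) ∧ (l.map Prod.snd).Nodup ∧
      #Q ≤ l.length + 4 * w ∧ l.IsChain (fun x y => R x.1 y.1 y.2) ∧
      ∃ x y, l.getLast? = some x ∧ l.head? = some y ∧ R x.1 y.1 y.2 := by
  obtain ⟨T, W, S, K, h, hcard⟩ := exists_searchState Q R #Q le_rfl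
  have hsize := h.card_eq
  have hTQ : T ⊆ Q := fun x hx => (h.cover x).2 (Or.inl hx)
  have hWQ : W ⊆ Q := fun x hx => (h.cover x).2 (Or.inr (Or.inl hx))
  have hKQ : #K ≤ #Q := by have := h.card_colours; omega
  have hTw : #T < w := by
    by_contra! hT
    obtain ⟨a, ha, b, hb, c, hc, hab⟩ := hR T hTQ W hWQ h.disjoint_T_W hT (by omega) K hKQ
    exact h.no_link a ha b hb c hc hab
  have hS : #Q ≤ S.length + 2 * w := by omega
  have hSlen : 2 * w < S.length := by omega
  set S1 := S.take w with hS1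
  set S2 := (S.drop w).take (S.length - 2 * w) with hS2
  set S3 := (S.drop w).drop (S.length - 2 * w) with hS3
  have hSeq : S = S1 ++ (S2 ++ S3) := by
    rw [hS1, hS2, hS3, List.take_append_drop, List.take_append_drop]
  have hl1 : S1.length = w := by rw [hS1, List.length_take]; omega
  have hl2 : S2.length = S.length - 2 * w := by
    rw [hS2, List.length_take, List.length_drop]; omega
  have hl3 : S3.length = w := by rw [hS3, List.length_drop, List.length_drop]; omega
  have hnd := h.nodup
  rw [hSeq, List.map_append, List.map_append, List.nodup_append'] at hnd
  obtain ⟨hnd1, hnd23, hdisj⟩ := hnd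
  have hnd3 := (List.nodup_append'.1 hnd23).2.1
  have hmemQ : ∀ x ∈ S, x.1 ∈ Q := fun x hx =>
    (h.cover x.1).2 (Or.inr (Or.inr (List.mem_map_of_mem hx)))
  obtain ⟨a, ha, b, hb, c, hc, hab⟩ := hR (S1.map Prod.fst).toFinset (by
      intro x hx
      rw [List.mem_toFinset, List.mem_map] at hx
      obtain ⟨y, hy, rfl⟩ := hx
      exact hmemQ y (by rw [hSeq]; simp [hy]))
    (S3.map Prod.fst).toFinset (by
      intro x hx
      rw [List.mem_toFinset, List.mem_map] at hx
      obtain ⟨y, hy, rfl⟩ := hx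
      exact hmemQ y (by rw [hSeq]; simp [hy]))
    (by
      rw [Finset.disjoint_left]
      intro x hx hx'
      rw [List.mem_toFinset] at hx hx'
      exact hdisj hx (List.mem_append_right _ hx'))
    (by rw [List.toFinset_card_of_nodup hnd1, List.length_map, hl1])
    (by rw [List.toFinset_card_of_nodup hnd3, List.length_map, hl3]) K hKQ
  rw [List.mem_toFinset, List.mem_map] at ha hb
  obtain ⟨a, ha, rfl⟩ := ha
  obtain ⟨b, hb, rfl⟩ := hb
  obtain ⟨P1, P1', hP1⟩ := List.append_of_mem ha
  obtain ⟨P3', P3, hP3⟩ := List.append_of_mem hb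
  set M := (a :: P1') ++ S2 ++ P3' with hM
  have hSeq' : S = P1 ++ ((M ++ [b]) ++ P3) := by
    rw [hSeq, hP1, hP3, hM]; simp
  have hsub : (M ++ [b]).Sublist S := by
    rw [hSeq']
    exact (List.sublist_append_left _ _).trans (List.sublist_append_right _ _)
  have hchain : (M ++ [b]).IsChain fun x y => R y.1 x.1 x.2 := by
    have := h.chain
    rw [hSeq', List.isChain_append, List.isChain_append] at this
    exact this.2.1.1
  have hchain' : (M ++ [(b.1, c)]).IsChain fun x y => R y.1 x.1 x.2 := by
    rw [List.isChain_append] at hchain ⊢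
    refine ⟨hchain.1, List.isChain_singleton _, fun x hx y hy => ?_⟩
    have := hchain.2.2 x hx b (by simp)
    simp only [List.head?_cons, Option.mem_def, Option.some.injEq] at hy
    rw [← hy]
    exact this
  refine ⟨(M ++ [(b.1, c)]).reverse, ?_, ?_, ?_, ?_, ?_, ?_⟩
  · rw [List.map_reverse, List.nodup_reverse]
    have := h.nodup.sublist (hsub.map Prod.fst)
    simpa using this
  · intro x hx
    rw [List.mem_reverse, List.mem_append, List.mem_singleton] at hx
    rcases hx with hx | rfl
    · exact hmemQ x (hsub.subset (by simp [hx]))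
    · exact hmemQ b (hsub.subset (by simp))
  · rw [List.map_reverse, List.nodup_reverse, List.map_append, List.nodup_append']
    have h1 := h.nodup_colours.sublist (hsub.map Prod.snd)
    rw [List.map_append, List.nodup_append'] at h1
    refine ⟨h1.1, by simp, ?_⟩
    intro d hd hd'
    simp only [List.map_cons, List.map_nil, List.mem_singleton] at hd'
    subst hd'
    refine hc (h.colours_mem _ ?_)
    refine (hsub.map Prod.snd).subset ?_
    rw [List.map_append]
    exact List.mem_append_left _ hd
  · rw [List.length_reverse, hM]
    simp only [List.length_append, List.length_cons, List.length_nil]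
    omega
  · rw [List.isChain_reverse]
    exact hchain'
  · refine ⟨a, (b.1, c), ?_, ?_, hab⟩
    · rw [List.getLast?_reverse, hM]; simp
    · rw [List.head?_reverse]; simp

end search

section assembling
variable {V : Type*}

/-- The edges between consecutive elements of a list. -/
def edgesOf : List V → List (Sym2 V)
  | a :: b :: l => s(a, b) :: edgesOf (b :: l)
  | _ => []

lemma edgesOf_append {l₁ l₂ : List V} {u v : V} (h₁ : l₁.getLast? = some u)
    (h₂ : l₂.head? = some v) : edgesOf (l₁ ++ l₂) = edgesOf l₁ ++ s(u, v) :: edgesOf l₂ := by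
  induction l₁ with
  | nil => simp at h₁
  | cons a l₁ ih =>
    rcases l₁ with _ | ⟨b, l₁⟩
    · rcases l₂ with _ | ⟨c, l₂⟩
      · simp at h₂
      · simp only [List.getLast?_singleton, Option.some.injEq, List.head?_cons] at h₁ h₂
        subst h₁ h₂
        rfl
    · rw [List.getLast?_cons_cons] at h₁
      simp only [List.cons_append, edgesOf, List.cons.injEq, true_and]
      exact ih h₁

lemma edgesOf_sublist_append_right (l₁ l₂ : List V) :
    (edgesOf l₁).Sublist (edgesOf (l₁ ++ l₂)) := by
  rcases List.eq_nil_or_concat l₁ with rfl | ⟨L, u, rfl⟩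
  · exact List.nil_sublist _
  rcases l₂ with _ | ⟨v, l₂⟩
  · simp
  rw [edgesOf_append (u := u) (v := v) (by simp) (by simp)]
  exact List.sublist_append_left _ _

lemma edgesOf_sublist_append_left (l₁ l₂ : List V) :
    (edgesOf l₂).Sublist (edgesOf (l₁ ++ l₂)) := by
  rcases List.eq_nil_or_concat l₁ with rfl | ⟨L, u, rfl⟩
  · simp
  rcases l₂ with _ | ⟨v, l₂⟩
  · exact List.nil_sublist _
  rw [edgesOf_append (u := u) (v := v) (by simp) (by simp)]
  exact (List.sublist_cons_self _ _).trans (List.sublist_append_right _ _)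

lemma edgesOf_sublist_of_isInfix {l₁ l₂ : List V} (h : l₁ <:+: l₂) :
    (edgesOf l₁).Sublist (edgesOf l₂) := by
  obtain ⟨s, t, rfl⟩ := h
  exact (edgesOf_sublist_append_left s l₁).trans (edgesOf_sublist_append_right _ t)

lemma edgesOf_ofFn {k : ℕ} (p : Fin (k + 1) → V) :
    edgesOf (List.ofFn p) = List.ofFn (edgeAt p) := by
  induction k with
  | zero => simp [edgesOf]
  | succ k ih =>
    have := ih (fun i => p i.succ)
    rw [List.ofFn_succ (f := fun i => p i.succ)] at this
    rw [List.ofFn_succ, List.ofFn_succ, edgesOf, this, List.ofFn_succ (f := edgeAt p)]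
    rfl

lemma exists_walk_of_nodup {L : List V} {u v : V} (hL : L.Nodup) (hv : L.head? = some v)
    (hu : L.getLast? = some u) :
    ∃ w : (⊤ : SimpleGraph V).Walk v u, w.support = L ∧ w.edges = edgesOf L := by
  induction L generalizing v with
  | nil => simp at hv
  | cons a L ih =>
    simp only [List.head?_cons, Option.some.injEq] at hv
    subst hv
    rcases L with _ | ⟨b, L⟩
    · simp only [List.getLast?_singleton, Option.some.injEq] at hu
      subst hu
      exact ⟨SimpleGraph.Walk.nil, rfl, rfl⟩
    · rw [List.nodup_cons] at hL
      rw [List.getLast?_cons_cons] at hu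
      obtain ⟨w, hw, hw'⟩ := ih hL.2 (v := b) rfl hu
      have hab : (⊤ : SimpleGraph V).Adj a b := by
        rw [SimpleGraph.top_adj]
        rintro rfl
        exact hL.1 (by simp)
      exact ⟨SimpleGraph.Walk.cons hab w, by simp [hw], by simp [hw', edgesOf]⟩

lemma exists_segment {p : List V} {s : ℕ} (hs : 2 * s ≤ p.length) {u v : V} (hv : v ∈ p.take s)
    (hu : u ∈ p.drop (p.length - s)) :
    ∃ q, q <:+: p ∧ q.head? = some v ∧ q.getLast? = some u ∧ p.length ≤ q.length + 2 * s := by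
  obtain ⟨A, A', hA⟩ := List.append_of_mem hv
  obtain ⟨B, B', hB⟩ := List.append_of_mem hu
  have hp : p = p.take s ++ ((p.drop s).take (p.length - 2 * s) ++ p.drop (p.length - s)) := by
    conv_lhs => rw [← List.take_append_drop s p,
      ← List.take_append_drop (p.length - 2 * s) (p.drop s), List.drop_drop]
    congr 4
    omega
  set M := (p.drop s).take (p.length - 2 * s) with hM
  have h1 : (p.take s).length = s := by rw [List.length_take]; omega
  have h2 : (p.drop (p.length - s)).length = s := by rw [List.length_drop]; omega
  have h3 := congrArg List.length hp
  rw [List.length_append, List.length_append] at h3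
  refine ⟨(v :: A') ++ M ++ (B ++ [u]), ⟨A, B', ?_⟩, ?_, ?_, ?_⟩
  · rw [hp, hA, hB]
    simp
  · simp
  · rw [List.getLast?_append]
    simp
  · simp only [List.length_append, List.length_cons, List.length_nil]
    omega

variable (φ : Sym2 V → ℕ) (C₀ : Set ℕ) (U : Set (Sym2 V)) (s : ℕ)

/-- There is an unused edge of colour `c ∈ C₀` from the last `s` vertices of `p` to the first `s`
vertices of `q`. -/
def Linked (p q : List V) (c : ℕ) : Prop :=
  ∃ u ∈ p.drop (p.length - s), ∃ v ∈ q.take s, φ s(u, v) = c ∧ c ∈ C₀ ∧ s(u, v) ∉ U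

lemma exists_list_of_chain {len : ℕ} (hs : 2 * s ≤ len) (l : List (List V × ℕ))
    (hl : ∀ x ∈ l, x.1.length = len ∧ x.1.Nodup ∧ ((edgesOf x.1).map φ).Nodup ∧
      ∀ e ∈ edgesOf x.1, φ e ∉ C₀)
    (hdisj : l.Pairwise fun x y => x.1.Disjoint y.1 ∧
      ((edgesOf x.1).map φ).Disjoint ((edgesOf y.1).map φ))
    (hcol : (l.map Prod.snd).Nodup)
    (hchain : l.IsChain fun x y => Linked φ C₀ U s x.1 y.1 y.2)
    {y z : List V × ℕ} (hy : l.head? = some y) (hz : l.getLast? = some z) {u v : V}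
    (hv : v ∈ y.1.take s) (hu : u ∈ z.1.drop (z.1.length - s)) :
    ∃ L : List V, L.head? = some v ∧ L.getLast? = some u ∧ L.Nodup ∧
      (∀ a ∈ L, ∃ x ∈ l, a ∈ x.1) ∧ ((edgesOf L).map φ).Nodup ∧
      (∀ e ∈ edgesOf L, (∃ x ∈ l, e ∈ edgesOf x.1) ∨
        (φ e ∈ l.tail.map Prod.snd ∧ φ e ∈ C₀ ∧ e ∉ U)) ∧
      l.length * len ≤ L.length + l.length * (2 * s) := by
  induction l generalizing y v with
  | nil => simp at hy
  | cons x l ih =>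
    simp only [List.head?_cons, Option.some.injEq] at hy
    subst hy
    obtain ⟨hx1, hx2, hx3, hx4⟩ := hl x (by simp)
    rcases l with _ | ⟨x', l⟩
    · simp only [List.getLast?_singleton, Option.some.injEq] at hz
      subst hz
      obtain ⟨q, hq, hqv, hqu, hlen⟩ := exists_segment (by omega) hv hu
      refine ⟨q, hqv, hqu, hx2.sublist hq.sublist, fun a ha => ⟨x, by simp, hq.subset ha⟩,
        hx3.sublist ((edgesOf_sublist_of_isInfix hq).map φ), fun e he =>
        Or.inl ⟨x, by simp, (edgesOf_sublist_of_isInfix hq).subset he⟩, ?_⟩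
      simp only [List.length_cons, List.length_nil]
      omega
    · rw [List.isChain_cons_cons] at hchain
      obtain ⟨⟨u₁, hu₁, v₁, hv₁, hφ, hC, hU⟩, hchain⟩ := hchain
      rw [List.pairwise_cons] at hdisj
      rw [List.map_cons, List.nodup_cons] at hcol
      rw [List.getLast?_cons_cons] at hz
      obtain ⟨L, hLv, hLu, hLnd, hLmem, hLcol, hLe, hLlen⟩ := ih
        (fun x hx => hl x (List.mem_cons_of_mem _ hx)) hdisj.2 hcol.2 hchain rfl hz hv₁
      obtain ⟨q, hq, hqv, hqu, hlen⟩ := exists_segment (by omega) hv hu₁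
      have hqe := edgesOf_sublist_of_isInfix hq
      have hedges := edgesOf_append hqu hLv
      refine ⟨q ++ L, ?_, ?_, ?_, ?_, ?_, ?_, ?_⟩
      · rw [List.head?_append, hqv]; rfl
      · rw [List.getLast?_append, hLu]; rfl
      · rw [List.nodup_append']
        refine ⟨hx2.sublist hq.sublist, hLnd, fun a ha ha' => ?_⟩
        obtain ⟨x'', hx'', hax⟩ := hLmem a ha'
        exact (hdisj.1 x'' hx'').1 (hq.subset ha) hax
      · intro a ha
        rw [List.mem_append] at ha
        rcases ha with ha | ha
        · exact ⟨x, by simp, hq.subset ha⟩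
        · obtain ⟨x'', hx'', hax⟩ := hLmem a ha
          exact ⟨x'', List.mem_cons_of_mem _ hx'', hax⟩
      · rw [hedges, List.map_append, List.map_cons, List.nodup_append', List.nodup_cons]
        have h1 : ∀ c ∈ (edgesOf L).map φ,
            (∃ x'' ∈ x' :: l, c ∈ (edgesOf x''.1).map φ ∧ c ∉ C₀) ∨
              (c ∈ l.map Prod.snd ∧ c ∈ C₀) := by
          intro c hc
          rw [List.mem_map] at hc
          obtain ⟨e, he, rfl⟩ := hc
          rcases hLe e he with ⟨x'', hx'', he⟩ | ⟨h1, h2, -⟩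
          · exact Or.inl ⟨x'', hx'', List.mem_map_of_mem he,
              (hl x'' (List.mem_cons_of_mem _ hx'')).2.2.2 e he⟩
          · exact Or.inr ⟨h1, h2⟩
        refine ⟨hx3.sublist (hqe.map φ), ⟨fun hc => ?_, hLcol⟩, ?_⟩
        · rcases h1 _ hc with ⟨-, -, -, h2⟩ | ⟨h2, -⟩
          · exact h2 (hφ ▸ hC)
          · have := hcol.2
            rw [List.map_cons, List.nodup_cons] at this
            exact this.1 (hφ ▸ h2)
        · intro c hc hc'
          have hcx := (hqe.map φ).subset hc
          have hc0 : c ∉ C₀ := by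
            rw [List.mem_map] at hcx
            obtain ⟨e, he, rfl⟩ := hcx
            exact hx4 e he
          rw [List.mem_cons] at hc'
          rcases hc' with rfl | hc'
          · exact hc0 (hφ ▸ hC)
          · rcases h1 _ hc' with ⟨x'', hx'', h2, -⟩ | ⟨-, h2⟩
            · exact (hdisj.1 x'' hx'').2 hcx h2
            · exact hc0 h2
      · intro e he
        rw [hedges, List.mem_append, List.mem_cons] at he
        rcases he with he | rfl | he
        · exact Or.inl ⟨x, by simp, hqe.subset he⟩
        · exact Or.inr ⟨by rw [hφ]; simp, hφ ▸ hC, hU⟩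
        · rcases hLe e he with ⟨x'', hx'', he⟩ | ⟨h1, h2⟩
          · exact Or.inl ⟨x'', List.mem_cons_of_mem _ hx'', he⟩
          · exact Or.inr ⟨by
              rw [List.tail_cons, List.map_cons]; exact List.mem_cons_of_mem _ h1, h2⟩
      · rw [List.length_append, List.length_cons, Nat.succ_mul, Nat.succ_mul]
        omega

lemma exists_rainbow_cycle_of_chain {len : ℕ} (hs : 2 * s ≤ len) (l : List (List V × ℕ))
    (hl : ∀ x ∈ l, x.1.length = len ∧ x.1.Nodup ∧ ((edgesOf x.1).map φ).Nodup ∧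
      ∀ e ∈ edgesOf x.1, φ e ∉ C₀)
    (hdisj : l.Pairwise fun x y => x.1.Disjoint y.1 ∧
      ((edgesOf x.1).map φ).Disjoint ((edgesOf y.1).map φ))
    (hcol : (l.map Prod.snd).Nodup)
    (hchain : l.IsChain fun x y => Linked φ C₀ U s x.1 y.1 y.2)
    {y z : List V × ℕ} (hy : l.head? = some y) (hz : l.getLast? = some z)
    (hclose : Linked φ C₀ U s z.1 y.1 y.2) (hlen : l.length * (2 * s) + 2 ≤ l.length * len) :
    ∃ (u : V) (w : (⊤ : SimpleGraph V).Walk u u), w.IsCycle ∧ (w.edges.map φ).Nodup ∧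
      l.length * len ≤ w.length + l.length * (2 * s) ∧
      ∀ e ∈ w.edges, (∃ x ∈ l, e ∈ edgesOf x.1) ∨
        (φ e ∈ l.map Prod.snd ∧ φ e ∈ C₀ ∧ e ∉ U) := by
  obtain ⟨u, hu, v, hv, hφ, hC, hU⟩ := hclose
  obtain ⟨L, hLv, hLu, hLnd, -, hLcol, hLe, hLlen⟩ :=
    exists_list_of_chain φ C₀ U s hs l hl hdisj hcol hchain hy hz hv hu
  obtain ⟨p, hp, hpe⟩ := exists_walk_of_nodup hLnd hLv hLu
  obtain ⟨l', rfl⟩ : ∃ l', l = y :: l' := by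
    rcases l with _ | ⟨a, l'⟩
    · simp at hy
    · simp only [List.head?_cons, Option.some.injEq] at hy
      exact ⟨l', by rw [hy]⟩
  have huv : u ≠ v := by
    rintro rfl
    rcases L with _ | ⟨a, _ | ⟨b, L⟩⟩
    · simp at hLv
    · simp only [List.length_cons, List.length_nil] at hLlen hlen
      omega
    · simp only [List.head?_cons, Option.some.injEq] at hLv
      subst hLv
      rw [List.getLast?_cons_cons] at hLu
      rw [List.nodup_cons] at hLnd
      exact hLnd.1 (List.mem_of_getLast? hLu)
  have hcolnd : ((s(u, v) :: edgesOf L).map φ).Nodup := by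
    rw [List.map_cons, List.nodup_cons]
    refine ⟨fun hc => ?_, hLcol⟩
    rw [List.mem_map] at hc
    obtain ⟨e, he, hee⟩ := hc
    rcases hLe e he with ⟨x, hx, he⟩ | ⟨h1, -⟩
    · exact (hl x hx).2.2.2 e he (by rw [hee, hφ]; exact hC)
    · rw [hee, hφ, List.tail_cons] at h1
      rw [List.map_cons, List.nodup_cons] at hcol
      exact hcol.1 h1
  refine ⟨u, SimpleGraph.Walk.cons ((SimpleGraph.top_adj u v).2 huv) p, ?_, ?_, ?_, ?_⟩
  · rw [SimpleGraph.Walk.cons_isCycle_iff]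
    refine ⟨by rw [SimpleGraph.Walk.isPath_def, hp]; exact hLnd, ?_⟩
    rw [hpe]
    have := List.Nodup.of_map φ hcolnd
    rw [List.nodup_cons] at this
    exact this.1
  · rw [SimpleGraph.Walk.edges_cons, hpe]
    exact hcolnd
  · have := p.length_support
    rw [hp] at this
    rw [SimpleGraph.Walk.length_cons, ← this]
    exact hLlen
  · intro e he
    rw [SimpleGraph.Walk.edges_cons, hpe, List.mem_cons] at he
    rcases he with rfl | he
    · exact Or.inr ⟨by rw [hφ]; simp, hφ ▸ hC, hU⟩
    · rcases hLe e he with h | ⟨h1, h2⟩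
      · exact Or.inl h
      · exact Or.inr ⟨by
          rw [List.tail_cons] at h1
          rw [List.map_cons]; exact List.mem_cons_of_mem _ h1, h2⟩

end assembling

section linking
variable {V : Type*} [Fintype V] [DecidableEq V] (φ : Sym2 V → ℕ) (C₀ : Set ℕ)

lemma exists_link {d E : ℝ} {g : ℕ}
    (hE : ∀ A B : Finset V, |∑ a ∈ A, ∑ b ∈ B, deviation φ C₀ d a b| ≤ E)
    (hg : ∀ c, #{z : V × V | z.1 ≠ z.2 ∧ φ s(z.1, z.2) = c} ≤ g)
    {X Y : Finset V} (hXY : Disjoint X Y) (U : Finset (Sym2 V)) (K : Finset ℕ)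
    (h : E + #U + #K * g < d * (#X * #Y)) :
    ∃ x ∈ X, ∃ y ∈ Y, φ s(x, y) ∈ C₀ ∧ φ s(x, y) ∉ K ∧ s(x, y) ∉ U := by
  classical
  by_contra hcon
  push Not at hcon
  have hne : ∀ x ∈ X, ∀ y ∈ Y, x ≠ y := fun x hx y hy => Finset.disjoint_left.1 hXY hx |>
    fun h e => h (e ▸ hy)
  have h1 : ∑ a ∈ X, ∑ b ∈ Y, deviation φ C₀ d a b =
      (#{z ∈ X ×ˢ Y | φ s(z.1, z.2) ∈ C₀} : ℝ) - d * (#X * #Y) := by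
    rw [← Finset.sum_product' (f := fun a b => deviation φ C₀ d a b)]
    have : ∀ z ∈ X ×ˢ Y, deviation φ C₀ d z.1 z.2 =
        (if φ s(z.1, z.2) ∈ C₀ then 1 else 0) - d := by
      intro z hz
      rw [Finset.mem_product] at hz
      rw [deviation, if_neg (hne _ hz.1 _ hz.2)]
    rw [Finset.sum_congr rfl this, Finset.sum_sub_distrib, Finset.sum_const, Finset.sum_boole,
      Finset.card_product, nsmul_eq_mul]
    push_cast
    ring
  have h2 : #{z ∈ X ×ˢ Y | φ s(z.1, z.2) ∈ C₀} ≤ #U + #K * g := by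
    have hsub : ({z ∈ X ×ˢ Y | φ s(z.1, z.2) ∈ C₀} : Finset (V × V)) ⊆
        {z ∈ X ×ˢ Y | s(z.1, z.2) ∈ U} ∪
          K.biUnion fun c => {z : V × V | z.1 ≠ z.2 ∧ φ s(z.1, z.2) = c} := by
      intro z hz
      rw [Finset.mem_filter, Finset.mem_product] at hz
      rw [Finset.mem_union, Finset.mem_filter, Finset.mem_product, Finset.mem_biUnion]
      by_cases hK : φ s(z.1, z.2) ∈ K
      · right
        exact ⟨_, hK, by simpa using hne _ hz.1.1 _ hz.1.2⟩
      · left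
        exact ⟨hz.1, hcon _ hz.1.1 _ hz.1.2 hz.2 hK⟩
    refine (Finset.card_le_card hsub).trans ((Finset.card_union_le _ _).trans ?_)
    refine Nat.add_le_add ?_ ?_
    · refine Finset.card_le_card_of_injOn (fun z => s(z.1, z.2)) ?_ ?_
      · intro z hz
        exact (Finset.mem_filter.1 hz).2
      · rintro ⟨a, b⟩ hz ⟨a', b'⟩ hz' he
        simp only [Finset.coe_filter, Finset.mem_product, Set.mem_ofPred_eq] at hz hz'
        rcases Sym2.eq_iff.1 he with ⟨rfl, rfl⟩ | ⟨rfl, rfl⟩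
        · rfl
        · exact absurd rfl (hne _ hz.1.1 _ hz'.1.2)
    · exact Finset.card_biUnion_le_card_mul _ _ _ fun c _ => hg c
  have h3 := (abs_le.1 (hE X Y)).1
  rw [h1] at h3
  have h4 : (#{z ∈ X ×ˢ Y | φ s(z.1, z.2) ∈ C₀} : ℝ) ≤ #U + #K * g := by exact_mod_cast h2
  linarith

/-- A family of injective rainbow paths that are pairwise vertex-disjoint and pairwise
colour-disjoint, and use no colour of `C₀`. -/
structure RainbowLinearForest {k : ℕ} (Q : Finset (Fin (k + 1) → V)) : Prop where
  injective : ∀ p ∈ Q, Function.Injective p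
  rainbow : ∀ p ∈ Q, Function.Injective fun j => φ (edgeAt p j)
  not_mem : ∀ p ∈ Q, ∀ j, φ (edgeAt p j) ∉ C₀
  vertex_disjoint : ∀ p ∈ Q, ∀ q ∈ Q, p ≠ q → ∀ i j, p i ≠ q j
  colour_disjoint : ∀ p ∈ Q, ∀ q ∈ Q, p ≠ q → ∀ i j, φ (edgeAt p i) ≠ φ (edgeAt q j)

lemma exists_linked_of_card {k : ℕ} {Q : Finset (Fin (k + 1) → V)}
    (hQ : RainbowLinearForest φ C₀ Q) {d E : ℝ} (hd : 0 ≤ d) {g s w : ℕ}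
    (hE : ∀ A B : Finset V, |∑ a ∈ A, ∑ b ∈ B, deviation φ C₀ d a b| ≤ E)
    (hg : ∀ c, #{z : V × V | z.1 ≠ z.2 ∧ φ s(z.1, z.2) = c} ≤ g) (hs : s ≤ k + 1)
    (U : Finset (Sym2 V)) (h : E + #U + #Q * g < d * (s * w) ^ 2)
    {A B : Finset (Fin (k + 1) → V)} (hA : A ⊆ Q) (hB : B ⊆ Q) (hAB : Disjoint A B)
    (hwA : w ≤ #A) (hwB : w ≤ #B) {K : Finset ℕ} (hK : #K ≤ #Q) :
    ∃ a ∈ A, ∃ b ∈ B, ∃ c ∉ K, Linked φ C₀ U s (List.ofFn a) (List.ofFn b) c := by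
  let X : Finset V := A.biUnion fun p => ((List.ofFn p).drop (k + 1 - s)).toFinset
  let Y : Finset V := B.biUnion fun p => ((List.ofFn p).take s).toFinset
  have hdis : ∀ p ∈ Q, ∀ q ∈ Q, p ≠ q → ∀ l l' : List V, l.Sublist (List.ofFn p) →
      l'.Sublist (List.ofFn q) → Disjoint l.toFinset l'.toFinset := by
    intro p hp q hq hpq l l' hl hl'
    rw [Finset.disjoint_left]
    intro v hv hv'
    rw [List.mem_toFinset] at hv hv'
    obtain ⟨i, hi⟩ := (List.mem_ofFn' _ _).1 (hl.subset hv)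
    obtain ⟨j, hj⟩ := (List.mem_ofFn' _ _).1 (hl'.subset hv')
    exact hQ.vertex_disjoint p hp q hq hpq i j (hi.trans hj.symm)
  have hnd : ∀ p ∈ Q, ∀ l : List V, l.Sublist (List.ofFn p) → #l.toFinset = l.length := by
    intro p hp l hl
    exact List.toFinset_card_of_nodup ((List.nodup_ofFn.2 (hQ.injective p hp)).sublist hl)
  have hX : #X = #A * s := by
    rw [Finset.card_biUnion, Finset.sum_congr rfl (g := fun _ => s), Finset.sum_const,
      smul_eq_mul]
    · intro p hp
      rw [hnd p (hA hp) _ (List.drop_sublist _ _), List.length_drop, List.length_ofFn]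
      omega
    · intro p hp q hq hpq
      exact hdis p (hA hp) q (hA hq) hpq _ _ (List.drop_sublist _ _) (List.drop_sublist _ _)
  have hY : #Y = #B * s := by
    rw [Finset.card_biUnion, Finset.sum_congr rfl (g := fun _ => s), Finset.sum_const,
      smul_eq_mul]
    · intro p hp
      rw [hnd p (hB hp) _ (List.take_sublist _ _), List.length_take, List.length_ofFn]
      omega
    · intro p hp q hq hpq
      exact hdis p (hB hp) q (hB hq) hpq _ _ (List.take_sublist _ _) (List.take_sublist _ _)
  have hXY : Disjoint X Y := by
    rw [Finset.disjoint_biUnion_left]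
    intro p hp
    rw [Finset.disjoint_biUnion_right]
    intro q hq
    refine hdis p (hA hp) q (hB hq) ?_ _ _ (List.drop_sublist _ _) (List.take_sublist _ _)
    rintro rfl
    exact Finset.disjoint_left.1 hAB hp hq
  obtain ⟨x, hx, y, hy, h1, h2, h3⟩ := exists_link φ C₀ hE hg hXY U K (by
    have h1 : ((w : ℝ) * s) ≤ #X := by rw [hX]; exact_mod_cast Nat.mul_le_mul_right s hwA
    have h2 : ((w : ℝ) * s) ≤ #Y := by rw [hY]; exact_mod_cast Nat.mul_le_mul_right s hwB
    have h3 : (#K : ℝ) ≤ #Q := by exact_mod_cast hK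
    calc E + #U + #K * g ≤ E + #U + #Q * g := by gcongr
      _ < d * (s * w) ^ 2 := h
      _ = d * ((w * s) * (w * s)) := by ring
      _ ≤ d * (#X * #Y) := by gcongr)
  obtain ⟨p, hp, hxp⟩ := Finset.mem_biUnion.1 hx
  obtain ⟨q, hq, hyq⟩ := Finset.mem_biUnion.1 hy
  rw [List.mem_toFinset] at hxp hyq
  exact ⟨p, hp, q, hq, _, h2, x, by simpa using hxp, y, hyq, rfl, h1, h3⟩

lemma exists_rainbow_cycle {k : ℕ} {Q : Finset (Fin (k + 1) → V)}
    (hQ : RainbowLinearForest φ C₀ Q) {d E : ℝ} (hd : 0 ≤ d) {g s w : ℕ}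
    (hE : ∀ A B : Finset V, |∑ a ∈ A, ∑ b ∈ B, deviation φ C₀ d a b| ≤ E)
    (hg : ∀ c, #{z : V × V | z.1 ≠ z.2 ∧ φ s(z.1, z.2) = c} ≤ g) (hs : 2 * s + 2 ≤ k + 1)
    (hw : 4 * w < #Q) (U : Finset (Sym2 V)) (h : E + #U + #Q * g < d * (s * w) ^ 2) :
    ∃ (u : V) (c : (⊤ : SimpleGraph V).Walk u u), c.IsCycle ∧ (c.edges.map φ).Nodup ∧
      (#Q - 4 * w) * (k + 1 - 2 * s) ≤ c.length ∧
      (∃ U' : Finset (Sym2 V), #U' ≤ #Q ∧ Disjoint U U' ∧ (∀ e ∈ U', φ e ∈ C₀) ∧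
        ∀ e ∈ c.edges, (∃ p ∈ Q, ∃ j, e = edgeAt p j) ∨ e ∈ U') := by
  classical
  obtain ⟨l, hl1, hlQ, hl2, hlen, hchain, x, y, hx, hy, hxy⟩ := exists_linked_cycle Q
    (fun p q c => Linked φ C₀ U s (List.ofFn p) (List.ofFn q) c) w hw
    (fun A hA B hB hAB hwA hwB K hK =>
      exists_linked_of_card φ C₀ hQ hd hE hg (by omega) U h hA hB hAB hwA hwB hK)
  let f : (Fin (k + 1) → V) × ℕ → List V × ℕ := fun z => (List.ofFn z.1, z.2)
  have hpos : 0 < l.length := by omega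
  have hsnd : (l.map f).map Prod.snd = l.map Prod.snd := by
    rw [List.map_map]; rfl
  obtain ⟨u, c, hc, hcr, hclen, hce⟩ := exists_rainbow_cycle_of_chain φ C₀ U s (len := k + 1)
    (by omega) (l.map f) (by
      intro _ hz'
      obtain ⟨z, hz, rfl⟩ := List.mem_map.1 hz'
      have hzQ := hlQ z hz
      refine ⟨by simp [f], List.nodup_ofFn.2 (hQ.injective _ hzQ), ?_, ?_⟩
      · simp only [f, edgesOf_ofFn, List.map_ofFn]
        exact List.nodup_ofFn.2 (hQ.rainbow _ hzQ)
      · intro e he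
        simp only [f, edgesOf_ofFn] at he
        obtain ⟨j, rfl⟩ := (List.mem_ofFn' _ _).1 he
        exact hQ.not_mem _ hzQ j) (by
      rw [List.pairwise_map]
      have hp : l.Pairwise fun a b => a.1 ≠ b.1 := List.pairwise_map.1 hl1
      refine hp.imp_of_mem fun {a b} ha hb hab => ⟨?_, ?_⟩
      · intro v hv hv'
        obtain ⟨i, hi⟩ := (List.mem_ofFn' _ _).1 hv
        obtain ⟨j, hj⟩ := (List.mem_ofFn' _ _).1 hv'
        exact hQ.vertex_disjoint _ (hlQ _ ha) _ (hlQ _ hb) hab i j (hi.trans hj.symm)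
      · simp only [f, edgesOf_ofFn, List.map_ofFn]
        intro v hv hv'
        obtain ⟨i, hi⟩ := (List.mem_ofFn' _ _).1 hv
        obtain ⟨j, hj⟩ := (List.mem_ofFn' _ _).1 hv'
        exact hQ.colour_disjoint _ (hlQ _ ha) _ (hlQ _ hb) hab i j (hi.trans hj.symm))
    (by rw [hsnd]; exact hl2)
    (by rw [List.isChain_map]; exact hchain)
    (y := f y) (z := f x) (by rw [List.head?_map, hy]; rfl) (by rw [List.getLast?_map, hx]; rfl)
    hxy (by rw [List.length_map]; nlinarith)
  rw [List.length_map] at hclen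
  have hlQ' : l.length ≤ #Q := by
    rw [← List.length_map (f := Prod.fst), ← List.toFinset_card_of_nodup hl1]
    refine Finset.card_le_card fun p hp => ?_
    rw [List.mem_toFinset, List.mem_map] at hp
    obtain ⟨z, hz, rfl⟩ := hp
    exact hlQ z hz
  have hpath : ∀ e, (∃ x ∈ l.map f, e ∈ edgesOf x.1) → ∃ p ∈ Q, ∃ j, e = edgeAt p j := by
    rintro e ⟨_, hz', he⟩
    obtain ⟨z, hz, rfl⟩ := List.mem_map.1 hz'
    simp only [f, edgesOf_ofFn] at he
    obtain ⟨j, rfl⟩ := (List.mem_ofFn' _ _).1 he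
    exact ⟨_, hlQ z hz, j, rfl⟩
  rw [hsnd] at hce
  refine ⟨u, c, hc, hcr, ?_, {e ∈ c.edges.toFinset | φ e ∈ C₀}, ?_, ?_, ?_, ?_⟩
  · calc (#Q - 4 * w) * (k + 1 - 2 * s) ≤ l.length * (k + 1 - 2 * s) := by
          gcongr; omega
      _ ≤ c.length := by
        rw [Nat.mul_sub]; omega
  · calc #{e ∈ c.edges.toFinset | φ e ∈ C₀} ≤ #(l.map Prod.snd).toFinset := by
          refine Finset.card_le_card_of_injOn φ ?_ ?_
          · intro e he
            simp only [Finset.coe_filter, List.mem_toFinset, Set.mem_ofPred_eq] at he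
            rcases hce e he.1 with h1 | h1
            · obtain ⟨p, hp, j, rfl⟩ := hpath e h1
              exact absurd he.2 (hQ.not_mem p hp j)
            · simpa using h1.1
          · intro e he e' he' hee
            simp only [Finset.coe_filter, List.mem_toFinset, Set.mem_ofPred_eq] at he he'
            exact List.inj_on_of_nodup_map hcr he.1 he'.1 hee
      _ ≤ (l.map Prod.snd).length := List.toFinset_card_le _
      _ ≤ #Q := by rw [List.length_map]; exact hlQ'
  · rw [Finset.disjoint_left]
    intro e heU he
    rw [Finset.mem_filter, List.mem_toFinset] at he
    rcases hce e he.1 with h1 | h1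
    · obtain ⟨p, hp, j, rfl⟩ := hpath e h1
      exact absurd he.2 (hQ.not_mem p hp j)
    · exact h1.2.2 heU
  · intro e he
    exact (Finset.mem_filter.1 he).2
  · intro e he
    rcases hce e he with h1 | h1
    · exact Or.inl (hpath e h1)
    · exact Or.inr (Finset.mem_filter.2 ⟨List.mem_toFinset.2 he, h1.2.1⟩)

lemma exists_disjoint_rainbow_cycles {ι : Type*} {k : ℕ} [Nonempty V]
    (Q : ι → Finset (Fin (k + 1) → V)) (I : Finset ι) {r : ℕ} (hr : ∀ i ∈ I, #(Q i) ≤ r)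
    (hQ : ∀ i ∈ I, RainbowLinearForest φ C₀ (Q i))
    (hne : ∀ i ∈ I, ∀ j ∈ I, i ≠ j → ∀ p ∈ Q i, ∀ q ∈ Q j, ∀ a b, edgeAt p a ≠ edgeAt q b)
    {d E : ℝ} (hd : 0 ≤ d) {g s w : ℕ}
    (hE : ∀ A B : Finset V, |∑ a ∈ A, ∑ b ∈ B, deviation φ C₀ d a b| ≤ E)
    (hg : ∀ c, #{z : V × V | z.1 ≠ z.2 ∧ φ s(z.1, z.2) = c} ≤ g) (hs : 2 * s + 2 ≤ k + 1)
    (hw : ∀ i ∈ I, 4 * w < #(Q i)) (h : E + #I * r + r * g < d * (s * w) ^ 2) :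
    ∃ (v : ι → V) (c : ∀ i, (⊤ : SimpleGraph V).Walk (v i) (v i)),
      (∀ i ∈ I, (c i).IsCycle ∧ ((c i).edges.map φ).Nodup ∧
        (#(Q i) - 4 * w) * (k + 1 - 2 * s) ≤ (c i).length) ∧
      ∀ i ∈ I, ∀ j ∈ I, i ≠ j → ∀ e ∈ (c i).edges, e ∉ (c j).edges := by
  classical
  suffices H : ∀ T ⊆ I, ∃ (c : ι → Σ v : V, (⊤ : SimpleGraph V).Walk v v) (U : Finset (Sym2 V)),
      #U ≤ #T * r ∧ (∀ e ∈ U, φ e ∈ C₀) ∧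
      (∀ i ∈ T, (c i).2.IsCycle ∧ ((c i).2.edges.map φ).Nodup ∧
        (#(Q i) - 4 * w) * (k + 1 - 2 * s) ≤ (c i).2.length ∧
        ∀ e ∈ (c i).2.edges, (∃ p ∈ Q i, ∃ j, e = edgeAt p j) ∨ e ∈ U) ∧
      ∀ i ∈ T, ∀ j ∈ T, i ≠ j → ∀ e ∈ (c i).2.edges, e ∉ (c j).2.edges by
    obtain ⟨c, U, -, -, h1, h2⟩ := H I subset_rfl
    exact ⟨fun i => (c i).1, fun i => (c i).2,
      fun i hi => ⟨(h1 i hi).1, (h1 i hi).2.1, (h1 i hi).2.2.1⟩, h2⟩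
  intro T
  induction T using Finset.induction_on with
  | empty =>
    intro _
    exact ⟨fun _ => ⟨Classical.arbitrary V, SimpleGraph.Walk.nil⟩, ∅, by simp⟩
  | insert i T hiT ih =>
    intro hT
    have hi : i ∈ I := hT (Finset.mem_insert_self _ _)
    have hT' : T ⊆ I := (Finset.subset_insert _ _).trans hT
    obtain ⟨c, U, hU, hUC, hc, hdis⟩ := ih hT'
    obtain ⟨u, c', h1, h2, h3, U', hU', hUU', hU'C, hc'⟩ := exists_rainbow_cycle φ C₀ (hQ i hi) hd
      hE hg hs (hw i hi) U (by
        have h1 : (#U : ℝ) ≤ #I * r := by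
          exact_mod_cast hU.trans (Nat.mul_le_mul_right r (Finset.card_le_card hT'))
        have h2 : (#(Q i) : ℝ) ≤ r := by exact_mod_cast hr i hi
        have h3 : (#(Q i) : ℝ) * g ≤ r * g := by gcongr
        linarith)
    have hup : ∀ j ∈ T, Function.update c i ⟨u, c'⟩ j = c j := fun j hj =>
      Function.update_of_ne (by rintro rfl; exact hiT hj) _ _
    have hsep : ∀ j ∈ T, ∀ e ∈ c'.edges, e ∉ (c j).2.edges := by
      intro j hj e he he'
      have hij : i ≠ j := by rintro rfl; exact hiT hj
      rcases hc' e he with ⟨p, hp, a, rfl⟩ | heU'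
      · rcases (hc j hj).2.2.2 _ he' with ⟨q, hq, b, hpq⟩ | heU
        · exact hne i hi j (hT' hj) hij p hp q hq a b hpq
        · exact (hQ i hi).not_mem p hp a (hUC _ heU)
      · rcases (hc j hj).2.2.2 _ he' with ⟨q, hq, b, rfl⟩ | heU
        · exact (hQ j (hT' hj)).not_mem q hq b (hU'C _ heU')
        · exact Finset.disjoint_left.1 hUU' heU heU'
    refine ⟨Function.update c i ⟨u, c'⟩, U ∪ U', ?_, ?_, ?_, ?_⟩
    · rw [Finset.card_insert_of_notMem hiT, Nat.succ_mul]
      exact (Finset.card_union_le _ _).trans (Nat.add_le_add hU (hU'.trans (hr i hi)))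
    · intro e he
      rcases Finset.mem_union.1 he with he | he
      · exact hUC e he
      · exact hU'C e he
    · intro j hj
      rcases Finset.mem_insert.1 hj with rfl | hj
      · rw [Function.update_self]
        exact ⟨h1, h2, h3, fun e he => (hc' e he).imp_right fun h => Finset.mem_union_right _ h⟩
      · rw [hup j hj]
        obtain ⟨a1, a2, a3, a4⟩ := hc j hj
        exact ⟨a1, a2, a3, fun e he => (a4 e he).imp_right fun h => Finset.mem_union_left _ h⟩
    · intro j hjT j' hjT' hjj'
      rcases Finset.mem_insert.1 hjT with rfl | hj
      · rcases Finset.mem_insert.1 hjT' with rfl | hj'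
        · exact absurd rfl hjj'
        · rw [Function.update_self, hup j' hj']
          exact hsep j' hj'
      · rcases Finset.mem_insert.1 hjT' with rfl | hj'
        · rw [Function.update_self, hup j hj]
          exact fun e he he' => hsep j hj e he' he
        · rw [hup j hj, hup j' hj']
          exact hdis j hj j' hj' hjj'

end linking

section packaging
variable {V : Type*} [Fintype V] [DecidableEq V]

/-- The paths of `M` carrying the label `i`. -/
def pathsAt {t k : ℕ} (M : Finset (Fin t × (Fin (k + 1) → V))) (i : Fin t) :
    Finset (Fin (k + 1) → V) :=
  {x ∈ M | x.1 = i}.image Prod.snd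

lemma mem_pathsAt {t k : ℕ} {M : Finset (Fin t × (Fin (k + 1) → V))} {i : Fin t}
    {p : Fin (k + 1) → V} : p ∈ pathsAt M i ↔ (i, p) ∈ M := by
  simp [pathsAt]

lemma sum_card_pathsAt {t k : ℕ} (M : Finset (Fin t × (Fin (k + 1) → V))) :
    ∑ i, #(pathsAt M i) = #M := by
  rw [Finset.card_eq_sum_card_fiberwise (f := Prod.fst) (t := Finset.univ) (by simp)]
  refine Finset.sum_congr rfl fun i _ => Finset.card_image_of_injOn ?_
  rintro ⟨a, p⟩ hx ⟨b, q⟩ hy (h : p = q)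
  simp only [Finset.coe_filter, Set.mem_ofPred_eq] at hx hy
  rw [h, hx.2, hy.2]

lemma card_mul_le_card_of_disjoint {k : ℕ} {Q : Finset (Fin (k + 1) → V)}
    (hinj : ∀ p ∈ Q, Function.Injective p)
    (hdis : ∀ p ∈ Q, ∀ q ∈ Q, p ≠ q → ∀ i j, p i ≠ q j) :
    #Q * (k + 1) ≤ Fintype.card V := by
  have : #(Q ×ˢ (Finset.univ : Finset (Fin (k + 1)))) ≤ #(Finset.univ : Finset V) := by
    refine Finset.card_le_card_of_injOn (fun z => z.1 z.2) (by simp) ?_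
    rintro ⟨p, i⟩ hp ⟨q, j⟩ hq (h : p i = q j)
    simp only [Finset.coe_product, Set.mem_prod, Finset.mem_coe] at hp hq
    by_cases hpq : p = q
    · subst hpq
      rw [hinj p hp.1 h]
    · exact absurd h (hdis p hp.1 q hq.1 hpq i j)
  simpa using this

lemma card_filter_ge_of_sum_ge {t : ℕ} (f : Fin t → ℝ) {r β : ℝ} (hβ : 0 < β) (hr : 0 < r)
    (hf : ∀ i, f i ≤ r) (hsum : (1 - β ^ 2) * (t * r) ≤ ∑ i, f i) :
    (1 - β) * t ≤ #{i | (1 - β) * r ≤ f i} := by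
  have h1 : ∑ i, f i ≤ ∑ i : Fin t, ((1 - β) * r + if (1 - β) * r ≤ f i then β * r else 0) := by
    refine Finset.sum_le_sum fun i _ => ?_
    split_ifs with h
    · linarith [hf i]
    · linarith
  rw [Finset.sum_add_distrib, ← Finset.sum_filter, Finset.sum_const, Finset.sum_const,
    Finset.card_univ, Fintype.card_fin, nsmul_eq_mul, nsmul_eq_mul] at h1
  have h2 : (β * r) * ((1 - β) * t) ≤ (β * r) * #{i | (1 - β) * r ≤ f i} := by nlinarith
  exact le_of_mul_le_mul_left h2 (by positivity)

lemma exists_cycles_of_paths (φ : Sym2 V → ℕ) (C₀ : Set ℕ) {t k : ℕ}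
    (M : Finset (Fin t × (Fin (k + 1) → V)))
    (hM : ∀ x ∈ M, Function.Injective x.2 ∧ (Function.Injective fun j => φ (edgeAt x.2 j)) ∧
      ∀ j, φ (edgeAt x.2 j) ∉ C₀)
    (hdis : ∀ x ∈ M, ∀ y ∈ M, x ≠ y → (∀ i j, edgeAt x.2 i ≠ edgeAt y.2 j) ∧
      (x.1 = y.1 → (∀ i j, x.2 i ≠ y.2 j) ∧ ∀ i j, φ (edgeAt x.2 i) ≠ φ (edgeAt y.2 j)))
    {β : ℝ} (hβ : 0 < β) (hn : 0 < Fintype.card V)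
    (hcard : (1 - β ^ 2) * (t * Fintype.card V) ≤ #M * (k + 1))
    {d E : ℝ} (hd : 0 ≤ d) {g s w : ℕ}
    (hE : ∀ A B : Finset V, |∑ a ∈ A, ∑ b ∈ B, deviation φ C₀ d a b| ≤ E)
    (hg : ∀ c, #{z : V × V | z.1 ≠ z.2 ∧ φ s(z.1, z.2) = c} ≤ g) (hs : 2 * s + 2 ≤ k + 1)
    (hw : 4 * w * (k + 1) < (1 - β) * Fintype.card V)
    (h : E + (t + g) * (Fintype.card V / (k + 1)) < d * (s * w) ^ 2) :
    ∃ (N : ℕ) (v : Fin N → V) (c : ∀ i, (⊤ : SimpleGraph V).Walk (v i) (v i)),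
      (1 - β) * t ≤ N ∧ (∀ i, (c i).IsCycle) ∧ (∀ i, ((c i).edges.map φ).Nodup) ∧
      (∀ i, ((1 - β) * (Fintype.card V / (k + 1)) - 4 * w) * (k + 1 - 2 * s) ≤ (c i).length) ∧
      ∀ i j, i ≠ j → ∀ e ∈ (c i).edges, e ∉ (c j).edges := by
  classical
  have : Nonempty V := Fintype.card_pos_iff.1 hn
  set r : ℝ := Fintype.card V / (k + 1) with hr
  have hn' : (0 : ℝ) < Fintype.card V := by exact_mod_cast hn
  have hk : (0 : ℝ) < k + 1 := by positivity
  have hr0 : 0 < r := by positivity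
  have hQ : ∀ i, RainbowLinearForest φ C₀ (pathsAt M i) := fun i =>
    { injective := fun p hp => (hM _ (mem_pathsAt.1 hp)).1
      rainbow := fun p hp => (hM _ (mem_pathsAt.1 hp)).2.1
      not_mem := fun p hp => (hM _ (mem_pathsAt.1 hp)).2.2
      vertex_disjoint := fun p hp q hq hpq =>
        ((hdis _ (mem_pathsAt.1 hp) _ (mem_pathsAt.1 hq) (by simpa using hpq)).2 rfl).1
      colour_disjoint := fun p hp q hq hpq =>
        ((hdis _ (mem_pathsAt.1 hp) _ (mem_pathsAt.1 hq) (by simpa using hpq)).2 rfl).2 }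
  have hQn : ∀ i, #(pathsAt M i) * (k + 1) ≤ Fintype.card V := fun i =>
    card_mul_le_card_of_disjoint (hQ i).injective (hQ i).vertex_disjoint
  have hQr : ∀ i, (#(pathsAt M i) : ℝ) ≤ r := fun i => by
    rw [hr, le_div_iff₀ hk]
    exact_mod_cast hQn i
  let I : Finset (Fin t) := {i | (1 - β) * r ≤ #(pathsAt M i)}
  have hI : (1 - β) * t ≤ #I := by
    refine card_filter_ge_of_sum_ge (fun i => (#(pathsAt M i) : ℝ)) hβ hr0 hQr ?_
    rw [← Nat.cast_sum, sum_card_pathsAt, hr, ← mul_div_assoc, ← mul_div_assoc, div_le_iff₀ hk]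
    exact hcard
  have hIr : ∀ i ∈ I, (1 - β) * r ≤ #(pathsAt M i) := fun i hi => (Finset.mem_filter.1 hi).2
  obtain ⟨v, c, hc, hcd⟩ := exists_disjoint_rainbow_cycles φ C₀ (pathsAt M) I
    (r := Fintype.card V / (k + 1)) (fun i _ => (Nat.le_div_iff_mul_le (by omega)).2 (hQn i))
    (fun i _ => hQ i)
    (fun i _ j _ hij p hp q hq => (hdis _ (mem_pathsAt.1 hp) _ (mem_pathsAt.1 hq)
      (by simp [hij])).1) hd hE hg hs
    (fun i hi => by
      have h1 : (4 * w : ℝ) < (1 - β) * r := by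
        rw [hr, ← mul_div_assoc, lt_div_iff₀ hk]
        exact hw
      exact_mod_cast h1.trans_le (hIr i hi))
    (by
      have h1 : ((Fintype.card V / (k + 1) : ℕ) : ℝ) ≤ r := by
        rw [hr]
        exact_mod_cast Nat.cast_div_le (α := ℝ) (m := Fintype.card V) (n := k + 1)
      have h2 : (#I : ℝ) ≤ t := by
        exact_mod_cast (Finset.card_le_univ I).trans (by simp)
      refine lt_of_le_of_lt ?_ h
      have h3 : (#I : ℝ) * (Fintype.card V / (k + 1) : ℕ) ≤ t * r := by gcongr
      have h4 : ((Fintype.card V / (k + 1) : ℕ) : ℝ) * g ≤ r * g := by gcongr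
      linarith)
  let e := I.equivFin.symm
  refine ⟨#I, fun i => v (e i), fun i => c (e i), hI, fun i => (hc _ (e i).2).1,
    fun i => (hc _ (e i).2).2.1, fun i => ?_, fun i j hij => hcd _ (e i).2 _ (e j).2 ?_⟩
  · have h1 := (hc _ (e i).2).2.2
    have h2 := hIr _ (e i).2
    have h3 : (#(pathsAt M (e i)) : ℝ) - 4 * w ≤ (#(pathsAt M (e i)) - 4 * w : ℕ) := by
      rw [sub_le_iff_le_add]
      exact_mod_cast (by omega)
    have h4 : ((k : ℝ) + 1 - 2 * s) = (k + 1 - 2 * s : ℕ) := by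
      rw [Nat.cast_sub (by omega)]
      push_cast
      ring
    calc ((1 - β) * r - 4 * w) * (k + 1 - 2 * s)
        ≤ (#(pathsAt M (e i)) - 4 * w : ℕ) * (k + 1 - 2 * s : ℕ) := by
          rw [h4]
          exact mul_le_mul_of_nonneg_right (by linarith) (Nat.cast_nonneg _)
      _ ≤ _ := by exact_mod_cast h1
  · intro h
    exact hij (e.injective (Subtype.ext h))

end packaging

section good_graph
variable {V : Type*} [Fintype V] [DecidableEq V] (φ : Sym2 V → ℕ)

lemma exists_reservoir_nat (L g q : ℕ) (hq : 0 < q)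
    (hL : ∀ v c, #{u | v ≠ u ∧ φ s(v, u) = c} ≤ L)
    (hg : ∀ c, #{z : V × V | z.1 ≠ z.2 ∧ φ s(z.1, z.2) = c} ≤ g) :
    ∃ C₀ : Set ℕ, ∀ A B : Finset V, (∑ a ∈ A, ∑ b ∈ B, deviation φ C₀ (1 / q) a b) ^ 4 ≤
      (Fintype.card V : ℝ) ^ 6 * (2 * (Fintype.card V * L) + g) := by
  classical
  have : Fintype (Set.range φ) := Fintype.ofFinite _
  obtain ⟨P, hP⟩ := exists_reservoir (Set.rangeFactorization φ) L g q hq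
    (fun v c => by
      refine le_trans (le_of_eq ?_) (hL v c)
      congr 1
      ext u
      simp [Subtype.ext_iff, Set.rangeFactorization])
    (fun c => by
      refine le_trans (le_of_eq ?_) (hg c)
      congr 1
      ext u
      simp [Subtype.ext_iff, Set.rangeFactorization])
  refine ⟨Subtype.val '' P, fun A B => le_trans (le_of_eq ?_) (hP A B)⟩
  congr 1
  refine Finset.sum_congr rfl fun a _ => Finset.sum_congr rfl fun b _ => ?_
  have : φ s(a, b) ∈ Subtype.val '' P ↔ Set.rangeFactorization φ s(a, b) ∈ P := by
    constructor
    · rintro ⟨x, hx, h⟩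
      rwa [show Set.rangeFactorization φ s(a, b) = x from Subtype.ext h.symm]
    · intro h
      exact ⟨_, h, rfl⟩
  simp only [deviation, this]

variable (C₀ : Set ℕ)

/-- The graph on `S` of the edges whose colour is not in `C₀`. -/
def avoidingGraph (S : Finset V) : SimpleGraph V where
  Adj u v := u ≠ v ∧ u ∈ S ∧ v ∈ S ∧ φ s(u, v) ∉ C₀
  symm := ⟨fun u v h => ⟨h.1.symm, h.2.2.1, h.2.1, by rw [Sym2.eq_swap]; exact h.2.2.2⟩⟩
  loopless := ⟨fun _ h => h.1 rfl⟩

instance [DecidablePred (· ∈ C₀)] (S : Finset V) : DecidableRel (avoidingGraph φ C₀ S).Adj :=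
  fun u v => inferInstanceAs (Decidable (u ≠ v ∧ u ∈ S ∧ v ∈ S ∧ φ s(u, v) ∉ C₀))

lemma sum_deviation_eq (d : ℝ) (v : V) [DecidablePred (· ∈ C₀)] :
    ∑ b, deviation φ C₀ d v b =
      (1 - d) * (Fintype.card V - 1) - #{u | u ≠ v ∧ φ s(u, v) ∉ C₀} := by
  have h1 : ∀ b, deviation φ C₀ d v b =
      ((1 - d) - if b = v then 1 - d else 0) - if b ≠ v ∧ φ s(b, v) ∉ C₀ then 1 else 0 := by
    intro b
    by_cases hb : b = v
    · subst hb
      simp [deviation]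
    · rw [deviation, if_neg (Ne.symm hb), Sym2.eq_swap]
      by_cases h : φ s(b, v) ∈ C₀ <;> simp [hb, h]
  rw [Finset.sum_congr rfl fun b _ => h1 b, Finset.sum_sub_distrib, Finset.sum_sub_distrib,
    Finset.sum_const, Finset.sum_ite_eq', Finset.sum_boole, Finset.card_univ, nsmul_eq_mul]
  simp
  ring

lemma exists_large_set_of_deviation_le {d E y : ℝ}
    (hE : ∀ A B : Finset V, |∑ a ∈ A, ∑ b ∈ B, deviation φ C₀ d a b| ≤ E) :
    ∃ S : Finset V, y * (Fintype.card V - #S) ≤ 2 * E ∧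
      ∀ v ∈ S, |∑ b, deviation φ C₀ d v b| ≤ y := by
  classical
  let f : V → ℝ := fun v => ∑ b, deviation φ C₀ d v b
  let P : Finset V := {v | y < f v}
  let N : Finset V := {v | f v < -y}
  refine ⟨(P ∪ N)ᶜ, ?_, ?_⟩
  · have h1 : #P * y ≤ E := by
      refine le_trans ?_ ((le_abs_self _).trans (hE P Finset.univ))
      rw [← nsmul_eq_mul]
      exact Finset.card_nsmul_le_sum _ _ _ fun v hv => (Finset.mem_filter.1 hv).2.le
    have h2 : #N * y ≤ E := by
      refine le_trans ?_ ((neg_le_abs _).trans (hE N Finset.univ))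
      rw [← nsmul_eq_mul, ← Finset.sum_neg_distrib]
      exact Finset.card_nsmul_le_sum _ _ _ fun v hv => by
        have := (Finset.mem_filter.1 hv).2
        simp only [f] at this
        linarith
    have hE0 : 0 ≤ E := (abs_nonneg _).trans (hE ∅ ∅)
    rw [Finset.card_compl, Nat.cast_sub (Finset.card_le_univ _), sub_sub_cancel]
    rcases le_total 0 y with hy | hy
    · have h3 : (#(P ∪ N) : ℝ) ≤ #P + #N := by exact_mod_cast Finset.card_union_le P N
      nlinarith
    · have : (0 : ℝ) ≤ #(P ∪ N) := by positivity
      nlinarith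
  · intro v hv
    simp only [P, N, Finset.mem_compl, Finset.mem_union, Finset.mem_filter, Finset.mem_univ,
      true_and, not_or, not_lt] at hv
    exact abs_le.2 ⟨hv.2, hv.1⟩

lemma exists_almost_regular_avoidingGraph [DecidablePred (· ∈ C₀)] {d E x : ℝ} (hd : 0 ≤ d)
    (hd1 : d ≤ 1) (hx : 0 < x)
    (hE : ∀ A B : Finset V, |∑ a ∈ A, ∑ b ∈ B, deviation φ C₀ d a b| ≤ E)
    (hEx : 2 * E ≤ x ^ 2 * (Fintype.card V : ℝ) ^ 2) (hn : 1 ≤ x * Fintype.card V) :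
    ∃ S : Finset V, (1 - x) * Fintype.card V ≤ #S ∧
      (∀ v, (#{u | (avoidingGraph φ C₀ S).Adj u v} : ℝ) ≤ (1 - d + x) * Fintype.card V) ∧
      ∀ v ∈ S, (1 - d - 3 * x) * Fintype.card V ≤ #{u | (avoidingGraph φ C₀ S).Adj u v} := by
  set n : ℝ := ((Fintype.card V : ℕ) : ℝ) with hn'
  have hn0 : 0 < n := by nlinarith [show (0 : ℝ) ≤ n by positivity]
  obtain ⟨S, hS, hSf⟩ := exists_large_set_of_deviation_le φ C₀ (y := x * n) hE
  have hS1 : n - #S ≤ x * n := by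
    refine le_of_mul_le_mul_left (hS.trans (hEx.trans (le_of_eq ?_))) (show 0 < x * n by positivity)
    ring
  refine ⟨S, by linarith, fun v => ?_, fun v hv => ?_⟩
  · by_cases hv : v ∈ S
    · have h1 := (abs_le.1 (hSf v hv)).1
      rw [sum_deviation_eq] at h1
      have h2 : (#{u | (avoidingGraph φ C₀ S).Adj u v} : ℝ) ≤
          #{u | u ≠ v ∧ φ s(u, v) ∉ C₀} := by
        refine Nat.cast_le.2 (Finset.card_le_card fun u hu => ?_)
        rw [Finset.mem_filter] at hu ⊢
        exact ⟨hu.1, hu.2.1, hu.2.2.2.2⟩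
      nlinarith
    · rw [Finset.filter_false_of_mem fun u _ h => hv h.2.2.1]
      simp only [Finset.card_empty, Nat.cast_zero]
      have : 0 ≤ 1 - d + x := by linarith
      positivity
  · have h1 := (abs_le.1 (hSf v hv)).2
    rw [sum_deviation_eq] at h1
    have h2 : #{u | u ≠ v ∧ φ s(u, v) ∉ C₀} ≤
        #{u | (avoidingGraph φ C₀ S).Adj u v} + #Sᶜ := by
      refine (Finset.card_le_card fun u hu => ?_).trans (Finset.card_union_le _ _)
      rw [Finset.mem_union, Finset.mem_filter, Finset.mem_compl]
      rw [Finset.mem_filter] at hu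
      by_cases huS : u ∈ S
      · exact Or.inl ⟨hu.1, hu.2.1, huS, hv, hu.2.2⟩
      · exact Or.inr huS
    rw [Finset.card_compl] at h2
    have h3 : (#{u | u ≠ v ∧ φ s(u, v) ∉ C₀} : ℝ) ≤
        #{u | (avoidingGraph φ C₀ S).Adj u v} + (n - #S) := by
      rw [hn', ← Nat.cast_sub (Finset.card_le_univ _)]
      exact_mod_cast h2
    nlinarith

lemma card_rainbowPaths_ge [Nonempty V] (G : SimpleGraph V) [DecidableRel G.Adj] {L : ℕ}
    (hL : ∀ v c, #{u | v ≠ u ∧ φ s(v, u) = c} ≤ L) (S : Finset V)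
    (hG : ∀ u v, G.Adj u v → u ∈ S) {ρ x : ℝ} (hx1 : x ≤ 1) (hρ : 0 ≤ ρ)
    (hS : (1 - x) * Fintype.card V ≤ #S)
    (hdeg : ∀ v ∈ S, ρ * Fintype.card V ≤ #{u | G.Adj u v}) (k : ℕ)
    (hLx : (1 + L : ℝ) ≤ 2 * x * Fintype.card V) :
    ((1 - x) * ρ ^ k - 2 * (k + 1) ^ 2 * x) * (Fintype.card V : ℝ) ^ (k + 1) ≤
      #(rainbowPaths G φ k) := by
  have z : V := Classical.arbitrary V
  set n : ℝ := ((Fintype.card V : ℕ) : ℝ) with hn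
  have hn0 : 0 ≤ n := by positivity
  have h1 : #S * ⌈ρ * n⌉₊ ^ k ≤ #(walksOf G k) :=
    (card_mul_pow_le_card_walksOf G S _ hG (fun v hv => Nat.ceil_le.2 (hdeg v hv)) k).trans
      (Finset.card_le_card (Finset.filter_subset _ _))
  have h2 := h1.trans (card_walksOf_le_card_rainbowPaths_add G φ z hL k)
  have h3 : (#S : ℝ) * (⌈ρ * n⌉₊ : ℝ) ^ k ≤ #(rainbowPaths G φ k) +
      ((k + 1) ^ 2 + k ^ 2 * L) * n ^ k := by
    rw [hn]; exact_mod_cast h2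
  have h4 : ((1 - x) * n) * (ρ * n) ^ k ≤ (#S : ℝ) * (⌈ρ * n⌉₊ : ℝ) ^ k := by
    have : 0 ≤ 1 - x := by linarith
    gcongr
    exact Nat.le_ceil _
  have h5 : (((k : ℝ) + 1) ^ 2 + k ^ 2 * L) * n ^ k ≤ ((k + 1) ^ 2 * (2 * x * n)) * n ^ k := by
    refine mul_le_mul_of_nonneg_right ?_ (by positivity)
    have hL0 : (0 : ℝ) ≤ L := by positivity
    have hk0 : (0 : ℝ) ≤ k := by positivity
    have : (k : ℝ) ^ 2 ≤ (k + 1) ^ 2 := by nlinarith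
    nlinarith [sq_nonneg ((k : ℝ) + 1)]
  have h6 : ((1 - x) * n) * (ρ * n) ^ k = (1 - x) * ρ ^ k * n ^ (k + 1) := by
    rw [mul_pow, pow_succ]; ring
  have h7 : ((k + 1) ^ 2 * (2 * x * n)) * n ^ k = 2 * (k + 1) ^ 2 * x * n ^ (k + 1) := by
    rw [pow_succ]; ring
  rw [sub_mul]
  linarith

end good_graph

section many_paths

lemma exists_many_rainbow_paths (m : ℕ) {a : ℝ} (ha0 : 0 ≤ a) (ha : a < 1) : ∃ δ : ℝ, 0 < δ ∧
    ∀ (V : Type) [Fintype V] [DecidableEq V] (φ : Sym2 V → ℕ) (C₀ : Set ℕ) (L g t : ℕ)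
      (d E x η B : ℝ), 0 ≤ d → d ≤ 1 / 4 → 0 < x → x ≤ 1 / 16 → x ≤ d →
      (∀ A B : Finset V, |∑ a ∈ A, ∑ b ∈ B, deviation φ C₀ d a b| ≤ E) →
      2 * E ≤ x ^ 2 * (Fintype.card V : ℝ) ^ 2 → 1 ≤ x * Fintype.card V →
      (∀ v c, #{u | v ≠ u ∧ φ s(v, u) = c} ≤ L) →
      (∀ c, #{z : V × V | z.1 ≠ z.2 ∧ φ s(z.1, z.2) = c} ≤ g) →
      L ≤ η * Fintype.card V → 1 ≤ L → η ≤ x → Fintype.card V ≤ g →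
      g ≤ (1 + x) * Fintype.card V → 2 * t ≤ Fintype.card V →
      η * (4 * (m + 3) * 2 ^ (m + 1)) ≤ δ →
      B * ((1 + x) * (1 - d + x) ^ (m + 1)) ≤
        a * ((1 - x) * (1 - d - 3 * x) ^ (m + 2) - 2 * (m + 3) ^ 2 * x) →
      ∃ M : Finset (Fin t × (Fin (m + 3) → V)),
        (∀ x ∈ M, Function.Injective x.2 ∧ (Function.Injective fun j => φ (edgeAt x.2 j)) ∧
          ∀ j, φ (edgeAt x.2 j) ∉ C₀) ∧
        (∀ x ∈ M, ∀ y ∈ M, x ≠ y → (∀ i j, edgeAt x.2 i ≠ edgeAt y.2 j) ∧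
          (x.1 = y.1 → (∀ i j, x.2 i ≠ y.2 j) ∧
            ∀ i j, φ (edgeAt x.2 i) ≠ φ (edgeAt y.2 j))) ∧
        B * (t * Fintype.card V) ≤ #M * (m + 3) := by
  classical
  obtain ⟨δ, hδ, h⟩ := exists_disjoint_rainbowPaths m ha
  refine ⟨δ, hδ, fun V _ _ φ C₀ L g t d E x η B hd hd4 hx hx1 hxd hE hEx hxn hL hg hLη hL1 hηx hng
    hgn htn hηδ hB => ?_⟩
  set n : ℝ := ((Fintype.card V : ℕ) : ℝ) with hn
  have hn0 : 0 < n := by nlinarith [show (0 : ℝ) ≤ n by positivity]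
  have hne : Nonempty V := Fintype.card_pos_iff.1 ((Nat.cast_pos (α := ℝ)).1 hn0)
  obtain ⟨S, hS, hup, hlow⟩ := exists_almost_regular_avoidingGraph φ C₀ hd (by linarith) hx hE hEx
    hxn
  set G := avoidingGraph φ C₀ S with hG
  set Δ := ⌊(1 - d + x) * n⌋₊ with hΔ
  have hΔ1 : (Δ : ℝ) ≤ (1 - d + x) * n := Nat.floor_le (by
    have : 0 ≤ 1 - d + x := by linarith
    positivity)
  have hΔ2 : n / 2 ≤ Δ := by
    have := Nat.lt_floor_add_one ((1 - d + x) * n)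
    rw [← hΔ] at this
    nlinarith
  have hngR : n ≤ g := by rw [hn]; exact_mod_cast hng
  have hR := card_rainbowPaths_ge φ G hL S (fun u v h => h.2.1) (ρ := 1 - d - 3 * x) (x := x)
    (by linarith) (by linarith) hS hlow (m + 2) (by rw [← hn]; nlinarith)
  obtain ⟨M, hM, hdis, hcard⟩ := h V ℕ φ G L g Δ t hne hL hg
    (fun v => Nat.le_floor (hup v)) (htn.trans hng)
    (by
      have : (Δ : ℝ) ≤ g := by nlinarith
      exact_mod_cast this) (by omega)
    (by
      have : (g : ℝ) ≤ 2 * n := by nlinarith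
      rw [hn] at this
      exact_mod_cast this) hL1
    (by
      push_cast
      rw [← hn]
      calc 4 * ((m : ℝ) + 3) ^ 2 * (L * n ^ (m + 1))
          ≤ 4 * ((m : ℝ) + 3) ^ 2 * ((η * n) * n ^ (m + 1)) := by gcongr
        _ = (η * (4 * (m + 3) * 2 ^ (m + 1))) * ((m + 3) * (n * (n / 2) ^ (m + 1))) := by
          rw [div_pow]
          field_simp
        _ ≤ δ * ((m + 3) * (g * Δ ^ (m + 1))) := by gcongr)
  refine ⟨M, fun p hp => ?_, hdis, ?_⟩
  · have h1 := Finset.mem_filter.1 (hM p hp)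
    refine ⟨h1.2.1, h1.2.2, fun j => ?_⟩
    exact ((Finset.mem_filter.1 h1.1).2 j).2.2.2
  · have hpos : 0 < (1 + x) * (1 - d + x) ^ (m + 1) * n ^ (m + 2) := by
      have : 0 < 1 - d + x := by linarith
      positivity
    refine le_of_mul_le_mul_right ?_ hpos
    rw [← hn] at hR
    push_cast at hR hcard
    have e : ((m : ℝ) + 2 + 1) = m + 3 := by ring
    rw [e] at hR
    calc B * (t * n) * ((1 + x) * (1 - d + x) ^ (m + 1) * n ^ (m + 2))
        = (B * ((1 + x) * (1 - d + x) ^ (m + 1))) * (t * n ^ (m + 2 + 1)) := by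
          rw [pow_succ n (m + 2)]; ring
      _ ≤ (a * ((1 - x) * (1 - d - 3 * x) ^ (m + 2) - 2 * (m + 3) ^ 2 * x)) *
          (t * n ^ (m + 2 + 1)) := by gcongr
      _ = (a * t) * (((1 - x) * (1 - d - 3 * x) ^ (m + 2) - 2 * (m + 3) ^ 2 * x) *
          n ^ (m + 2 + 1)) := by ring
      _ ≤ (a * t) * #(rainbowPaths G φ (m + 2)) := by gcongr
      _ = a * (t * #(rainbowPaths G φ (m + 2))) := by ring
      _ ≤ #M * ((m + 3) * (g * Δ ^ (m + 1))) := hcard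
      _ ≤ #M * ((m + 3) * (((1 + x) * n) * ((1 - d + x) * n) ^ (m + 1))) := by gcongr
      _ = _ := by rw [mul_pow, pow_succ n (m + 1)]; ring

end many_paths

section cycles

lemma exists_small_parameter (m : ℕ) {a d B c : ℝ} (hd1 : d < 1) (hB : B < a * (1 - d))
    (hc : 0 < c) : ∃ x : ℝ, 0 < x ∧ x < c ∧ B * ((1 + x) * (1 - d + x) ^ (m + 1)) ≤
      a * ((1 - x) * (1 - d - 3 * x) ^ (m + 2) - 2 * (m + 3) ^ 2 * x) := by
  have h1 : ∀ᶠ x : ℝ in nhds 0, B * ((1 + x) * (1 - d + x) ^ (m + 1)) <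
      a * ((1 - x) * (1 - d - 3 * x) ^ (m + 2) - 2 * (m + 3) ^ 2 * x) := by
    refine Filter.Tendsto.eventually_lt (Continuous.tendsto (by fun_prop) 0)
      (Continuous.tendsto (by fun_prop) 0) ?_
    have : 0 < (1 - d) ^ (m + 1) := pow_pos (by linarith) _
    have := mul_lt_mul_of_pos_right hB this
    rw [pow_succ _ (m + 1)]
    simp only [add_zero, sub_zero, mul_zero, one_mul]
    linarith
  have h2 : ∀ᶠ x : ℝ in nhdsWithin 0 (Set.Ioi 0), x ∈ Set.Ioo 0 c := Ioo_mem_nhdsGT hc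
  obtain ⟨x, hx, hx'⟩ := ((h1.filter_mono nhdsWithin_le_nhds).and h2).exists
  exact ⟨x, hx'.1, hx'.2, hx.le⟩

lemma card_neighbours_le_of_lBounded {n : ℕ} {φ : Sym2 (Fin n) → ℕ} {l : ℝ}
    (h : Paper.LBounded (⊤ : SimpleGraph (Fin n)) φ l) (v : Fin n) (c : ℕ) :
    #{u | v ≠ u ∧ φ s(v, u) = c} ≤ ⌊l⌋₊ := by
  refine Nat.le_floor ?_
  have := h v c
  rw [Set.ncard_eq_toFinset_card'] at this
  refine le_trans (Nat.cast_le.2 (Finset.card_le_card fun u hu => ?_)) this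
  rw [Set.mem_toFinset]
  exact (Finset.mem_filter.1 hu).2

lemma card_pairs_le_of_gBounded {n : ℕ} {φ : Sym2 (Fin n) → ℕ} {b : ℝ}
    (h : Paper.GBounded (⊤ : SimpleGraph (Fin n)) φ (b / 2)) (c : ℕ) :
    #{z : Fin n × Fin n | z.1 ≠ z.2 ∧ φ s(z.1, z.2) = c} ≤ ⌊b⌋₊ := by
  classical
  refine Nat.le_floor ?_
  have h1 := h c
  have : Fintype (Paper.colourCls (⊤ : SimpleGraph (Fin n)) φ c) := Fintype.ofFinite _
  rw [Set.ncard_eq_toFinset_card'] at h1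
  have h2 : #{z : Fin n × Fin n | z.1 ≠ z.2 ∧ φ s(z.1, z.2) = c} ≤
      2 * #(Paper.colourCls (⊤ : SimpleGraph (Fin n)) φ c).toFinset := by
    refine Finset.card_le_mul_card_image_of_maps_to
      (f := fun z : Fin n × Fin n => s(z.1, z.2)) ?_ 2 ?_
    · intro z hz
      rw [Finset.mem_filter] at hz
      rw [Set.mem_toFinset]
      exact ⟨by simpa using hz.2.1, hz.2.2⟩
    · intro e _
      induction e using Sym2.ind with
      | _ a b =>
        refine (Finset.card_le_card (t := {(a, b), (b, a)}) fun z hz => ?_).trans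
          Finset.card_le_two
        have := (Finset.mem_filter.1 hz).2
        rcases z with ⟨x, y⟩
        simpa using this
  have h3 : (#{z : Fin n × Fin n | z.1 ≠ z.2 ∧ φ s(z.1, z.2) = c} : ℝ) ≤
      2 * #(Paper.colourCls (⊤ : SimpleGraph (Fin n)) φ c).toFinset := by exact_mod_cast h2
  linarith

lemma abs_sum_deviation_le_of_pow_four_le {n L g : ℕ} {y E x η : ℝ}
    (hη1 : η ≤ 1) (hy : y ^ 4 ≤ (n : ℝ) ^ 6 * (2 * (n * L) + g)) (hE0 : 0 ≤ E)
    (hE : 2 * E = x ^ 2 * n ^ 2) (hηx : 48 * η ≤ x ^ 8) (hn : 2 ≤ η * n) (hL : L ≤ η * n)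
    (hg : g ≤ (1 + η) * n) : |y| ≤ E := by
  rw [← pow_le_pow_iff_left₀ (abs_nonneg _) hE0 (show 4 ≠ 0 by norm_num),
    Even.pow_abs ⟨2, rfl⟩]
  refine hy.trans ?_
  have hn0 : (0 : ℝ) ≤ n := by positivity
  have h1 : E ^ 4 = x ^ 8 * n ^ 8 / 16 := by
    rw [show E = x ^ 2 * n ^ 2 / 2 by linarith]; ring
  rw [h1]
  calc (n : ℝ) ^ 6 * (2 * (n * L) + g)
      ≤ (n : ℝ) ^ 6 * (2 * (n * (η * n)) + η * n * n) := by
        gcongr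
        nlinarith
    _ = 48 * η * n ^ 8 / 16 := by ring
    _ ≤ x ^ 8 * n ^ 8 / 16 := by gcongr

lemma exists_long_cycles_of_paths {n m g t : ℕ} (φ : Sym2 (Fin n) → ℕ) (C₀ : Set ℕ)
    (M : Finset (Fin t × (Fin (m + 3) → Fin n)))
    (hM : ∀ x ∈ M, Function.Injective x.2 ∧ (Function.Injective fun j => φ (edgeAt x.2 j)) ∧
      ∀ j, φ (edgeAt x.2 j) ∉ C₀)
    (hdis : ∀ x ∈ M, ∀ y ∈ M, x ≠ y → (∀ i j, edgeAt x.2 i ≠ edgeAt y.2 j) ∧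
      (x.1 = y.1 → (∀ i j, x.2 i ≠ y.2 j) ∧ ∀ i j, φ (edgeAt x.2 i) ≠ φ (edgeAt y.2 j)))
    {α β ε d E : ℝ} (hβ4 : β ≤ 1 / 4) (hβα : 4 * β ≤ α) (hε : 8 * ε = β)
    (hε0 : 0 < ε) (hd0 : 0 < d) (hm1 : 8 < d * ε ^ 4 * m) (hm2 : 2 < ε * m)
    (hcard : (1 - β ^ 2) * (t * n) ≤ #M * (m + 3))
    (hn0 : (0 : ℝ) < n) (hn2 : 4 * ((m : ℝ) + 3) ≤ ε * n)
    (htg : (t : ℝ) + g ≤ 2 * n) (ht2R : (n : ℝ) ≤ 2 * t + 1)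
    (hgn : ∀ c, #{z : Fin n × Fin n | z.1 ≠ z.2 ∧ φ s(z.1, z.2) = c} ≤ g)
    (hdev : ∀ A B : Finset (Fin n), |∑ a ∈ A, ∑ b ∈ B, deviation φ C₀ d a b| ≤ E)
    (hE : 2 * E ≤ d * ε ^ 4 * n ^ 2) :
    ∃ (k : ℕ) (v : Fin k → Fin n) (w : ∀ i : Fin k, (⊤ : SimpleGraph (Fin n)).Walk (v i) (v i)),
      (1 - α) * n / 2 ≤ (k : ℝ) ∧ (∀ i, (w i).IsCycle) ∧ (∀ i, ((w i).edges.map φ).Nodup) ∧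
      (∀ i, (1 - α) * n ≤ ((w i).length : ℝ)) ∧
      (∀ i j, i ≠ j → ∀ e ∈ (w i).edges, e ∉ (w j).edges) := by
  have hβ : 0 < β := by linarith
  have hε32 : ε ≤ 1 / 32 := by linarith
  have hεm : ε * m ≤ 1 / 32 * m := by gcongr
  have hεn : ε * n ≤ 1 / 32 * n := by gcongr
  have hβn : β * n = 8 * (ε * n) := by rw [← hε]; ring
  have hαn : 4 * β * n ≤ α * n := by gcongr
  have hm0 : (0 : ℝ) ≤ m := by positivity
  have hkr : (((m + 2 : ℕ) : ℝ) + 1) = m + 3 := by push_cast; ring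
  set s := ⌈ε * (m + 3)⌉₊ with hs
  set w := ⌈ε * n / (m + 3)⌉₊ with hw
  have hs1 : ε * (m + 3) ≤ s := Nat.le_ceil _
  have hs2 : (s : ℝ) < ε * (m + 3) + 1 := Nat.ceil_lt_add_one (by positivity)
  have hw1 : ε * n / (m + 3) ≤ w := Nat.le_ceil _
  have hw2 : (w : ℝ) < ε * n / (m + 3) + 1 := Nat.ceil_lt_add_one (by positivity)
  have hw3 : (w : ℝ) * (m + 3) ≤ ε * n + (m + 3) := by
    have h1 : (w : ℝ) * (m + 3) ≤ (ε * n / (m + 3) + 1) * (m + 3) := by gcongr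
    have h2 : (ε * n / (m + 3) + 1) * (m + 3) = ε * n + (m + 3) := by field_simp
    linarith
  have hsw : ε ^ 2 * n ≤ s * w := by
    calc ε ^ 2 * n = (ε * (m + 3)) * (ε * n / (m + 3)) := by field_simp
      _ ≤ s * w := by gcongr
  obtain ⟨N, v, c, hN, hc1, hc2, hc3, hc4⟩ := exists_cycles_of_paths φ C₀ M hM hdis hβ
    (by rw [Fintype.card_fin]; exact_mod_cast hn0) (by rw [hkr, Fintype.card_fin]; exact hcard)
    hd0.le hdev hgn (s := s) (w := w)
    (by
      have : (2 * s + 2 : ℝ) ≤ m + 3 := by linarith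
      exact_mod_cast this)
    (by
      rw [hkr, Fintype.card_fin]
      linarith)
    (by
      rw [hkr, Fintype.card_fin]
      have h1 : ((t : ℝ) + g) * (n / (m + 3)) ≤ d * ε ^ 4 * n ^ 2 / 4 := by
        rw [← mul_div_assoc, div_le_iff₀ (by positivity)]
        calc ((t : ℝ) + g) * n ≤ 2 * n * n := by gcongr
          _ = 8 * (n ^ 2 / 4) := by ring
          _ ≤ (d * ε ^ 4 * (m + 3)) * (n ^ 2 / 4) := by
            gcongr
            linarith [show 0 < d * ε ^ 4 by positivity]
          _ = _ := by ring
      have h3 : d * (ε ^ 2 * n) ^ 2 ≤ d * (s * w) ^ 2 := by gcongr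
      have h4 : 0 < d * ε ^ 4 * n ^ 2 := by positivity
      have h5 : d * (ε ^ 2 * n) ^ 2 = d * ε ^ 4 * n ^ 2 := by ring
      linarith)
  refine ⟨N, v, c, ?_, hc1, hc2, fun i => ?_, hc4⟩
  · refine le_trans ?_ hN
    have := mul_le_mul_of_nonneg_left ht2R (show 0 ≤ 1 - β by linarith)
    linarith
  · refine le_trans ?_ (hc3 i)
    rw [hkr, Fintype.card_fin]
    have h1 : (1 - β - 5 * ε) * n / (m + 3) ≤ (1 - β) * (n / (m + 3)) - 4 * w := by
      rw [div_le_iff₀ (by positivity), sub_mul _ (4 * (w : ℝ)), mul_assoc (1 - β),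
        div_mul_cancel₀ _ (by positivity)]
      linarith
    have h2 : (1 - 3 * ε) * (m + 3) ≤ (m : ℝ) + 3 - 2 * s := by linarith
    have h3 : 0 ≤ (1 - 3 * ε) * ((m : ℝ) + 3) := by
      have : 0 ≤ 1 - 3 * ε := by linarith
      positivity
    have h4 : 0 ≤ (1 - β - 5 * ε) * n / (m + 3) := by
      have : 0 ≤ 1 - β - 5 * ε := by linarith
      positivity
    calc (1 - α) * n ≤ ((1 - β - 5 * ε) * (1 - 3 * ε)) * n :=
          mul_le_mul_of_nonneg_right (by linarith [show 0 ≤ 3 * ε * (β + 5 * ε) by positivity]) hn0.le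
      _ = ((1 - β - 5 * ε) * n / (m + 3)) * ((1 - 3 * ε) * (m + 3)) := by field_simp
      _ ≤ _ := mul_le_mul h1 h2 h3 (h4.trans h1)

lemma exists_cycles_of_parameters (m q : ℕ) {α β ε d : ℝ} (hβ4 : β ≤ 1 / 4)
    (hβα : 4 * β ≤ α) (hε : 8 * ε = β) (hε0 : 0 < ε) (hd : d = 1 / q) (hd0 : 0 < d)
    (hd64 : d ≤ 1 / 64) (hm1 : 8 < d * ε ^ 4 * m) (hm2 : 2 < ε * m) :
    ∃ δ : ℝ, 0 < δ ∧ ∀ x η : ℝ, 0 < x → x ≤ d → x ^ 2 ≤ d * ε ^ 4 → 0 < η → η ≤ x →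
      48 * η ≤ x ^ 8 → η * (4 * (m + 3) * 2 ^ (m + 1)) ≤ δ →
      (1 - β ^ 2) * ((1 + x) * (1 - d + x) ^ (m + 1)) ≤
        (1 - β ^ 2 / 4) * ((1 - x) * (1 - d - 3 * x) ^ (m + 2) - 2 * (m + 3) ^ 2 * x) →
      ∀ n : ℕ, 2 ≤ η * n → 4 * ((m : ℝ) + 3) ≤ ε * n → ∀ φ : Sym2 (Fin n) → ℕ,
      GBounded (⊤ : SimpleGraph (Fin n)) φ ((1 + η) * n / 2) →
      LBounded (⊤ : SimpleGraph (Fin n)) φ (η * n) →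
      ∃ (k : ℕ) (v : Fin k → Fin n)
        (w : ∀ i : Fin k, (⊤ : SimpleGraph (Fin n)).Walk (v i) (v i)),
        (1 - α) * n / 2 ≤ (k : ℝ) ∧ (∀ i, (w i).IsCycle) ∧ (∀ i, ((w i).edges.map φ).Nodup) ∧
        (∀ i, (1 - α) * n ≤ ((w i).length : ℝ)) ∧
        (∀ i j, i ≠ j → ∀ e ∈ (w i).edges, e ∉ (w j).edges) := by
  have hβ : 0 < β := by linarith
  have hβ2 : β ^ 2 ≤ 1 / 16 := by nlinarith
  have hq0 : (0 : ℝ) < q := by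
    rw [hd] at hd0
    exact one_div_pos.1 hd0
  obtain ⟨δ, hδ, hpaths⟩ := exists_many_rainbow_paths m (a := 1 - β ^ 2 / 4) (by linarith)
    (by linarith [show 0 < β ^ 2 by positivity])
  refine ⟨δ, hδ, fun x η hx hxd' hx2 hη hη1 hη2 hη3 hxB n hn1 hn2 φ hg hl => ?_⟩
  have hn0 : (0 : ℝ) < n := by
    by_contra h
    linarith [mul_nonpos_of_nonneg_of_nonpos hη.le (not_lt.1 h)]
  have hηn : η * n ≤ x * n := by gcongr
  have hxn : x * n ≤ 1 / 64 * n := by gcongr; linarith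
  set L := ⌊η * n⌋₊ with hL
  set g := ⌊(1 + η) * n⌋₊ with hg'
  set t := n / 2 with ht
  have hL1 : (L : ℝ) ≤ η * n := Nat.floor_le (by positivity)
  have hg1 : (g : ℝ) ≤ (1 + η) * n := Nat.floor_le (by positivity)
  have ht1 : 2 * t ≤ n := Nat.mul_div_le n 2
  have ht2 : n ≤ 2 * t + 1 := by omega
  have ht1R : 2 * (t : ℝ) ≤ n := by exact_mod_cast ht1
  have ht2R : (n : ℝ) ≤ 2 * t + 1 := by exact_mod_cast ht2
  have hLn := card_neighbours_le_of_lBounded hl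
  have hgn := card_pairs_le_of_gBounded hg
  rw [← hL] at hLn
  rw [← hg'] at hgn
  obtain ⟨C₀, hC₀⟩ := exists_reservoir_nat φ L g q (by exact_mod_cast hq0) hLn hgn
  rw [← hd, Fintype.card_fin] at hC₀
  obtain ⟨E, hE⟩ : ∃ E : ℝ, 2 * E = x ^ 2 * n ^ 2 := ⟨x ^ 2 * n ^ 2 / 2, by ring⟩
  have hE0 : 0 ≤ E := by linarith [show 0 ≤ x ^ 2 * (n : ℝ) ^ 2 by positivity]
  have hdev : ∀ A B : Finset (Fin n), |∑ a ∈ A, ∑ b ∈ B, deviation φ C₀ d a b| ≤ E :=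
    fun A B => abs_sum_deviation_le_of_pow_four_le (by linarith) (hC₀ A B) hE0 hE hη2
      hn1 hL1 hg1
  obtain ⟨M, hM, hdis, hcard⟩ := hpaths (Fin n) φ C₀ L g t d E x η (1 - β ^ 2) hd0.le
    (by linarith) hx (by linarith) hxd' hdev (by rw [Fintype.card_fin]; exact hE.le)
    (by rw [Fintype.card_fin]; linarith) hLn hgn (by rw [Fintype.card_fin]; exact hL1)
    (Nat.le_floor (by push_cast; linarith)) hη1
    (by rw [Fintype.card_fin]; exact Nat.le_floor (by linarith))
    (by rw [Fintype.card_fin]; linarith) (by rw [Fintype.card_fin]; exact ht1) hη3 hxB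
  rw [Fintype.card_fin] at hcard
  exact exists_long_cycles_of_paths φ C₀ M hM hdis hβ4 hβα hε hε0 hd0 hm1 hm2 hcard hn0 hn2
    (by linarith) ht2R hgn hdev (by rw [hE]; gcongr)

end cycles

end

/-- Corollary 1.1: any `(1+η)n/2`-bounded, locally `ηn`-bounded edge-colouring of `K_n`
contains `(1-α)n/2` edge-disjoint rainbow cycles of length at least `(1-α)n`. -/
theorem stmt_0 :
    ∀ α : ℝ, 0 < α →
    ∃ η : ℝ, 0 < η ∧ ∃ n₀ : ℕ, ∀ n : ℕ, n₀ ≤ n →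
    ∀ φ : Sym2 (Fin n) → ℕ,
      GBounded (⊤ : SimpleGraph (Fin n)) φ ((1 + η) * n / 2) →
      LBounded (⊤ : SimpleGraph (Fin n)) φ (η * n) →
      ∃ (k : ℕ) (v : Fin k → Fin n)
        (w : ∀ i : Fin k, (⊤ : SimpleGraph (Fin n)).Walk (v i) (v i)),
        (1 - α) * n / 2 ≤ (k : ℝ) ∧
        (∀ i, (w i).IsCycle) ∧
        (∀ i, ((w i).edges.map φ).Nodup) ∧
        (∀ i, (1 - α) * n ≤ ((w i).length : ℝ)) ∧
        (∀ i j, i ≠ j → ∀ e ∈ (w i).edges, e ∉ (w j).edges) := by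
  intro α hα
  obtain ⟨β, hβ, hβ4, hβα⟩ : ∃ β : ℝ, 0 < β ∧ β ≤ 1 / 4 ∧ 4 * β ≤ α :=
    ⟨min α 1 / 4, by positivity, by linarith [min_le_right α 1], by linarith [min_le_left α 1]⟩
  obtain ⟨ε, hε⟩ : ∃ ε : ℝ, 8 * ε = β := ⟨β / 8, by ring⟩
  have hε0 : 0 < ε := by linarith
  obtain ⟨q, hq⟩ := exists_nat_gt (4 / β ^ 2)
  have hq0 : (0 : ℝ) < q := lt_trans (by positivity) hq
  obtain ⟨d, hd⟩ : ∃ d : ℝ, d = 1 / q := ⟨_, rfl⟩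
  have hd0 : 0 < d := by rw [hd]; positivity
  have hdβ : d ≤ β ^ 2 / 4 := by
    rw [hd, div_le_iff₀ hq0]
    rw [div_lt_iff₀ (by positivity)] at hq
    linarith
  have hβ2 : β ^ 2 ≤ 1 / 16 := by nlinarith
  have hd64 : d ≤ 1 / 64 := by linarith
  obtain ⟨m, hm⟩ := exists_nat_gt (8 / (d * ε ^ 4) + 2 / ε)
  have hm1 : 8 < d * ε ^ 4 * m := by
    rw [← div_lt_iff₀' (by positivity)]
    have : 0 < 2 / ε := by positivity
    linarith
  have hm2 : 2 < ε * m := by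
    rw [← div_lt_iff₀' hε0]
    have : 0 < 8 / (d * ε ^ 4) := by positivity
    linarith
  obtain ⟨δ, hδ, hcycles⟩ := exists_cycles_of_parameters m q hβ4 hβα hε hε0 hd hd0 hd64 hm1 hm2
  obtain ⟨x, hx, hxd, hxB⟩ := exists_small_parameter m (a := 1 - β ^ 2 / 4) (d := d)
    (B := 1 - β ^ 2) (c := d * ε ^ 2) (by linarith)
    (by nlinarith [show 0 < β ^ 2 by positivity]) (by positivity)
  have hε2 : ε ^ 2 ≤ 1 := by nlinarith
  have hxd' : x ≤ d := by nlinarith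
  have hx2 : x ^ 2 ≤ d * ε ^ 4 := by
    calc x ^ 2 ≤ (d * ε ^ 2) ^ 2 := by gcongr
      _ = d * (d * ε ^ 4) := by ring
      _ ≤ 1 * (d * ε ^ 4) := by gcongr; linarith
      _ = d * ε ^ 4 := one_mul _
  let η : ℝ := min x (min (x ^ 8 / 48) (δ / (4 * (m + 3) * 2 ^ (m + 1))))
  have hη : 0 < η := by positivity
  have hη1 : η ≤ x := min_le_left _ _
  have hη2 : 48 * η ≤ x ^ 8 := by
    have : η ≤ x ^ 8 / 48 := (min_le_right _ _).trans (min_le_left _ _)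
    linarith
  have hη3 : η * (4 * (m + 3) * 2 ^ (m + 1)) ≤ δ :=
    (le_div_iff₀ (by positivity)).1 ((min_le_right _ _).trans (min_le_right _ _))
  refine ⟨η, hη, ⌈2 / η + 4 * (m + 3) / ε⌉₊, fun n hn φ hg hl => ?_⟩
  have hn := Nat.le_of_ceil_le hn
  have hp1 : 0 < 2 / η := by positivity
  have hp2 : 0 < 4 * ((m : ℝ) + 3) / ε := by positivity
  have hn1 : 2 ≤ η * n := (div_le_iff₀' hη).1 (by linarith)
  have hn2 : 4 * ((m : ℝ) + 3) ≤ ε * n := (div_le_iff₀' hε0).1 (by linarith)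
  exact hcycles x η hx hxd' hx2 hη hη1 hη2 hη3 hxB n hn1 hn2 φ hg hl
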